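/- Let 1 < p < N, γ ∈ (0, γ_p), and let v : ℝ^N \ {0} → ℝ be positive and continuously differentiable on ℝ^N \ {0}, satisfying weakly -Δ_p v - γ |x|^{-p} v^{p-1} = 0 in ℝ^N \ {0}, i.e. for every smooth φ compactly supported in ℝ^N \ {0}: ∫ |∇v|^{p-2} ⟨∇v, ∇φ⟩ dx = γ ∫ |x|^{-p} v^{p-1} φ dx. Assume v(x) → +∞ as |x| → 0, and that there exist constants c, C > 0 and R₁ > 0 such that c |x|^{-γ₂} ≤ v(x) ≤ C |x|^{-γ₂} for all |x| > R₁. Then v is radial and strictly radially decreasing: there exists a strictly antitone function g : (0,∞) → ℝ with v(x) = g(|x|) for all x ≠ 0. -/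

import Mathlib

open MeasureTheory Real Filter RealInnerProductSpace

namespace RS

/-! ### Pointwise inequalities -/

/-- `|y|^{p-2} y·e` -/
noncomputable def kk (p q s : ℝ) : ℝ := q ^ (p - 2) * s
/-- monotonicity gap -/
noncomputable def DD (p q s : ℝ) : ℝ := q ^ p - s - kk p q s + 1
/-- convexity gap -/
noncomputable def EE (p q s : ℝ) : ℝ := (p - 1) * q ^ p - p * kk p q s + 1

lemma qp_eq {p q : ℝ} (hp : 1 < p) (hq : 0 ≤ q) : q ^ p = q * q ^ (p - 1) := by
  rcases hq.eq_or_lt with h | h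
  · subst h
    rw [Real.zero_rpow (by linarith)]; simp
  · rw [← Real.rpow_one_add' hq (by linarith)]; congr 1; ring

lemma qm_sub {p q s : ℝ} (hp : 1 < p) (hs : |s| ≤ q) :
    q ^ (p - 1) - kk p q s = q ^ (p - 2) * (q - s) := by
  have hq : 0 ≤ q := (abs_nonneg s).trans hs
  unfold kk
  have : q ^ (p - 1) = q ^ (p - 2) * q := by
    rcases hq.eq_or_lt with h | h
    · subst h
      rw [Real.zero_rpow (by linarith)]; simp
    · rw [← Real.rpow_add_one h.ne']; congr 1; ring
  rw [this]; ring

lemma kk_le {p q s : ℝ} (hp : 1 < p) (hs : |s| ≤ q) : kk p q s ≤ q ^ (p - 1) := by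
  have h := qm_sub hp hs
  have hq : 0 ≤ q := (abs_nonneg s).trans hs
  have : 0 ≤ q ^ (p - 2) * (q - s) :=
    mul_nonneg (Real.rpow_nonneg hq _) (by linarith [le_abs_self s])
  linarith

lemma abs_kk_le {p q s : ℝ} (hp : 1 < p) (hs : |s| ≤ q) : |kk p q s| ≤ q ^ (p - 1) := by
  rw [abs_le]
  refine ⟨?_, kk_le hp hs⟩
  have := kk_le (q := q) (s := -s) hp (by rwa [abs_neg])
  unfold kk at *
  linarith

lemma DD_eq {p q s : ℝ} (hp : 1 < p) (hs : |s| ≤ q) :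
    DD p q s = (1 - q) * (1 - q ^ (p - 1)) + (q - s) + (q ^ (p - 1) - kk p q s) := by
  have hq : 0 ≤ q := (abs_nonneg s).trans hs
  unfold DD
  rw [qp_eq hp hq]; ring

lemma prod_eq {p q : ℝ} (hp : 1 < p) (hq : 0 ≤ q) :
    (1 - q) * (1 - q ^ (p - 1)) = |1 - q| * |1 - q ^ (p - 1)| := by
  rcases le_total q 1 with h | h
  · have : q ^ (p - 1) ≤ 1 := Real.rpow_le_one hq h (by linarith)
    rw [abs_of_nonneg (by linarith), abs_of_nonneg (by linarith)]
  · have : 1 ≤ q ^ (p - 1) := Real.one_le_rpow h (by linarith)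
    rw [abs_of_nonpos (by linarith), abs_of_nonpos (by linarith)]; ring

/-- the three parts of `DD` are dominated by it -/
lemma DD_parts {p q s : ℝ} (hp : 1 < p) (hs : |s| ≤ q) :
    0 ≤ q - s ∧ 0 ≤ q ^ (p - 1) - kk p q s ∧ 0 ≤ |1 - q| * |1 - q ^ (p - 1)| ∧
    DD p q s = |1 - q| * |1 - q ^ (p - 1)| + (q - s) + (q ^ (p - 1) - kk p q s) := by
  have hq : 0 ≤ q := (abs_nonneg s).trans hs
  refine ⟨by linarith [le_abs_self s], by linarith [kk_le hp hs], by positivity, ?_⟩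
  rw [DD_eq hp hs, prod_eq hp hq]

lemma DD_nonneg {p q s : ℝ} (hp : 1 < p) (hs : |s| ≤ q) : 0 ≤ DD p q s := by
  obtain ⟨h1, h2, h3, h4⟩ := DD_parts hp hs
  linarith

lemma EE_nonneg {p q s : ℝ} (hp : 1 < p) (hs : |s| ≤ q) : 0 ≤ EE p q s := by
  have hq : 0 ≤ q := (abs_nonneg s).trans hs
  have h1 := kk_le hp hs
  have hc : (p / (p - 1)).HolderConjugate p := by
    have : p.HolderConjugate (p / (p - 1)) := by
      simpa [Real.conjExponent] using Real.HolderConjugate.conjExponent hp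
    exact this.symm
  have h2 := Real.young_inequality_of_nonneg (a := q ^ (p - 1)) (b := 1)
    (Real.rpow_nonneg hq _) zero_le_one hc
  rw [← Real.rpow_mul hq, mul_div_cancel₀ p (by linarith : p - 1 ≠ 0), Real.one_rpow, mul_one] at h2
  have h3 : q ^ p / (p / (p - 1)) + 1 / p = ((p - 1) * q ^ p + 1) / p := by
    have : p - 1 ≠ 0 := by linarith
    field_simp
  rw [h3, le_div_iff₀ (by linarith)] at h2
  unfold EE
  nlinarith

lemma EE_le {p q s : ℝ} (hp : 1 < p) (hs : |s| ≤ q) : EE p q s ≤ p * DD p q s := by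
  have hq : 0 ≤ q := (abs_nonneg s).trans hs
  have h2 := one_add_mul_self_le_rpow_one_add (s := q - 1) (by linarith) hp.le
  rw [add_sub_cancel] at h2
  have h3 := le_abs_self s
  unfold EE DD
  nlinarith

lemma DD_zero {p q s : ℝ} (hp : 1 < p) (hs : |s| ≤ q) (h : DD p q s = 0) : q = 1 ∧ s = 1 := by
  have hq : 0 ≤ q := (abs_nonneg s).trans hs
  obtain ⟨h1, h2, h3, h4⟩ := DD_parts hp hs
  have h5 : |1 - q| * |1 - q ^ (p - 1)| = 0 := by linarith
  have h6 : q = s := by linarith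
  have : q = 1 := by
    rcases mul_eq_zero.1 h5 with h | h
    · have := abs_eq_zero.1 h; linarith
    · have := abs_eq_zero.1 h
      have h7 : q ^ (p - 1) = 1 := by linarith
      exact (Real.rpow_left_injOn (by linarith : p - 1 ≠ 0)) hq (zero_le_one' ℝ)
        (by simpa using h7)
  exact ⟨this, by linarith⟩

lemma qp_bound {p : ℝ} (hp : 1 < p) : ∃ C : ℝ, 1 ≤ C ∧ ∀ q s : ℝ, |s| ≤ q →
    q ^ p ≤ C * (1 + DD p q s) := by
  set Q : ℝ := max 4 (4 ^ (1 / (p - 1))) with hQ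
  have hQ4 : 4 ≤ Q := le_max_left _ _
  refine ⟨Q ^ p + 2, by linarith [Real.rpow_nonneg (by linarith : (0:ℝ) ≤ Q) p], ?_⟩
  intro q s hs
  have hq : 0 ≤ q := (abs_nonneg s).trans hs
  obtain ⟨h1, h2, h3, h4⟩ := DD_parts hp hs
  have hD := DD_nonneg hp hs
  have hQp : 0 ≤ Q ^ p := Real.rpow_nonneg (by linarith) _
  rcases le_total q Q with h | h
  · have : q ^ p ≤ Q ^ p := Real.rpow_le_rpow hq h (by linarith)
    nlinarith
  · have e1 : 4 ≤ q ^ (p - 1) := by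
      have : (4:ℝ) ^ (1 / (p - 1)) ≤ q := (le_max_right _ _).trans h
      have h5 := Real.rpow_le_rpow (by positivity) this (by linarith : 0 ≤ p - 1)
      rwa [← Real.rpow_mul (by norm_num), one_div, inv_mul_cancel₀ (by linarith), Real.rpow_one] at h5
    have e2 : 4 ≤ q := hQ4.trans h
    have e3 := qp_eq hp hq
    rw [← prod_eq hp hq] at h4
    have : q ^ p ≤ 2 * DD p q s := by
      rw [e3]; nlinarith
    nlinarith

lemma delta_small {p : ℝ} (hp : 1 < p) {κ : ℝ} (hκ : 0 < κ) : ∃ C : ℝ, 0 ≤ C ∧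
    ∀ q s : ℝ, |s| ≤ q → |1 - kk p q s| ≤ κ + C * DD p q s := by
  have hcont : ContinuousAt (fun q : ℝ => q ^ (p - 1)) 1 :=
    Real.continuousAt_rpow_const _ _ (Or.inl one_ne_zero)
  obtain ⟨d, hd, hd'⟩ := Metric.continuousAt_iff.1 hcont κ hκ
  refine ⟨1 / d + 1, by positivity, ?_⟩
  intro q s hs
  have hq : 0 ≤ q := (abs_nonneg s).trans hs
  obtain ⟨h1, h2, h3, h4⟩ := DD_parts hp hs
  have hD := DD_nonneg hp hs
  have t1 : |1 - kk p q s| ≤ |1 - q ^ (p - 1)| + (q ^ (p - 1) - kk p q s) := by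
    calc |1 - kk p q s| = |(1 - q ^ (p - 1)) + (q ^ (p - 1) - kk p q s)| := by ring_nf
      _ ≤ _ := (abs_add_le _ _).trans (by rw [abs_of_nonneg h2])
  have t2 : |1 - q ^ (p - 1)| ≤ κ + (1 / d) * (|1 - q| * |1 - q ^ (p - 1)|) := by
    rcases lt_or_ge |1 - q| d with h | h
    · have := hd' (x := q) (by rwa [Real.dist_eq, abs_sub_comm])
      rw [Real.dist_eq, Real.one_rpow, abs_sub_comm] at this
      have : 0 ≤ 1 / d * (|1 - q| * |1 - q ^ (p - 1)|) := by positivity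
      linarith
    · have : 1 ≤ (1 / d) * |1 - q| := by
        rw [one_div, ← div_eq_inv_mul, le_div_iff₀ hd]; linarith
      nlinarith [abs_nonneg (1 - q ^ (p - 1))]
  have : 0 ≤ 1 / d := by positivity
  nlinarith

lemma grad_small {p : ℝ} (hp : 1 < p) {κ : ℝ} (hκ : 0 < κ) : ∃ C : ℝ, 0 ≤ C ∧
    ∀ q s : ℝ, |s| ≤ q → Real.sqrt (q ^ 2 - 2 * s + 1) ≤ κ + C * DD p q s := by
  -- a lower bound for `|1 - q^(p-1)|` away from `q = 1`
  obtain ⟨d, hd, hd'⟩ : ∃ d : ℝ, 0 < d ∧ ∀ q : ℝ, 0 ≤ q → κ / 2 ≤ |1 - q| →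
      d ≤ |1 - q ^ (p - 1)| := by
    have e1 : 1 < (1 + κ / 2) ^ (p - 1) := Real.one_lt_rpow (by linarith) (by linarith)
    have e2 : (max 0 (1 - κ / 2)) ^ (p - 1) < 1 := 
      Real.rpow_lt_one (le_max_left _ _) (max_lt one_pos (by linarith)) (by linarith)
    refine ⟨min ((1 + κ / 2) ^ (p - 1) - 1) (1 - (max 0 (1 - κ / 2)) ^ (p - 1)),
      lt_min (by linarith) (by linarith), ?_⟩
    intro q hq h
    rcases le_total q 1 with h1 | h1
    · rw [abs_of_nonneg (by linarith)] at h
      have := Real.rpow_le_rpow hq (show q ≤ max 0 (1 - κ / 2) from le_max_of_le_right (by linarith))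
        (by linarith : 0 ≤ p - 1)
      exact (min_le_right _ _).trans (le_trans (by linarith) (le_abs_self _))
    · rw [abs_of_nonpos (by linarith)] at h
      have := Real.rpow_le_rpow (by linarith) (show 1 + κ / 2 ≤ q by linarith)
        (by linarith : 0 ≤ p - 1)
      exact (min_le_left _ _).trans (le_trans (by linarith) (neg_le_abs _))
  refine ⟨1 / d + 2 / κ, by positivity, ?_⟩
  intro q s hs
  have hq : 0 ≤ q := (abs_nonneg s).trans hs
  obtain ⟨h1, h2, h3, h4⟩ := DD_parts hp hs
  have hD := DD_nonneg hp hs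
  have t2 : |1 - q| ≤ κ / 2 + (1 / d) * (|1 - q| * |1 - q ^ (p - 1)|) := by
    rcases lt_or_ge |1 - q| (κ / 2) with h | h
    · have : 0 ≤ 1 / d * (|1 - q| * |1 - q ^ (p - 1)|) := by positivity
      linarith
    · have := hd' q hq h
      have : 1 ≤ (1 / d) * |1 - q ^ (p - 1)| := by
        rw [one_div, ← div_eq_inv_mul, le_div_iff₀ hd]; linarith
      nlinarith [abs_nonneg (1 - q)]
  have hd0 : 0 ≤ 1 / d := by positivity
  have hk0 : 0 ≤ 2 / κ := by positivity
  have hfin : |1 - q| + (κ / 2 + 2 / κ * (q - s)) ≤ κ + (1 / d + 2 / κ) * DD p q s := by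
    nlinarith
  refine le_trans (Real.sqrt_le_iff.2 ⟨by positivity, ?_⟩) hfin
  have hk : κ / 2 * (2 / κ) = 1 := by field_simp
  have e : 2 * (q - s) ≤ (κ / 2 + 2 / κ * (q - s)) ^ 2 := by
    nlinarith [sq_nonneg (κ / 2 - 2 / κ * (q - s))]
  have e0 : 0 ≤ |1 - q| * (κ / 2 + 2 / κ * (q - s)) := by positivity
  nlinarith [sq_abs (1 - q)]

end RS

namespace RS

/-! ### The space, the dilation invariant measure, annuli -/

abbrev E (N : ℕ) := EuclideanSpace ℝ (Fin N)

/-- the dilation invariant measure `|x|^{-N} dx` -/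
noncomputable def nu (N : ℕ) : Measure (E N) :=
  (volume : Measure (E N)).withDensity (fun x => ENNReal.ofReal ((‖x‖ ^ N)⁻¹))

/-- closed annulus, in logarithmic scale -/
def ann (N : ℕ) (a b : ℝ) : Set (E N) := {x | exp a ≤ ‖x‖ ∧ ‖x‖ ≤ exp b}

lemma ne_zero_of_mem_ann {N : ℕ} {a b : ℝ} {x : E N} (h : x ∈ ann N a b) : x ≠ 0 := by
  intro h0
  have := h.1
  rw [h0, norm_zero] at this
  exact absurd (exp_pos a) (not_lt.2 this)

lemma ann_subset {N : ℕ} (a b : ℝ) : ann N a b ⊆ {0}ᶜ := fun _ hx => ne_zero_of_mem_ann hx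

lemma mem_ann_iff {N : ℕ} {a b : ℝ} {x : E N} (h : x ≠ 0) :
    x ∈ ann N a b ↔ a ≤ log ‖x‖ ∧ log ‖x‖ ≤ b := by
  have := norm_pos_iff.2 h
  unfold ann
  rw [Set.mem_ofPred_eq, Real.le_log_iff_exp_le this, Real.log_le_iff_le_exp this]

lemma isClosed_ann {N : ℕ} (a b : ℝ) : IsClosed (ann N a b) :=
  (isClosed_le continuous_const continuous_norm).inter (isClosed_le continuous_norm continuous_const)

lemma isCompact_ann {N : ℕ} (a b : ℝ) : IsCompact (ann N a b) := by
  refine Metric.isCompact_of_isClosed_isBounded (isClosed_ann a b) ?_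
  refine (Metric.isBounded_closedBall (x := (0 : E N)) (r := exp b)).subset ?_
  intro x hx
  simpa using hx.2

lemma measurableSet_ann {N : ℕ} (a b : ℝ) : MeasurableSet (ann N a b) := (isClosed_ann a b).measurableSet

lemma measurable_dens (N : ℕ) : Measurable (fun x : E N => ENNReal.ofReal ((‖x‖ ^ N)⁻¹)) := by
  fun_prop

lemma integral_nu {N : ℕ} (f : E N → ℝ) : ∫ x, f x ∂(nu N) = ∫ x, (‖x‖ ^ N)⁻¹ * f x := by
  unfold nu
  rw [integral_withDensity_eq_integral_toReal_smul (measurable_dens N)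
    (by filter_upwards with x using ENNReal.ofReal_lt_top)]
  congr 1; ext x
  rw [ENNReal.toReal_ofReal (by positivity), smul_eq_mul]

lemma ae_ne_zero {N : ℕ} (hN : 2 ≤ N) : ∀ᵐ x ∂(volume : Measure (E N)), x ≠ 0 := by
  have : Nonempty (Fin N) := ⟨⟨0, by omega⟩⟩
  have : Nontrivial (E N) := inferInstance
  simp [ae_iff]

lemma ae_nu_of_ae {N : ℕ} {P : E N → Prop} (h : ∀ᵐ x, P x) : ∀ᵐ x ∂(nu N), P x :=
  (withDensity_absolutelyContinuous _ _).ae_le h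

lemma ae_nu_ne_zero {N : ℕ} (hN : 2 ≤ N) : ∀ᵐ x ∂(nu N), x ≠ 0 := ae_nu_of_ae (ae_ne_zero hN)

lemma nu_ann_lt_top {N : ℕ} (a b : ℝ) : nu N (ann N a b) < ⊤ := by
  unfold nu
  rw [withDensity_apply _ (measurableSet_ann a b)]
  calc ∫⁻ x in ann N a b, ENNReal.ofReal ((‖x‖ ^ N)⁻¹)
      ≤ ∫⁻ x in ann N a b, ENNReal.ofReal ((exp a ^ N)⁻¹) := by
        refine setLIntegral_mono' (measurableSet_ann a b) ?_
        intro x hx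
        refine ENNReal.ofReal_le_ofReal ?_
        have := hx.1
        gcongr
    _ = ENNReal.ofReal ((exp a ^ N)⁻¹) * volume (ann N a b) := by
        rw [lintegral_const, Measure.restrict_apply MeasurableSet.univ, Set.univ_inter]
    _ < ⊤ := ENNReal.mul_lt_top ENNReal.ofReal_lt_top (isCompact_ann a b).measure_lt_top

lemma integrableOn_ann {N : ℕ} {f : E N → ℝ} (hf : ContinuousOn f {0}ᶜ) (a b : ℝ) :
    IntegrableOn f (ann N a b) (nu N) := by
  have hc : ContinuousOn f (ann N a b) := hf.mono (ann_subset a b)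
  obtain ⟨C, hC⟩ := (isCompact_ann a b).exists_bound_of_continuousOn hc
  refine IntegrableOn.of_bound (nu_ann_lt_top a b)
    (hc.aestronglyMeasurable (measurableSet_ann a b)) C ?_
  rw [ae_restrict_iff' (measurableSet_ann a b)]
  filter_upwards with x hx using hC x hx

lemma zero_off_ann {N : ℕ} {φ : ℝ → ℝ} {a b : ℝ} (hs : ∀ t, t ∉ Set.Icc a b → φ t = 0)
    {x : E N} (hx : x ≠ 0) (hxa : x ∉ ann N a b) : φ (log ‖x‖) = 0 := by
  apply hs
  rwa [Set.mem_Icc, ← mem_ann_iff hx]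

/-- basic integrability lemma -/
lemma intg {N : ℕ} (hN : 2 ≤ N) {φ : ℝ → ℝ} (hφ : Continuous φ) {a b : ℝ}
    (hs : ∀ t, t ∉ Set.Icc a b → φ t = 0) {f : E N → ℝ} (hf : ContinuousOn f {0}ᶜ) :
    Integrable (fun x => φ (log ‖x‖) * f x) (nu N) := by
  have h1 : ContinuousOn (fun x : E N => φ (log ‖x‖) * f x) {0}ᶜ := by
    refine ContinuousOn.mul ?_ hf
    refine hφ.comp_continuousOn (ContinuousOn.log continuous_norm.continuousOn ?_)
    intro x hx; exact norm_ne_zero_iff.2 hx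
  have h2 := integrableOn_ann h1 a b
  rw [← integrable_indicator_iff (measurableSet_ann a b)] at h2
  refine h2.congr ?_
  filter_upwards [ae_nu_ne_zero hN] with x hx
  by_cases hxa : x ∈ ann N a b
  · rw [Set.indicator_of_mem hxa]
  · rw [Set.indicator_of_notMem hxa, zero_off_ann hs hx hxa, zero_mul]

lemma lintegral_nu_smul {N : ℕ} {c : ℝ} (hc : 0 < c) {f : E N → ENNReal} (hf : Measurable f) :
    ∫⁻ x, f (c • x) ∂(nu N) = ∫⁻ x, f x ∂(nu N) := by
  unfold nu
  have hfc : Measurable (fun x : E N => f (c • x)) := hf.comp (measurable_const_smul c)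
  rw [lintegral_withDensity_eq_lintegral_mul _ (measurable_dens N) hfc,
    lintegral_withDensity_eq_lintegral_mul _ (measurable_dens N) hf]
  have hm : Measurable (fun x : E N => ENNReal.ofReal ((‖x‖ ^ N)⁻¹) * f x) :=
    (measurable_dens N).mul hf
  have h1 : ∀ x : E N, ENNReal.ofReal ((‖x‖ ^ N)⁻¹) * f (c • x) =
      ENNReal.ofReal (c ^ N) * (ENNReal.ofReal ((‖c • x‖ ^ N)⁻¹) * f (c • x)) := by
    intro x
    rw [← mul_assoc, ← ENNReal.ofReal_mul (by positivity), norm_smul, mul_pow, Real.norm_of_nonneg hc.le]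
    congr 2
    rw [mul_inv, ← mul_assoc, mul_inv_cancel₀ (by positivity), one_mul]
  simp only [Pi.mul_apply, Function.comp]
  simp_rw [h1]
  have hm2 : Measurable (fun x : E N => ENNReal.ofReal ((‖c • x‖ ^ N)⁻¹) * f (c • x)) :=
    hm.comp (measurable_const_smul c)
  rw [lintegral_const_mul _ hm2]
  have h2 := lintegral_map (μ := (volume : Measure (E N))) hm (measurable_const_smul c)
  rw [← h2, Measure.map_addHaar_smul _ hc.ne', lintegral_smul_measure, smul_eq_mul, ← mul_assoc,
    ← ENNReal.ofReal_mul (by positivity)]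
  have : c ^ N * |(c ^ Module.finrank ℝ (E N))⁻¹| = 1 := by
    rw [finrank_euclideanSpace_fin, abs_of_pos (by positivity), mul_inv_cancel₀ (by positivity)]
  rw [this, ENNReal.ofReal_one, one_mul]

lemma mp_smul (N : ℕ) {c : ℝ} (hc : 0 < c) :
    MeasurePreserving (fun x : E N => c • x) (nu N) (nu N) := by
  refine ⟨measurable_const_smul c, ?_⟩
  ext s hs
  rw [Measure.map_apply (measurable_const_smul c) hs, ← lintegral_indicator_one hs,
    ← lintegral_nu_smul hc (measurable_one.indicator hs),
    ← lintegral_indicator_one ((measurable_const_smul c) hs)]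
  rfl

lemma integral_nu_smul {N : ℕ} {c : ℝ} (hc : 0 < c) (f : E N → ℝ) :
    ∫ x, f (c • x) ∂(nu N) = ∫ x, f x ∂(nu N) := by
  refine (mp_smul N hc).integral_comp ?_ f
  exact (Homeomorph.smulOfNeZero c hc.ne').measurableEmbedding

lemma preimage_ann {N : ℕ} (a b τ : ℝ) :
    (fun x : E N => exp τ • x) ⁻¹' (ann N a b) = ann N (a - τ) (b - τ) := by
  ext x
  simp only [ann, Set.mem_preimage, Set.mem_ofPred_eq, norm_smul, Real.norm_of_nonneg (exp_pos τ).le,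
    Real.exp_sub]
  rw [div_le_iff₀' (exp_pos _), le_div_iff₀' (exp_pos _)]

lemma nu_ann_shift {N : ℕ} (a b τ : ℝ) : nu N (ann N (a - τ) (b - τ)) = nu N (ann N a b) := by
  rw [← preimage_ann]
  exact (mp_smul N (exp_pos τ)).measure_preimage (measurableSet_ann a b).nullMeasurableSet

/-- measure of a unit annulus -/
noncomputable def V1 (N : ℕ) : ℝ := (nu N).real (ann N 0 1)

lemma V1_nonneg (N : ℕ) : 0 ≤ V1 N := measureReal_nonneg

lemma nu_unit (N : ℕ) (a : ℝ) : (nu N).real (ann N a (a + 1)) = V1 N := by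
  unfold V1 Measure.real
  rw [← nu_ann_shift 0 1 (-a)]
  simp [add_comm]

lemma nu_ann_le (N : ℕ) (a : ℝ) (n : ℕ) : (nu N).real (ann N a (a + n)) ≤ (n + 1) * V1 N := by
  induction n with
  | zero =>
    have : ann N a (a + (0:ℕ)) ⊆ ann N a (a + 1) := fun x hx => ⟨hx.1, hx.2.trans (by simp)⟩
    calc _ ≤ (nu N).real (ann N a (a + 1)) := measureReal_mono this (nu_ann_lt_top _ _).ne
      _ = _ := by rw [nu_unit]; simp
  | succ n ih =>
    have : ann N a (a + (n + 1 : ℕ)) ⊆ ann N a (a + n) ∪ ann N (a + n) (a + n + 1) := by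
      intro x hx
      rcases le_total ‖x‖ (exp (a + n)) with h | h
      · exact Or.inl ⟨hx.1, h⟩
      · exact Or.inr ⟨h, by simpa [add_assoc] using hx.2⟩
    have h2 : nu N (ann N a (a + n) ∪ ann N (a + n) (a + n + 1)) < ⊤ :=
      (measure_union_le _ _).trans_lt (ENNReal.add_lt_top.2 ⟨nu_ann_lt_top _ _, nu_ann_lt_top _ _⟩)
    calc _ ≤ _ := measureReal_mono this h2.ne
      _ ≤ (nu N).real (ann N a (a + n)) + (nu N).real (ann N (a + n) (a + n + 1)) :=
        measureReal_union_le _ _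
      _ ≤ (n + 1) * V1 N + V1 N := by rw [nu_unit]; linarith
      _ = _ := by push_cast; ring

end RS

namespace RS

/-! ### Passing from smooth to `C^1` test functions -/

lemma exists_smooth_approx {N : ℕ} {F : E N → ℝ} (hF : ContDiff ℝ 1 F) (hc : HasCompactSupport F)
    {δ : ℝ} (hδ : 0 < δ) {ε : ℝ} (hε : 0 < ε) :
    ∃ φ : E N → ℝ, ContDiff ℝ (⊤ : ℕ∞) φ ∧ HasCompactSupport φ ∧
      tsupport φ ⊆ Metric.cthickening δ (tsupport F) ∧
      (∀ x, |φ x - F x| ≤ ε) ∧ (∀ x, ‖fderiv ℝ φ x - fderiv ℝ F x‖ ≤ ε) := by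
  have hcd : HasCompactSupport (fderiv ℝ F) := hc.fderiv ℝ
  have hcont : Continuous (fderiv ℝ F) := hF.continuous_fderiv one_ne_zero
  obtain ⟨r1, hr1, h1⟩ := Metric.uniformContinuous_iff.1
    (hc.uniformContinuous_of_continuous hF.continuous) ε hε
  obtain ⟨r2, hr2, h2⟩ := Metric.uniformContinuous_iff.1
    (hcd.uniformContinuous_of_continuous hcont) ε hε
  set r := min δ (min r1 r2) with hr
  have hr0 : 0 < r := lt_min hδ (lt_min hr1 hr2)
  let b : ContDiffBump (0 : E N) := ⟨r / 2, r, by positivity, by linarith⟩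
  have hbc : HasCompactSupport (b.normed (volume : Measure (E N))) := b.hasCompactSupport_normed
  have hbs : ContDiff ℝ (⊤ : ℕ∞) (b.normed (volume : Measure (E N))) := b.contDiff_normed
  have hbl : LocallyIntegrable (b.normed (volume : Measure (E N))) volume :=
    b.continuous_normed.locallyIntegrable
  refine ⟨convolution (b.normed volume) F (ContinuousLinearMap.lsmul ℝ ℝ) volume, ?_, ?_, ?_, ?_, ?_⟩
  · exact hbc.contDiff_convolution_left _ hbs hF.continuous.locallyIntegrable
  · exact hbc.convolution _ hc
  · refine closure_minimal ?_ Metric.isClosed_cthickening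
    refine (support_convolution_subset _).trans ?_
    rw [b.support_normed_eq]
    rintro _ ⟨y, hy, z, hz, rfl⟩
    refine Metric.mem_cthickening_of_dist_le _ z _ _ (subset_tsupport _ hz) ?_
    have : dist y 0 < r := hy
    rw [dist_zero_right] at this
    simp only [dist_eq_norm, add_sub_cancel_right]
    exact this.le.trans (min_le_left _ _)
  · intro x
    rw [← Real.dist_eq]
    refine b.dist_normed_convolution_le hF.continuous.aestronglyMeasurable ?_
    intro y hy
    have hy' : dist y x < r := hy
    exact (h1 (hy'.trans_le ((min_le_right _ _).trans (min_le_left _ _)))).le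
  · intro x
    rw [(hc.hasFDerivAt_convolution_right (ContinuousLinearMap.lsmul ℝ ℝ) hbl hF x).fderiv]
    refine ContinuousLinearMap.opNorm_le_bound _ hε.le ?_
    intro y
    rw [_root_.sub_apply, convolution_precompR_apply _ hbl hcd hcont, ← dist_eq_norm]
    refine b.dist_normed_convolution_le (g := fun a => fderiv ℝ F a y) ?_ ?_
    · exact (hcont.clm_apply continuous_const).aestronglyMeasurable
    intro z hz
    have hz' : dist z x < r := hz
    have := (h2 (hz'.trans_le ((min_le_right _ _).trans (min_le_right _ _)))).le
    rw [dist_eq_norm, ← _root_.sub_apply]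
    refine (ContinuousLinearMap.le_opNorm _ _).trans ?_
    rw [← dist_eq_norm]
    gcongr

lemma integrable_of_supp {N : ℕ} {K : Set (E N)} (hK : IsCompact K) {f : E N → ℝ}
    (hf : ContinuousOn f K) (h0 : ∀ x, x ∉ K → f x = 0) : Integrable f := by
  have := (hf.integrableOn_compact hK (μ := volume))
  rw [← integrable_indicator_iff hK.measurableSet] at this
  refine this.congr (Eventually.of_forall fun x => ?_)
  by_cases hx : x ∈ K
  · rw [Set.indicator_of_mem hx]
  · rw [Set.indicator_of_notMem hx, h0 x hx]

lemma fderiv_zero_off {N : ℕ} {F : E N → ℝ} {K : Set (E N)} (h : tsupport F ⊆ K) {x : E N}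
    (hx : x ∉ K) : fderiv ℝ F x = 0 := by
  by_contra hne
  exact hx (h (support_fderiv_subset ℝ hne))

lemma weak_C1 {N : ℕ} {W : E N → E N} {c : E N → ℝ} (hW : ContinuousOn W {0}ᶜ)
    (hcc : ContinuousOn c {0}ᶜ)
    (hweak : ∀ φ : E N → ℝ, ContDiff ℝ (⊤ : ℕ∞) φ → HasCompactSupport φ →
      tsupport φ ⊆ {(0 : E N)}ᶜ → ∫ x, fderiv ℝ φ x (W x) = ∫ x, c x * φ x)
    {F : E N → ℝ} (hF : ContDiff ℝ 1 F) (hc : HasCompactSupport F)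
    (hs : tsupport F ⊆ {(0 : E N)}ᶜ) : ∫ x, fderiv ℝ F x (W x) = ∫ x, c x * F x := by
  obtain ⟨δ, hδ, hδ'⟩ := hc.isCompact.exists_cthickening_subset_open isOpen_compl_singleton hs
  set K := Metric.cthickening δ (tsupport F) with hK
  have hKc : IsCompact K := hc.isCompact.cthickening
  have hFK : tsupport F ⊆ K := Metric.self_subset_cthickening _
  have hWK := hW.mono hδ'
  have hcK := hcc.mono hδ'
  have h_integ : ∀ φ : E N → ℝ, ContDiff ℝ 1 φ → tsupport φ ⊆ K →
      Integrable (fun x => fderiv ℝ φ x (W x)) ∧ Integrable (fun x => c x * φ x) := by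
    intro φ h1 h2
    refine ⟨integrable_of_supp hKc ?_ ?_, integrable_of_supp hKc (hcK.mul h1.continuous.continuousOn) ?_⟩
    · exact (h1.continuous_fderiv one_ne_zero).continuousOn.clm_apply hWK
    · intro x hx
      rw [fderiv_zero_off h2 hx]; rfl
    · intro x hx
      rw [image_eq_zero_of_notMem_tsupport (fun h => hx (h2 h)), mul_zero]
  set B := ∫ x in K, (‖W x‖ + |c x|) with hB
  have hBi : IntegrableOn (fun x => ‖W x‖ + |c x|) K :=
    (hWK.norm.add hcK.abs).integrableOn_compact hKc
  have hB0 : 0 ≤ B := integral_nonneg fun x => by positivity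
  have key : ∀ ε : ℝ, 0 < ε → |(∫ x, fderiv ℝ F x (W x)) - ∫ x, c x * F x| ≤ ε * B := by
    intro ε hε
    obtain ⟨φ, h1, h2, h3, h4, h5⟩ := exists_smooth_approx hF hc hδ hε
    have h1' : ContDiff ℝ 1 φ := h1.of_le (by exact_mod_cast le_top)
    have e1 := h_integ F hF hFK
    have e2 := h_integ φ h1' h3
    have e3 := hweak φ h1 h2 (h3.trans hδ')
    have e4 : (∫ x, fderiv ℝ F x (W x)) - ∫ x, c x * F x
        = ∫ x, ((fderiv ℝ F x (W x) - fderiv ℝ φ x (W x)) - (c x * F x - c x * φ x)) := by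
      rw [integral_sub (f := fun x => fderiv ℝ F x (W x) - fderiv ℝ φ x (W x)) (g := fun x => c x * F x - c x * φ x)
        (e1.1.sub e2.1) (e1.2.sub e2.2), integral_sub e1.1 e2.1, integral_sub e1.2 e2.2, e3]
      ring
    rw [e4, hB, ← integral_const_mul, ← integral_indicator hKc.measurableSet, ← Real.norm_eq_abs]
    refine norm_integral_le_of_norm_le ?_ ?_
    · rw [integrable_indicator_iff hKc.measurableSet]
      exact hBi.const_mul ε
    · filter_upwards with x
      by_cases hx : x ∈ K
      · rw [Set.indicator_of_mem hx, ← _root_.sub_apply, ← mul_sub]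
        have a1 := (ContinuousLinearMap.le_opNorm (fderiv ℝ F x - fderiv ℝ φ x) (W x))
        have a2 := h5 x
        rw [norm_sub_rev] at a2
        have a3 := h4 x
        rw [abs_sub_comm] at a3
        calc _ ≤ ‖(fderiv ℝ F x - fderiv ℝ φ x) (W x)‖ + ‖c x * (F x - φ x)‖ := norm_sub_le _ _
          _ ≤ ε * ‖W x‖ + |c x| * ε := by
            rw [norm_mul, Real.norm_eq_abs (c x), Real.norm_eq_abs (F x - φ x)]
            gcongr
            exact a1.trans (by gcongr)
          _ = _ := by ring
      · rw [Set.indicator_of_notMem hx, fderiv_zero_off hFK hx, fderiv_zero_off h3 hx,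
          image_eq_zero_of_notMem_tsupport (fun h => hx (hFK h)),
          image_eq_zero_of_notMem_tsupport (fun h => hx (h3 h))]
        simp
  have : |(∫ x, fderiv ℝ F x (W x)) - ∫ x, c x * F x| ≤ 0 := by
    refine le_of_forall_pos_le_add fun ε hε => ?_
    have := key (ε / (B + 1)) (by positivity)
    have h2 : ε / (B + 1) * B ≤ ε := by
      rw [div_mul_eq_mul_div, div_le_iff₀ (by positivity)]
      nlinarith
    linarith
  exact sub_eq_zero.1 (abs_nonpos_iff.1 this)

/-- dilation invariance, infinitesimal form -/
lemma euler_zero {N : ℕ} {F : E N → ℝ} (hF : ContDiff ℝ 1 F) {a b : ℝ}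
    (hs : ∀ x, x ∉ ann N a b → F x = 0) : ∫ x, fderiv ℝ F x x ∂(nu N) = 0 := by
  have hts : tsupport F ⊆ ann N a b := closure_minimal
    (fun x hx => by by_contra h; exact hx (hs x h)) (isClosed_ann a b)
  have hcf : Continuous (fun x => fderiv ℝ F x x) :=
    (hF.continuous_fderiv one_ne_zero).clm_apply continuous_id
  obtain ⟨C, hC⟩ := (isCompact_ann a b).exists_bound_of_continuousOn hcf.continuousOn
  have hb : ∀ x, ‖fderiv ℝ F x x‖ ≤ C ⊔ 0 := by
    intro x
    by_cases hx : x ∈ ann N a b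
    · exact (hC x hx).trans (le_max_left _ _)
    · rw [fderiv_zero_off hts hx]; simp
  have h := hasDerivAt_integral_of_dominated_loc_of_deriv_le (μ := nu N) (𝕜 := ℝ)
    (F := fun (τ : ℝ) (x : E N) => F (exp τ • x)) (x₀ := 0) (s := Metric.ball 0 1)
    (F' := fun (τ : ℝ) (x : E N) => fderiv ℝ F (exp τ • x) (exp τ • x))
    (bound := (ann N (a - 1) (b + 1)).indicator fun _ => C ⊔ 0)
    (Metric.ball_mem_nhds 0 one_pos) ?_ ?_ ?_ ?_ ?_ ?_
  · have h2 := h.2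
    simp only [exp_zero, one_smul] at h2
    have h3 : (fun n : ℝ => ∫ x, F (exp n • x) ∂(nu N)) = fun _ => ∫ x, F x ∂(nu N) := by
      ext τ; exact integral_nu_smul (exp_pos τ) F
    rw [h3] at h2
    exact h2.unique (hasDerivAt_const _ _)
  · filter_upwards with τ
    exact (hF.continuous.comp (continuous_const_smul _)).aestronglyMeasurable
  · have : IntegrableOn F (ann N a b) (nu N) := integrableOn_ann hF.continuous.continuousOn a b
    rw [← integrable_indicator_iff (measurableSet_ann a b)] at this
    refine this.congr (Eventually.of_forall fun x => ?_)
    simp only [exp_zero, one_smul]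
    by_cases hx : x ∈ ann N a b
    · rw [Set.indicator_of_mem hx]
    · rw [Set.indicator_of_notMem hx, hs x hx]
  · exact (hcf.comp (continuous_const_smul _)).aestronglyMeasurable
  · filter_upwards with x τ hτ
    have hτ' : |τ| < 1 := by simpa using hτ
    have := abs_lt.1 hτ'
    by_cases hx : x ∈ ann N (a - 1) (b + 1)
    · rw [Set.indicator_of_mem hx]; exact hb _
    · rw [Set.indicator_of_notMem hx]
      have : exp τ • x ∉ ann N a b := by
        intro h
        apply hx
        have h' : x ∈ ann N (a - τ) (b - τ) := by rw [← preimage_ann]; exact h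
        exact ⟨(exp_le_exp.2 (by linarith)).trans h'.1, h'.2.trans (exp_le_exp.2 (by linarith))⟩
      rw [fderiv_zero_off hts this]; simp
  · rw [integrable_indicator_iff (measurableSet_ann _ _)]
    exact integrableOn_ann continuousOn_const _ _
  · filter_upwards with x τ hτ
    have h1 : HasDerivAt (fun τ : ℝ => exp τ • x) (exp τ • x) τ := (Real.hasDerivAt_exp τ).smul_const x
    exact (hF.differentiable one_ne_zero _).hasFDerivAt.comp_hasDerivAt τ h1

end RS

namespace RS

/-- `f` is `C^1` with derivative `f'` -/
structure C1 (f f' : ℝ → ℝ) : Prop where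
  d : ∀ t, HasDerivAt f (f' t) t
  c : Continuous f'

namespace C1
variable {f f' g g' : ℝ → ℝ}

lemma cont (h : C1 f f') : Continuous f := continuous_iff_continuousAt.2 fun t => (h.d t).continuousAt

lemma contDiff (h : C1 f f') : ContDiff ℝ 1 f := by
  rw [contDiff_one_iff_deriv]
  refine ⟨fun t => (h.d t).differentiableAt, ?_⟩
  have : deriv f = f' := by ext t; exact (h.d t).deriv
  rw [this]; exact h.c

lemma mul (h : C1 f f') (k : C1 g g') :
    C1 (fun t => f t * g t) (fun t => f' t * g t + f t * g' t) :=
  ⟨fun t => (h.d t).mul (k.d t), by have := h.c; have := k.c; have := h.cont; have := k.cont; fun_prop⟩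

lemma const_mul (h : C1 f f') (c : ℝ) : C1 (fun t => c * f t) (fun t => c * f' t) :=
  ⟨fun t => (h.d t).const_mul c, by have := h.c; fun_prop⟩

lemma expc (c : ℝ) : C1 (fun t => exp (c * t)) (fun t => c * exp (c * t)) := by
  refine ⟨fun t => ?_, by fun_prop⟩
  have := ((hasDerivAt_id t).const_mul c).exp
  simp only [id, mul_one] at this
  convert this using 1
  ring

lemma congr' (h : C1 f f') {k : ℝ → ℝ} (e : ∀ t, f' t = k t) : C1 f k := by
  have : f' = k := funext e
  rwa [← this]

end C1

/-- support in `[a,b]` -/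
def Supp (η : ℝ → ℝ) (a b : ℝ) : Prop := ∀ t, t ∉ Set.Icc a b → η t = 0

lemma Supp.deriv {η η' : ℝ → ℝ} {a b : ℝ} (h : Supp η a b) (hd : C1 η η') : Supp η' a b := by
  intro t ht
  have h1 : η =ᶠ[nhds t] fun _ => (0 : ℝ) := by
    filter_upwards [(isClosed_Icc (a := a) (b := b)).isOpen_compl.mem_nhds ht] with y hy using h y hy
  exact (hd.d t).unique ((hasDerivAt_const t (0:ℝ)).congr_of_eventuallyEq h1)

/-- the data of the problem -/
structure Dat (N : ℕ) where
  p : ℝ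
  μ : ℝ
  γ : ℝ
  C : ℝ
  R : ℝ
  v : E N → ℝ
  hN : 2 ≤ N
  hp1 : 1 < p
  hpN : p < N
  root : (p - 1) * μ ^ p - (N - p) * μ ^ (p - 1) + γ = 0
  lb : (N - p) / p < μ
  ub : μ ≤ (N - p) / (p - 1)
  pos : ∀ x, x ≠ 0 → 0 < v x
  reg : ContDiffOn ℝ 1 v {(0 : E N)}ᶜ
  weak : ∀ φ : E N → ℝ, ContDiff ℝ (⊤ : ℕ∞) φ → HasCompactSupport φ →
      tsupport φ ⊆ {(0 : E N)}ᶜ →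
      (∫ x, ‖gradient v x‖ ^ (p - 2) * ⟪gradient v x, gradient φ x⟫)
        = γ * ∫ x, ‖x‖ ^ (-p) * v x ^ (p - 1) * φ x
  hR : 0 < R
  hC : 0 < C
  decay : ∀ x : E N, R < ‖x‖ → v x ≤ C * ‖x‖ ^ (-μ)

namespace Dat
variable {N : ℕ} (d : Dat N)

noncomputable def ell (x : E N) : ℝ := log (d.v x) + d.μ * log ‖x‖
noncomputable def q (x : E N) : ℝ := ‖x‖ * ‖gradient d.v x‖ / (d.μ * d.v x)
noncomputable def s (x : E N) : ℝ := - ⟪x, gradient d.v x⟫ / (d.μ * d.v x)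
noncomputable def k (x : E N) : ℝ := kk d.p (d.q x) (d.s x)
noncomputable def D (x : E N) : ℝ := DD d.p (d.q x) (d.s x)
noncomputable def E1 (x : E N) : ℝ := EE d.p (d.q x) (d.s x)
noncomputable def W (x : E N) : E N := ‖gradient d.v x‖ ^ (d.p - 2) • gradient d.v x
noncomputable def a : ℝ := d.p * d.μ - (N - d.p)
noncomputable def lam : ℝ := d.μ / d.a

lemma hμ : 0 < d.μ := by
  refine lt_trans ?_ d.lb
  have := d.hpN; have := d.hp1
  exact div_pos (by linarith) (by linarith)

lemma ha : 0 < d.a := by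
  have h := d.lb; have := d.hp1
  rw [div_lt_iff₀ (by linarith)] at h
  unfold a; linarith

lemma hlam : 1 ≤ d.lam := by
  have h := d.ub; have := d.hp1
  rw [le_div_iff₀ (by linarith)] at h
  unfold lam
  rw [le_div_iff₀ d.ha]
  unfold a; linarith

lemma lam_a : d.lam * d.a = d.μ := div_mul_cancel₀ _ d.ha.ne'

lemma gam : d.γ = d.μ ^ (d.p - 1) * ((N - d.p) - (d.p - 1) * d.μ) := by
  have h := d.root
  rw [qp_eq d.hp1 d.hμ.le] at h
  linarith

lemma contDiffAt_v {x : E N} (hx : x ≠ 0) : ContDiffAt ℝ 1 d.v x :=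
  d.reg.contDiffAt (isOpen_compl_singleton.mem_nhds hx)

lemma diff_v {x : E N} (hx : x ≠ 0) : DifferentiableAt ℝ d.v x :=
  (d.contDiffAt_v hx).differentiableAt one_ne_zero

lemma cont_v : ContinuousOn d.v {0}ᶜ := d.reg.continuousOn

lemma cont_grad : ContinuousOn (gradient d.v) {0}ᶜ := by
  have : ContinuousOn (fderiv ℝ d.v) {0}ᶜ := d.reg.continuousOn_fderiv_of_isOpen isOpen_compl_singleton le_rfl
  unfold gradient
  exact (InnerProductSpace.toDual ℝ (E N)).symm.continuous.comp_continuousOn this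

lemma cont_logn : ContinuousOn (fun x : E N => log ‖x‖) {0}ᶜ :=
  ContinuousOn.log continuous_norm.continuousOn fun _ hx => norm_ne_zero_iff.2 hx

lemma cont_ell : ContinuousOn d.ell {0}ᶜ :=
  (d.cont_v.log fun x hx => (d.pos x hx).ne').add (cont_logn.const_mul _ |> fun h => h)

lemma muv_pos {x : E N} (hx : x ≠ 0) : 0 < d.μ * d.v x := mul_pos d.hμ (d.pos x hx)

lemma cont_q : ContinuousOn d.q {0}ᶜ := by
  refine ContinuousOn.div (continuous_norm.continuousOn.mul d.cont_grad.norm)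
    (continuousOn_const.mul d.cont_v) fun x hx => (d.muv_pos hx).ne'

lemma cont_s : ContinuousOn d.s {0}ᶜ := by
  refine ContinuousOn.div (continuousOn_id.inner d.cont_grad).neg
    (continuousOn_const.mul d.cont_v) fun x hx => (d.muv_pos hx).ne'

lemma cont_pw {p : ℝ} (hp : 1 < p) : Continuous (fun w : E N => ‖w‖ ^ (p - 2) • w) := by
  rw [continuous_iff_continuousAt]
  intro w
  by_cases hw : w = 0
  · subst hw
    show Tendsto _ _ (nhds (‖(0 : E N)‖ ^ (p - 2) • (0 : E N)))
    rw [smul_zero]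
    refine squeeze_zero_norm (a := fun w : E N => ‖w‖ ^ (p - 1)) ?_ ?_
    · intro w
      rw [norm_smul, Real.norm_of_nonneg (by positivity)]
      rcases (norm_nonneg w).eq_or_lt with h | h
      · rw [← h, mul_zero, Real.zero_rpow (by linarith)]
      · rw [← Real.rpow_add_one h.ne']
        exact le_of_eq (by congr 1; ring)
    · have : Continuous (fun w : E N => ‖w‖ ^ (p - 1)) :=
        continuous_norm.rpow_const fun _ => Or.inr (by linarith)
      have h2 := this.tendsto 0
      rwa [norm_zero, Real.zero_rpow (by linarith)] at h2
  · have h1 : ContinuousAt (fun w : E N => ‖w‖ ^ (p - 2)) w :=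
      continuous_norm.continuousAt.rpow_const (Or.inl (norm_ne_zero_iff.2 hw))
    exact h1.smul continuousAt_id

lemma cont_W : ContinuousOn d.W {0}ᶜ := (cont_pw d.hp1).comp_continuousOn d.cont_grad

lemma q_nonneg {x : E N} (hx : x ≠ 0) : 0 ≤ d.q x := by
  have := d.muv_pos hx
  unfold q; positivity

lemma abs_s_le {x : E N} (hx : x ≠ 0) : |d.s x| ≤ d.q x := by
  have := d.muv_pos hx
  unfold s q
  rw [abs_div, abs_neg, abs_of_pos this]
  gcongr
  exact abs_real_inner_le_norm _ _

lemma D_nonneg {x : E N} (hx : x ≠ 0) : 0 ≤ d.D x := DD_nonneg d.hp1 (d.abs_s_le hx)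
lemma E1_nonneg {x : E N} (hx : x ≠ 0) : 0 ≤ d.E1 x := EE_nonneg d.hp1 (d.abs_s_le hx)
lemma E1_le {x : E N} (hx : x ≠ 0) : d.E1 x ≤ d.p * d.D x := EE_le d.hp1 (d.abs_s_le hx)

lemma grad_norm {x : E N} (hx : x ≠ 0) : ‖gradient d.v x‖ = d.μ * d.v x / ‖x‖ * d.q x := by
  have := d.muv_pos hx; have := norm_pos_iff.2 hx
  have h1 := d.hμ; have h2 := d.pos x hx
  unfold q; field_simp

lemma grad_inner {x : E N} (hx : x ≠ 0) : ⟪x, gradient d.v x⟫ = - (d.μ * d.v x * d.s x) := by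
  have h1 := d.hμ; have h2 := d.pos x hx
  unfold s; field_simp

lemma inner_W {x : E N} (hx : x ≠ 0) :
    ⟪x, d.W x⟫ / ‖x‖ ^ 2 = - ((d.μ * d.v x) ^ (d.p - 1) * ‖x‖ ^ (-d.p) * d.k x) := by
  have h0 := d.muv_pos hx; have h3 := norm_pos_iff.2 hx
  unfold W
  rw [inner_smul_right, d.grad_inner hx, d.grad_norm hx,
    Real.mul_rpow (by positivity) (d.q_nonneg hx), Real.div_rpow h0.le h3.le]
  unfold k kk
  have e1 : (d.μ * d.v x) ^ (d.p - 1) = (d.μ * d.v x) ^ (d.p - 2) * (d.μ * d.v x) := by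
    rw [← Real.rpow_add_one h0.ne']; congr 1; ring
  have e2 : ‖x‖ ^ (-d.p) = (‖x‖ ^ (d.p - 2))⁻¹ * (‖x‖ ^ 2)⁻¹ := by
    rw [← mul_inv, ← Real.rpow_natCast ‖x‖ 2, ← Real.rpow_add h3, ← Real.rpow_neg h3.le]
    congr 1; push_cast; ring
  rw [e1, e2]
  have : 0 < ‖x‖ ^ (d.p - 2) := by positivity
  field_simp

lemma grad_W {x : E N} (hx : x ≠ 0) :
    ⟪gradient d.v x, d.W x⟫ / d.v x = d.μ * ((d.μ * d.v x) ^ (d.p - 1) * ‖x‖ ^ (-d.p) * d.q x ^ d.p) := by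
  have h0 := d.muv_pos hx; have h3 := norm_pos_iff.2 hx
  have h1 := d.hμ; have h2 := d.pos x hx
  unfold W
  have e0 : ‖gradient d.v x‖ ^ (d.p - 2) * ‖gradient d.v x‖ ^ 2 = ‖gradient d.v x‖ ^ d.p := by
    rcases (norm_nonneg (gradient d.v x)).eq_or_lt with h | h
    · have hp := d.hp1
      rw [← h, Real.zero_rpow (x := d.p) (by linarith)]; simp
    · rw [← Real.rpow_natCast _ 2, ← Real.rpow_add h]; congr 1; push_cast; ring
  rw [inner_smul_right, real_inner_self_eq_norm_sq, e0, d.grad_norm hx,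
    Real.mul_rpow (by positivity) (d.q_nonneg hx), Real.div_rpow h0.le h3.le, qp_eq d.hp1 h0.le,
    Real.rpow_neg h3.le]
  have : 0 < ‖x‖ ^ d.p := by positivity
  field_simp

lemma cont_k : ContinuousOn d.k {0}ᶜ := by
  have h : ContinuousOn (fun x => - (⟪x, d.W x⟫ / ‖x‖ ^ 2 / ((d.μ * d.v x) ^ (d.p - 1) * ‖x‖ ^ (-d.p)))) {0}ᶜ := by
    refine (ContinuousOn.div (ContinuousOn.div (continuousOn_id.inner d.cont_W)
      (continuous_norm.continuousOn.pow 2) ?_) (ContinuousOn.mul ?_ ?_) ?_).neg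
    · intro x hx; exact (pow_pos (norm_pos_iff.2 hx) 2).ne'
    · exact (continuousOn_const.mul d.cont_v).rpow_const fun x hx => Or.inl (d.muv_pos hx).ne'
    · exact continuous_norm.continuousOn.rpow_const fun x hx => Or.inl (norm_ne_zero_iff.2 hx)
    · intro x hx
      exact (mul_pos (rpow_pos_of_pos (d.muv_pos hx) _) (rpow_pos_of_pos (norm_pos_iff.2 hx) _)).ne'
  refine h.congr ?_
  intro x hx
  have := norm_pos_iff.2 hx; have := d.muv_pos hx
  show d.k x = - (⟪x, d.W x⟫ / ‖x‖ ^ 2 / ((d.μ * d.v x) ^ (d.p - 1) * ‖x‖ ^ (-d.p)))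
  rw [d.inner_W hx]
  field_simp

lemma cont_qp : ContinuousOn (fun x => d.q x ^ d.p) {0}ᶜ :=
  d.cont_q.rpow_const fun _ _ => Or.inr (by linarith [d.hp1])

lemma cont_D : ContinuousOn d.D {0}ᶜ := by
  have := ((d.cont_qp.sub d.cont_s).sub d.cont_k).add (continuousOn_const (c := (1:ℝ)))
  exact this

lemma cont_E1 : ContinuousOn d.E1 {0}ᶜ := by
  have := (((continuousOn_const (c := d.p - 1)).mul d.cont_qp).sub
    ((continuousOn_const (c := d.p)).mul d.cont_k)).add (continuousOn_const (c := (1:ℝ)))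
  exact this

/-! test functions -/

open Classical in
noncomputable def tf (η G : ℝ → ℝ) (x : E N) : ℝ :=
  if x = 0 then 0 else η (log ‖x‖) * G (d.ell x)

lemma tf_ne {η G : ℝ → ℝ} {x : E N} (hx : x ≠ 0) : d.tf η G x = η (log ‖x‖) * G (d.ell x) := by
  unfold tf; rw [if_neg hx]

lemma tf_off {η G : ℝ → ℝ} {a b : ℝ} (hs : Supp η a b) {x : E N} (hx : x ∉ ann N a b) :
    d.tf η G x = 0 := by
  by_cases h : x = 0
  · unfold tf; rw [if_pos h]
  · rw [d.tf_ne h, zero_off_ann hs h hx, zero_mul]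

lemma tf_ev {η G : ℝ → ℝ} {x : E N} (hx : x ≠ 0) :
    d.tf η G =ᶠ[nhds x] fun y => η (log ‖y‖) * G (d.ell y) := by
  filter_upwards [isOpen_compl_singleton.mem_nhds hx] with y hy using d.tf_ne hy

lemma contDiffAt_logn {x : E N} (hx : x ≠ 0) : ContDiffAt ℝ 1 (fun x : E N => log ‖x‖) x :=
  (contDiffAt_norm ℝ hx).log (norm_ne_zero_iff.2 hx)

lemma contDiffAt_ell {x : E N} (hx : x ≠ 0) : ContDiffAt ℝ 1 d.ell x :=
  ((d.contDiffAt_v hx).log (d.pos x hx).ne').add (contDiffAt_const.mul (contDiffAt_logn hx))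

lemma tf_contDiff {η η' G G' : ℝ → ℝ} {a b : ℝ} (hη : C1 η η') (hG : C1 G G') (hs : Supp η a b) :
    ContDiff ℝ 1 (d.tf η G) := by
  rw [contDiff_iff_contDiffAt]
  intro x
  by_cases hx : x = 0
  · have : d.tf η G =ᶠ[nhds x] fun _ => 0 := by
      filter_upwards [(isClosed_ann (N := N) a b).isOpen_compl.mem_nhds
        (show x ∉ ann N a b from fun h => ne_zero_of_mem_ann h hx)] with y hy using d.tf_off hs hy
    exact contDiffAt_const.congr_of_eventuallyEq this
  · refine ContDiffAt.congr_of_eventuallyEq ?_ (d.tf_ev hx)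
    exact (hη.contDiff.contDiffAt.comp x (contDiffAt_logn hx)).mul
      (hG.contDiff.contDiffAt.comp x (d.contDiffAt_ell hx))

lemma tf_tsupport {η G : ℝ → ℝ} {a b : ℝ} (hs : Supp η a b) : tsupport (d.tf η G) ⊆ ann N a b :=
  closure_minimal (fun x hx => by by_contra h; exact hx (d.tf_off hs h)) (isClosed_ann a b)

lemma tf_compact {η G : ℝ → ℝ} {a b : ℝ} (hs : Supp η a b) : HasCompactSupport (d.tf η G) :=
  (isCompact_ann a b).of_isClosed_subset (isClosed_tsupport _) (d.tf_tsupport hs)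

lemma hasFDerivAt_logn {x : E N} (hx : x ≠ 0) :
    HasFDerivAt (fun x : E N => log ‖x‖) ((‖x‖ ^ 2)⁻¹ • innerSL ℝ x) x := by
  have h1 : HasFDerivAt (fun x : E N => ‖x‖ ^ 2) (2 • innerSL ℝ x) x :=
    (hasStrictFDerivAt_norm_sq x).hasFDerivAt
  have h3 := norm_pos_iff.2 hx
  have h2 := (h1.log (by positivity)).const_mul (1/2 : ℝ)
  have e1 : (fun x : E N => log ‖x‖) = fun y : E N => 1 / 2 * log (‖y‖ ^ 2) := by
    funext y; rw [Real.log_pow]; push_cast; ring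
  have e2 : (‖x‖ ^ 2)⁻¹ • innerSL ℝ x = (1 / 2 : ℝ) • (‖x‖ ^ 2)⁻¹ • 2 • innerSL ℝ x := by
    ext y; simp; ring
  rw [e1, e2]; exact h2

lemma hasFDerivAt_ell {x : E N} (hx : x ≠ 0) :
    HasFDerivAt d.ell ((d.v x)⁻¹ • fderiv ℝ d.v x + d.μ • ((‖x‖ ^ 2)⁻¹ • innerSL ℝ x)) x :=
  ((d.diff_v hx).hasFDerivAt.log (d.pos x hx).ne').add ((hasFDerivAt_logn hx).const_mul d.μ)

lemma tf_fderiv {η η' G G' : ℝ → ℝ} (hη : C1 η η') (hG : C1 G G')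
    {x : E N} (hx : x ≠ 0) (ξ : E N) :
    fderiv ℝ (d.tf η G) x ξ = η' (log ‖x‖) * G (d.ell x) * (⟪x, ξ⟫ / ‖x‖ ^ 2)
      + η (log ‖x‖) * G' (d.ell x) * (⟪gradient d.v x, ξ⟫ / d.v x + d.μ * (⟪x, ξ⟫ / ‖x‖ ^ 2)) := by
  have h1 := (hη.d (log ‖x‖)).comp_hasFDerivAt x (hasFDerivAt_logn hx)
  have h2 := (hG.d (d.ell x)).comp_hasFDerivAt x (d.hasFDerivAt_ell hx)
  have h3 := (h1.mul h2).congr_of_eventuallyEq (d.tf_ev hx)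
  rw [h3.fderiv, inner_gradient_left]
  simp
  ring

end Dat
end RS

namespace RS

/-- continuous off the origin and supported in the annulus -/
structure Nice {N : ℕ} (f : E N → ℝ) (a b : ℝ) : Prop where
  c : ContinuousOn f {0}ᶜ
  s : ∀ x, x ≠ 0 → x ∉ ann N a b → f x = 0

lemma Nice.int {N : ℕ} (hN : 2 ≤ N) {f : E N → ℝ} {a b : ℝ} (h : Nice f a b) : Integrable f (nu N) := by
  have h2 := integrableOn_ann h.c a b
  rw [← integrable_indicator_iff (measurableSet_ann a b)] at h2
  refine h2.congr ?_
  filter_upwards [ae_nu_ne_zero hN] with x hx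
  by_cases hxa : x ∈ ann N a b
  · rw [Set.indicator_of_mem hxa]
  · rw [Set.indicator_of_notMem hxa, h.s x hx hxa]

namespace Dat
variable {N : ℕ} (d : Dat N)

lemma cont_eta {η : ℝ → ℝ} (hη : Continuous η) : ContinuousOn (fun x : E N => η (log ‖x‖)) {0}ᶜ :=
  hη.comp_continuousOn cont_logn

lemma cont_G {G : ℝ → ℝ} (hG : Continuous G) : ContinuousOn (fun x : E N => G (d.ell x)) {0}ᶜ :=
  hG.comp_continuousOn d.cont_ell

lemma weak' {F : E N → ℝ} (hF : ContDiff ℝ 1 F) (hc : HasCompactSupport F)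
    (hs : tsupport F ⊆ {(0 : E N)}ᶜ) :
    ∫ x, fderiv ℝ F x (d.W x) = ∫ x, (d.γ * (‖x‖ ^ (-d.p) * d.v x ^ (d.p - 1))) * F x := by
  refine weak_C1 d.cont_W ?_ ?_ hF hc hs
  · refine continuousOn_const.mul (ContinuousOn.mul ?_ ?_)
    · exact continuous_norm.continuousOn.rpow_const fun x hx => Or.inl (norm_ne_zero_iff.2 hx)
    · exact d.cont_v.rpow_const fun x hx => Or.inl (d.pos x hx).ne'
  · intro φ h1 h2 h3
    have := d.weak φ h1 h2 h3
    rw [← integral_const_mul] at this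
    calc _ = _ := ?_
      _ = _ := this
      _ = _ := ?_
    · congr 1; ext x
      unfold W
      rw [inner_gradient_right, map_smul, smul_eq_mul]; rfl
    · congr 1; ext x; ring

lemma weight {x : E N} (hx : x ≠ 0) :
    (‖x‖ ^ (-d.p) * d.v x ^ (d.p - 1)) * (exp (((d.p - 1) * d.μ + d.p - N) * log ‖x‖)
      * exp ((1 - d.p) * d.ell x)) = (‖x‖ ^ N)⁻¹ := by
  have h1 := d.pos x hx
  have h2 := norm_pos_iff.2 hx
  unfold ell
  rw [Real.rpow_def_of_pos h1, Real.rpow_def_of_pos h2, ← Real.exp_add, ← Real.exp_add, ← Real.exp_add,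
    ← Real.rpow_natCast, ← Real.rpow_neg h2.le, Real.rpow_def_of_pos h2]
  congr 1; ring

/-- identity (A) -/
lemma idA {η η' G G' : ℝ → ℝ} {a b : ℝ} (hη : C1 η η') (hs : Supp η a b) (hG : C1 G G') :
    ∫ x, (-((((d.p - N) * η (log ‖x‖) + η' (log ‖x‖)) * G (d.ell x)
        + d.μ * η (log ‖x‖) * G' (d.ell x)) * d.k x)
      + d.μ * ((1 - d.p) * η (log ‖x‖) * G (d.ell x) + η (log ‖x‖) * G' (d.ell x)) * d.q x ^ d.p
      - ((N - d.p) - (d.p - 1) * d.μ) * (η (log ‖x‖) * G (d.ell x))) ∂(nu N) = 0 := by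
  set β := (d.p - 1) * d.μ + d.p - N with hβ
  have hA := (C1.expc β).mul hη
  have hΓ := (C1.expc (1 - d.p)).mul hG
  have hsA : Supp (fun t => exp (β * t) * η t) a b := fun t ht => by simp only [hs t ht, mul_zero]
  set F := d.tf (fun t => exp (β * t) * η t) (fun t => exp ((1 - d.p) * t) * G t) with hF
  have hFd : ContDiff ℝ 1 F := d.tf_contDiff hA hΓ hsA
  have hFc : HasCompactSupport F := d.tf_compact hsA
  have hFs : tsupport F ⊆ ann N a b := d.tf_tsupport hsA
  have hFs' : tsupport F ⊆ {(0 : E N)}ᶜ := hFs.trans (ann_subset a b)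
  have hw := d.weak' hFd hFc hFs'
  have i1 : Integrable (fun x => fderiv ℝ F x (d.W x)) := by
    refine integrable_of_supp (isCompact_ann a b)
      ((hFd.continuous_fderiv one_ne_zero).continuousOn.clm_apply (d.cont_W.mono (ann_subset a b))) ?_
    intro x hx; rw [fderiv_zero_off hFs hx]; rfl
  have i2 : Integrable (fun x => (d.γ * (‖x‖ ^ (-d.p) * d.v x ^ (d.p - 1))) * F x) := by
    refine integrable_of_supp (isCompact_ann a b) (ContinuousOn.mul ?_ hFd.continuous.continuousOn) ?_
    · refine ContinuousOn.mono ?_ (ann_subset a b)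
      refine continuousOn_const.mul (ContinuousOn.mul ?_ ?_)
      · exact continuous_norm.continuousOn.rpow_const fun x hx => Or.inl (norm_ne_zero_iff.2 hx)
      · exact d.cont_v.rpow_const fun x hx => Or.inl (d.pos x hx).ne'
    · intro x hx; rw [hF, d.tf_off hsA hx, mul_zero]
  rw [← sub_eq_zero, ← integral_sub i1 i2] at hw
  rw [integral_nu]
  have hμp : 0 < d.μ ^ (d.p - 1) := Real.rpow_pos_of_pos d.hμ _
  rw [← mul_right_inj' hμp.ne', mul_zero, ← integral_const_mul, ← hw]
  refine integral_congr_ae ?_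
  filter_upwards [ae_ne_zero d.hN] with x hx
  have hwt := d.weight hx
  rw [← hβ] at hwt
  rw [d.tf_fderiv hA hΓ hx, hF, d.tf_ne hx, d.inner_W hx, d.grad_W hx, d.gam,
    Real.mul_rpow d.hμ.le (d.pos x hx).le, ← hwt]
  set e1 := exp (β * log ‖x‖)
  set e2 := exp ((1 - d.p) * d.ell x)
  set r := ‖x‖ ^ (-d.p)
  set w := d.v x ^ (d.p - 1)
  set m := d.μ ^ (d.p - 1)
  rw [hβ]
  ring

/-- identity (II) -/
lemma idII {η η' H g : ℝ → ℝ} {a b : ℝ} (hη : C1 η η') (hs : Supp η a b) (hH : C1 H g) :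
    ∫ x, (η' (log ‖x‖) * H (d.ell x) + d.μ * η (log ‖x‖) * g (d.ell x) * (1 - d.s x)) ∂(nu N) = 0 := by
  rw [← euler_zero (d.tf_contDiff hη hH hs) (fun x hx => d.tf_off hs hx)]
  refine integral_congr_ae ?_
  filter_upwards [ae_nu_ne_zero d.hN] with x hx
  have h3 := norm_pos_iff.2 hx
  have h4 := d.pos x hx
  rw [d.tf_fderiv hη hH hx, real_inner_comm x (gradient d.v x), d.grad_inner hx, real_inner_self_eq_norm_sq]
  field_simp
  ring

/-- identity (III) -/
lemma idIII {η η' H g g' : ℝ → ℝ} {a b : ℝ} (hη : C1 η η') (hs : Supp η a b) (hH : C1 H g)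
    (hg : C1 g g') :
    ∫ x, (η' (log ‖x‖) * ((d.p - 1) * H (d.ell x) - d.lam * (1 - d.k x) * g (d.ell x))
      + d.μ * η (log ‖x‖) * (g (d.ell x) * ((d.p - 1) * d.D x + (d.lam - 1) * d.E1 x)
        - d.lam * g' (d.ell x) * d.D x)) ∂(nu N) = 0 := by
  have hsd := hs.deriv hη
  have A := d.idA hη hs hg
  have B := d.idII hη hs hg
  have C := d.idII hη hs hH
  have n1 := cont_eta (N := N) hη.cont
  have n2 := cont_eta (N := N) hη.c
  have n3 := d.cont_G hH.cont
  have n4 := d.cont_G hg.cont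
  have n5 := d.cont_G hg.c
  have n6 := d.cont_k
  have n7 := d.cont_qp
  have n8 := d.cont_s
  have IA := (Nice.int d.hN (f := fun x => (-((((d.p - N) * η (log ‖x‖) + η' (log ‖x‖)) * g (d.ell x)
        + d.μ * η (log ‖x‖) * g' (d.ell x)) * d.k x)
      + d.μ * ((1 - d.p) * η (log ‖x‖) * g (d.ell x) + η (log ‖x‖) * g' (d.ell x)) * d.q x ^ d.p
      - ((N - d.p) - (d.p - 1) * d.μ) * (η (log ‖x‖) * g (d.ell x)))) (a := a) (b := b)
      ⟨by
          repeat' first | assumption | exact continuousOn_const | apply ContinuousOn.fun_add | apply ContinuousOn.fun_sub | apply ContinuousOn.fun_mul | apply ContinuousOn.fun_neg, fun x hx hxa => by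
        simp only [zero_off_ann hs hx hxa, zero_off_ann hsd hx hxa]; ring⟩)
  have IB := (Nice.int d.hN (f := fun x => η' (log ‖x‖) * g (d.ell x)
      + d.μ * η (log ‖x‖) * g' (d.ell x) * (1 - d.s x)) (a := a) (b := b)
      ⟨by
          repeat' first | assumption | exact continuousOn_const | apply ContinuousOn.fun_add | apply ContinuousOn.fun_sub | apply ContinuousOn.fun_mul | apply ContinuousOn.fun_neg, fun x hx hxa => by
        simp only [zero_off_ann hs hx hxa, zero_off_ann hsd hx hxa]; ring⟩)
  have IC := (Nice.int d.hN (f := fun x => η' (log ‖x‖) * H (d.ell x)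
      + d.μ * η (log ‖x‖) * g (d.ell x) * (1 - d.s x)) (a := a) (b := b)
      ⟨by
          repeat' first | assumption | exact continuousOn_const | apply ContinuousOn.fun_add | apply ContinuousOn.fun_sub | apply ContinuousOn.fun_mul | apply ContinuousOn.fun_neg, fun x hx hxa => by
        simp only [zero_off_ann hs hx hxa, zero_off_ann hsd hx hxa]; ring⟩)
  have key := integral_sub (IC.const_mul (d.p - 1)) ((IA.add IB).const_mul d.lam)
  rw [integral_const_mul, integral_const_mul] at key
  simp only [Pi.add_apply] at key
  rw [integral_add IA IB, A, B, C] at key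
  simp only [mul_zero, add_zero, sub_zero] at key
  rw [← key]
  congr 1; ext x
  have hl : d.lam * (d.p * d.μ) = d.μ + d.lam * (N - d.p) := by
    have := d.lam_a; unfold Dat.a at this; linarith
  unfold D E1 DD EE
  simp only [show kk d.p (d.q x) (d.s x) = d.k x from rfl]
  linear_combination (η (log ‖x‖) * g (d.ell x) * (1 - d.k x)) * hl

end Dat
end RS

namespace RS

/-! ### cutoffs -/

noncomputable def T' (t : ℝ) : ℝ := deriv smoothTransition t

lemma C1_T : C1 smoothTransition T' := by
  have h : ContDiff ℝ 1 smoothTransition := smoothTransition.contDiff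
  exact ⟨fun t => (h.differentiable one_ne_zero t).hasDerivAt, h.continuous_deriv le_rfl⟩

lemma T'_nonneg (t : ℝ) : 0 ≤ T' t := Monotone.deriv_nonneg smoothTransition.monotone

lemma T'_supp : Supp T' 0 1 := by
  intro t ht
  rw [Set.mem_Icc, not_and_or, not_le, not_le] at ht
  rcases ht with h | h
  · have : smoothTransition =ᶠ[nhds t] fun _ => (0:ℝ) := by
      filter_upwards [Iio_mem_nhds h] with y hy using smoothTransition.zero_of_nonpos (le_of_lt hy)
    exact (C1_T.d t).unique ((hasDerivAt_const t (0:ℝ)).congr_of_eventuallyEq this)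
  · have : smoothTransition =ᶠ[nhds t] fun _ => (1:ℝ) := by
      filter_upwards [Ioi_mem_nhds h] with y hy using smoothTransition.one_of_one_le (le_of_lt hy)
    exact (C1_T.d t).unique ((hasDerivAt_const t (1:ℝ)).congr_of_eventuallyEq this)

lemma T'_bdd : ∃ M : ℝ, 0 ≤ M ∧ ∀ t, T' t ≤ M := by
  obtain ⟨M, hM⟩ := (isCompact_Icc (a := (0:ℝ)) (b := 1)).exists_bound_of_continuousOn
    (f := T') C1_T.c.continuousOn
  refine ⟨M ⊔ 0, le_max_right _ _, fun t => ?_⟩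
  by_cases h : t ∈ Set.Icc (0:ℝ) 1
  · exact (le_abs_self _).trans ((hM t h).trans (le_max_left _ _))
  · rw [T'_supp t h]; exact le_max_right _ _

lemma C1.shift {f f' : ℝ → ℝ} (h : C1 f f') (c : ℝ) : C1 (fun t => f (t - c)) (fun t => f' (t - c)) :=
  ⟨fun t => (h.d (t - c)).comp_sub_const t c,
    h.c.comp (by fun_prop)⟩

lemma C1.refl_shift {f f' : ℝ → ℝ} (h : C1 f f') (c : ℝ) :
    C1 (fun t => f (c - t)) (fun t => - f' (c - t)) :=
  ⟨fun t => (h.d (c - t)).comp_const_sub c t,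
    (h.c.comp (by fun_prop)).neg⟩

lemma C1.pow {f f' : ℝ → ℝ} (h : C1 f f') (n : ℕ) :
    C1 (fun t => f t ^ n) (fun t => n * f t ^ (n - 1) * f' t) :=
  ⟨fun t => (h.d t).pow n, by have := h.c; have := h.cont; fun_prop⟩

noncomputable def cut (a b t : ℝ) : ℝ := smoothTransition (t - a) * smoothTransition (b - t)
noncomputable def cut' (a b t : ℝ) : ℝ :=
  T' (t - a) * smoothTransition (b - t) + smoothTransition (t - a) * (- T' (b - t))

lemma cut_C1 (a b : ℝ) : C1 (cut a b) (cut' a b) := (C1_T.shift a).mul (C1_T.refl_shift b)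

lemma cut_nonneg (a b t : ℝ) : 0 ≤ cut a b t :=
  mul_nonneg (smoothTransition.nonneg _) (smoothTransition.nonneg _)

lemma cut_le_one (a b t : ℝ) : cut a b t ≤ 1 :=
  mul_le_one₀ (smoothTransition.le_one _) (smoothTransition.nonneg _) (smoothTransition.le_one _)

lemma cut_supp (a b : ℝ) : Supp (cut a b) a b := by
  intro t ht
  rw [Set.mem_Icc, not_and_or, not_le, not_le] at ht
  unfold cut
  rcases ht with h | h
  · rw [smoothTransition.zero_of_nonpos (x := t - a) (by linarith), zero_mul]
  · rw [smoothTransition.zero_of_nonpos (x := b - t) (by linarith), mul_zero]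

lemma cut_one {a b t : ℝ} (h1 : a + 1 ≤ t) (h2 : t ≤ b - 1) : cut a b t = 1 := by
  unfold cut
  rw [smoothTransition.one_of_one_le (x := t - a) (by linarith),
    smoothTransition.one_of_one_le (x := b - t) (by linarith), one_mul]

lemma cut'_bdd : ∃ M : ℝ, 0 ≤ M ∧ ∀ a b t, |cut' a b t| ≤ M := by
  obtain ⟨M, hM, h⟩ := T'_bdd
  refine ⟨M, hM, fun a b t => ?_⟩
  have h1 := T'_nonneg (t - a); have h2 := T'_nonneg (b - t)
  have h3 := h (t - a); have h4 := h (b - t)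
  have h5 := smoothTransition.nonneg (t - a); have h6 := smoothTransition.nonneg (b - t)
  have h7 := smoothTransition.le_one (t - a); have h8 := smoothTransition.le_one (b - t)
  unfold cut'
  rw [abs_le]; constructor <;> nlinarith

/-! ### comparison of integrals -/

lemma int_le_ann {N : ℕ} (hN : 2 ≤ N) {F f : E N → ℝ} {a b : ℝ} (hf : ContinuousOn f {0}ᶜ)
    (hF : Integrable F (nu N)) (h1 : ∀ x, x ≠ 0 → x ∈ ann N a b → F x ≤ f x)
    (h0 : ∀ x, x ≠ 0 → x ∉ ann N a b → F x ≤ 0) : ∫ x, F x ∂(nu N) ≤ ∫ x in ann N a b, f x ∂(nu N) := by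
  rw [← integral_indicator (measurableSet_ann a b)]
  refine integral_mono_ae hF ((integrable_indicator_iff (measurableSet_ann a b)).2 (integrableOn_ann hf a b)) ?_
  filter_upwards [ae_nu_ne_zero hN] with x hx
  by_cases h : x ∈ ann N a b
  · rw [Set.indicator_of_mem h]; exact h1 x hx h
  · rw [Set.indicator_of_notMem h]; exact h0 x hx h

lemma ann_le_int {N : ℕ} (hN : 2 ≤ N) {F f : E N → ℝ} {a b : ℝ} (hf : ContinuousOn f {0}ᶜ)
    (hF : Integrable F (nu N)) (h1 : ∀ x, x ≠ 0 → x ∈ ann N a b → f x ≤ F x)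
    (h0 : ∀ x, x ≠ 0 → x ∉ ann N a b → 0 ≤ F x) : ∫ x in ann N a b, f x ∂(nu N) ≤ ∫ x, F x ∂(nu N) := by
  have := int_le_ann hN (F := fun x => - F x) (f := fun x => - f x) (a := a) (b := b) hf.neg hF.neg
    (fun x hx h => neg_le_neg (h1 x hx h)) (fun x hx h => neg_nonpos.2 (h0 x hx h))
  rw [integral_neg, integral_neg] at this
  linarith

lemma ann_mono_int {N : ℕ} {f : E N → ℝ} {a b a' b' : ℝ} (hf : ContinuousOn f {0}ᶜ)
    (h0 : ∀ x, x ≠ 0 → 0 ≤ f x) (ha : a' ≤ a) (hb : b ≤ b') :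
    ∫ x in ann N a b, f x ∂(nu N) ≤ ∫ x in ann N a' b', f x ∂(nu N) := by
  refine setIntegral_mono_set (integrableOn_ann hf a' b') ?_ (Eventually.of_forall ?_)
  · rw [EventuallyLE, ae_restrict_iff' (measurableSet_ann _ _)]
    filter_upwards with x hx using h0 x (ne_zero_of_mem_ann hx)
  · intro x hx
    exact ⟨(exp_le_exp.2 ha).trans hx.1, hx.2.trans (exp_le_exp.2 hb)⟩

lemma ann_int_nonneg {N : ℕ} {f : E N → ℝ} (h0 : ∀ x, x ≠ 0 → 0 ≤ f x) (a b : ℝ) :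
    0 ≤ ∫ x in ann N a b, f x ∂(nu N) :=
  setIntegral_nonneg (measurableSet_ann _ _) fun x hx => h0 x (ne_zero_of_mem_ann hx)

lemma ann_add {N : ℕ} {f : E N → ℝ} (hf : ContinuousOn f {0}ᶜ)
    (h0 : ∀ x, x ≠ 0 → 0 ≤ f x) (a b c : ℝ) :
    ∫ x in ann N a c, f x ∂(nu N) ≤ ∫ x in ann N a b, f x ∂(nu N) + ∫ x in ann N b c, f x ∂(nu N) := by
  have i1 := (integrable_indicator_iff (measurableSet_ann (N := N) a b)).2 (integrableOn_ann hf a b)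
  have i2 := (integrable_indicator_iff (measurableSet_ann (N := N) b c)).2 (integrableOn_ann hf b c)
  have i3 := (integrable_indicator_iff (measurableSet_ann (N := N) a c)).2 (integrableOn_ann hf a c)
  rw [← integral_indicator (measurableSet_ann a b), ← integral_indicator (measurableSet_ann b c),
    ← integral_indicator (measurableSet_ann a c), ← integral_add i1 i2]
  refine integral_mono i3 (i1.add i2) ?_
  intro x
  show (ann N a c).indicator f x ≤ (ann N a b).indicator f x + (ann N b c).indicator f x
  have p1 : 0 ≤ (ann N a b).indicator f x := Set.indicator_nonneg (fun y hy => h0 y (ne_zero_of_mem_ann hy)) x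
  have p2 : 0 ≤ (ann N b c).indicator f x := Set.indicator_nonneg (fun y hy => h0 y (ne_zero_of_mem_ann hy)) x
  by_cases h : x ∈ ann N a c
  · rw [Set.indicator_of_mem h]
    rcases le_total ‖x‖ (exp b) with hb | hb
    · have : x ∈ ann N a b := ⟨h.1, hb⟩
      rw [Set.indicator_of_mem this]; linarith
    · have : x ∈ ann N b c := ⟨hb, h.2⟩
      rw [Set.indicator_of_mem this (f := f)]; linarith
  · rw [Set.indicator_of_notMem h]; linarith

lemma ann_unif {N : ℕ} {f : E N → ℝ} (hf : ContinuousOn f {0}ᶜ) (h0 : ∀ x, x ≠ 0 → 0 ≤ f x)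
    {C : ℝ} (h : ∀ τ, ∫ x in ann N τ (τ + 1), f x ∂(nu N) ≤ C) (n : ℕ) (τ : ℝ) :
    ∫ x in ann N τ (τ + n), f x ∂(nu N) ≤ (n + 1) * C := by
  induction n with
  | zero =>
    refine (ann_mono_int hf h0 le_rfl (by simp)).trans ((h τ).trans (by simp))
  | succ n ih =>
    have e1 := ann_add hf h0 τ (τ + n) (τ + (n + 1 : ℕ))
    have e2 := h (τ + n)
    have e3 : τ + n + 1 = τ + (n + 1 : ℕ) := by push_cast; ring
    rw [e3] at e2
    push_cast at *
    linarith

namespace Dat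
variable {N : ℕ} (d : Dat N)

lemma cont_delta : ContinuousOn (fun x => 1 - d.k x) {0}ᶜ := continuousOn_const.sub d.cont_k

lemma int3 {η H : ℝ → ℝ} {f : E N → ℝ} {a b : ℝ} (hη : Continuous η) (hs : Supp η a b)
    (hH : Continuous H) (hf : ContinuousOn f {0}ᶜ) :
    Integrable (fun x => η (log ‖x‖) * (H (d.ell x) * f x)) (nu N) :=
  intg d.hN hη hs ((d.cont_G hH).mul hf)

lemma intX {η H g : ℝ → ℝ} {a b : ℝ} (hη : Continuous η) (hs : Supp η a b)
    (hH : Continuous H) (hg : Continuous g) :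
    Integrable (fun x => η (log ‖x‖) * ((d.p - 1) * H (d.ell x) - d.lam * (1 - d.k x) * g (d.ell x))) (nu N) := by
  have n3 := d.cont_G hH
  have n4 := d.cont_G hg
  have n6 := d.cont_k
  refine intg d.hN hη hs ?_
  repeat' first | assumption | exact continuousOn_const | apply ContinuousOn.fun_add | apply ContinuousOn.fun_sub | apply ContinuousOn.fun_mul | apply ContinuousOn.fun_neg

lemma III_low {η η' H g g' : ℝ → ℝ} {a b σ : ℝ} (hη : C1 η η') (hs : Supp η a b) (hH : C1 H g)
    (hg : C1 g g') (hη0 : ∀ t, 0 ≤ η t) (hg0 : ∀ t, 0 ≤ g t) (hgg : ∀ t, g' t ≤ σ * g t)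
    (hσ : d.lam * σ ≤ (d.p - 1) / 2) :
    ∫ x, η' (log ‖x‖) * ((d.p - 1) * H (d.ell x) - d.lam * (1 - d.k x) * g (d.ell x)) ∂(nu N)
      ≤ - (d.μ * (d.p - 1) / 2 * ∫ x, η (log ‖x‖) * (g (d.ell x) * d.D x) ∂(nu N)) := by
  have key := d.idIII hη hs hH hg
  have n4 := d.cont_G hg.cont
  have n5 := d.cont_G hg.c
  have n9 := d.cont_D
  have n10 := d.cont_E1
  have i1 := d.intX hη.c (hs.deriv hη) hH.cont hg.cont
  have i2 : Integrable (fun x => η (log ‖x‖) * (d.μ * (g (d.ell x) * ((d.p - 1) * d.D x + (d.lam - 1) * d.E1 x)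
        - d.lam * g' (d.ell x) * d.D x))) (nu N) := by
    refine intg d.hN hη.cont hs ?_
    repeat' first | assumption | exact continuousOn_const | apply ContinuousOn.fun_add | apply ContinuousOn.fun_sub | apply ContinuousOn.fun_mul | apply ContinuousOn.fun_neg
  have i3 : Integrable (fun x => η (log ‖x‖) * (g (d.ell x) * d.D x)) (nu N) :=
    intg d.hN hη.cont hs (n4.mul n9)
  have key2 := integral_add i1 i2
  have e : ∀ x : E N, η (log ‖x‖) * (d.μ * (g (d.ell x) * ((d.p - 1) * d.D x + (d.lam - 1) * d.E1 x)
        - d.lam * g' (d.ell x) * d.D x)) = d.μ * η (log ‖x‖) * (g (d.ell x) * ((d.p - 1) * d.D x + (d.lam - 1) * d.E1 x)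
        - d.lam * g' (d.ell x) * d.D x) := fun x => by ring
  simp only [e] at key2 i2
  rw [key] at key2
  have h3 : d.μ * (d.p - 1) / 2 * ∫ x, η (log ‖x‖) * (g (d.ell x) * d.D x) ∂(nu N) ≤
      ∫ x, d.μ * η (log ‖x‖) * (g (d.ell x) * ((d.p - 1) * d.D x + (d.lam - 1) * d.E1 x)
        - d.lam * g' (d.ell x) * d.D x) ∂(nu N) := by
    rw [← integral_const_mul]
    refine integral_mono_ae (i3.const_mul _) i2 ?_
    filter_upwards [ae_nu_ne_zero d.hN] with x hx
    have h1 := d.D_nonneg hx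
    have h2 := d.E1_nonneg hx
    have h3 := hη0 (log ‖x‖)
    have h4 := hg0 (d.ell x)
    have h5 := hgg (d.ell x)
    have h6 := d.hμ
    have h7 := d.hlam
    have h8 : d.lam * g' (d.ell x) * d.D x ≤ (d.p - 1) / 2 * g (d.ell x) * d.D x := by
      have : d.lam * g' (d.ell x) ≤ (d.p - 1) / 2 * g (d.ell x) := by
        calc d.lam * g' (d.ell x) ≤ d.lam * (σ * g (d.ell x)) := by gcongr
          _ = d.lam * σ * g (d.ell x) := by ring
          _ ≤ _ := by gcongr
      gcongr
    have h9 : 0 ≤ g (d.ell x) * ((d.lam - 1) * d.E1 x) :=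
      mul_nonneg h4 (mul_nonneg (by linarith) h2)
    have h10 : 0 ≤ d.μ * η (log ‖x‖) := by positivity
    have := mul_le_mul_of_nonneg_left (show (d.p - 1) / 2 * (g (d.ell x) * d.D x) ≤
      g (d.ell x) * ((d.p - 1) * d.D x + (d.lam - 1) * d.E1 x) - d.lam * g' (d.ell x) * d.D x by nlinarith) h10
    calc _ = d.μ * η (log ‖x‖) * ((d.p - 1) / 2 * (g (d.ell x) * d.D x)) := by ring
      _ ≤ _ := this
  linarith

lemma III_up {η η' : ℝ → ℝ} {a b : ℝ} (hη : C1 η η') (hs : Supp η a b) (hη0 : ∀ t, 0 ≤ η t) :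
    d.μ * ∫ x, η (log ‖x‖) * (exp (d.p * d.ell x) * d.D x) ∂(nu N) ≤
    ∫ x, η' (log ‖x‖) * ((d.p - 1) * (d.p⁻¹ * exp (d.p * d.ell x))
        - d.lam * (1 - d.k x) * exp (d.p * d.ell x)) ∂(nu N) := by
  have hp : 0 < d.p := by linarith [d.hp1]
  have hg := C1.expc d.p
  have hH : C1 (fun t => d.p⁻¹ * exp (d.p * t)) (fun t => exp (d.p * t)) :=
    (hg.const_mul d.p⁻¹).congr' fun t => by field_simp
  have key := d.idIII hη hs hH hg
  have n4 := d.cont_G hg.cont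
  have n5 := d.cont_G hg.c
  have n9 := d.cont_D
  have n10 := d.cont_E1
  have i1 := d.intX hη.c (hs.deriv hη) hH.cont hg.cont
  have i2 : Integrable (fun x => η (log ‖x‖) * (d.μ * (exp (d.p * d.ell x) * ((d.p - 1) * d.D x + (d.lam - 1) * d.E1 x)
        - d.lam * (d.p * exp (d.p * d.ell x)) * d.D x))) (nu N) := by
    refine intg d.hN hη.cont hs ?_
    repeat' first | assumption | exact continuousOn_const | apply ContinuousOn.fun_add | apply ContinuousOn.fun_sub | apply ContinuousOn.fun_mul | apply ContinuousOn.fun_neg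
  have i3 : Integrable (fun x => η (log ‖x‖) * (exp (d.p * d.ell x) * d.D x)) (nu N) :=
    intg d.hN hη.cont hs (n4.mul n9)
  have key2 := integral_add i1 i2
  have e : ∀ x : E N, η (log ‖x‖) * (d.μ * (exp (d.p * d.ell x) * ((d.p - 1) * d.D x + (d.lam - 1) * d.E1 x)
        - d.lam * (d.p * exp (d.p * d.ell x)) * d.D x)) = d.μ * η (log ‖x‖) * (exp (d.p * d.ell x) * ((d.p - 1) * d.D x + (d.lam - 1) * d.E1 x)
        - d.lam * (d.p * exp (d.p * d.ell x)) * d.D x) := fun x => by ring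
  simp only [e] at key2 i2
  rw [key] at key2
  have h3 : ∫ x, d.μ * η (log ‖x‖) * (exp (d.p * d.ell x) * ((d.p - 1) * d.D x + (d.lam - 1) * d.E1 x)
        - d.lam * (d.p * exp (d.p * d.ell x)) * d.D x) ∂(nu N) ≤
      - d.μ * ∫ x, η (log ‖x‖) * (exp (d.p * d.ell x) * d.D x) ∂(nu N) := by
    rw [← integral_const_mul]
    refine integral_mono_ae i2 (i3.const_mul _) ?_
    filter_upwards [ae_nu_ne_zero d.hN] with x hx
    have h1 := d.D_nonneg hx
    have h2 := d.E1_le hx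
    have h3 := hη0 (log ‖x‖)
    have h4 := (exp_pos (d.p * d.ell x)).le
    have h6 := d.hμ
    have h7 := d.hlam
    have h9 : (d.lam - 1) * d.E1 x ≤ (d.lam - 1) * (d.p * d.D x) :=
      mul_le_mul_of_nonneg_left h2 (by linarith)
    have h10 : 0 ≤ d.μ * η (log ‖x‖) * exp (d.p * d.ell x) := by positivity
    have := mul_le_mul_of_nonneg_left (show ((d.p - 1) * d.D x + (d.lam - 1) * d.E1 x)
        - d.lam * d.p * d.D x ≤ - d.D x by nlinarith) h10
    calc _ = d.μ * η (log ‖x‖) * exp (d.p * d.ell x) * (((d.p - 1) * d.D x + (d.lam - 1) * d.E1 x)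
        - d.lam * d.p * d.D x) := by ring
      _ ≤ _ := this
      _ = _ := by ring
  linarith

end Dat
end RS

namespace RS

lemma young_cut {p κ ξ q : ℝ} {N : ℕ} (hN : 2 ≤ N) (hp1 : 1 < p) (hpN : p < N) (hκ : 0 < κ) (h0 : 0 ≤ ξ) (h1 : ξ ≤ 1)
    (hq : 0 ≤ q) : ξ ^ (N - 1) * q ^ (p - 1) ≤ κ * (ξ ^ N * q ^ p) + (1 / κ) ^ (p - 1) := by
  have hb : 0 ≤ (1 / κ) ^ (p - 1) := by positivity
  rcases le_total 1 (κ * (ξ * q)) with h | h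
  · have e1 : ξ ^ N = ξ ^ (N - 1) * ξ := by
      rw [← pow_succ]; congr 1; omega
    have e2 := qp_eq hp1 hq
    have : 0 ≤ ξ ^ (N - 1) * q ^ (p - 1) := by positivity
    calc _ ≤ ξ ^ (N - 1) * q ^ (p - 1) * (κ * (ξ * q)) := le_mul_of_one_le_right this h
      _ = κ * (ξ ^ N * q ^ p) := by rw [e1, e2]; ring
      _ ≤ _ := by linarith
  · have e1 : ξ ^ (N - 1) ≤ ξ ^ (p - 1) := by
      rw [← Real.rpow_natCast]
      refine Real.rpow_le_rpow_of_exponent_ge' h0 h1 (by linarith) ?_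
      rw [Nat.cast_sub (by omega)]; push_cast; linarith
    have e3 : 0 ≤ ξ ^ N * q ^ p := by positivity
    calc _ ≤ ξ ^ (p - 1) * q ^ (p - 1) := by gcongr
      _ = (ξ * q) ^ (p - 1) := (Real.mul_rpow h0 hq).symm
      _ ≤ (1 / κ) ^ (p - 1) := by
        refine Real.rpow_le_rpow (by positivity) ?_ (by linarith)
        rw [le_div_iff₀ hκ]; linarith
      _ ≤ _ := by nlinarith

/-- uniformly bounded unit-window integrals -/
def Bd {N : ℕ} (f : E N → ℝ) : Prop := ∃ C : ℝ, 0 ≤ C ∧ ∀ τ, ∫ x in ann N τ (τ + 1), f x ∂(nu N) ≤ C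

lemma Bd.win {N : ℕ} {f : E N → ℝ} (h : Bd f) (hf : ContinuousOn f {0}ᶜ) (h0 : ∀ x, x ≠ 0 → 0 ≤ f x) (n : ℕ) :
    ∃ C : ℝ, 0 ≤ C ∧ ∀ a b : ℝ, b ≤ a + n → ∫ x in ann N a b, f x ∂(nu N) ≤ C := by
  obtain ⟨C, hC, h⟩ := h
  refine ⟨(n + 1) * C, by positivity, fun a b hb => ?_⟩
  exact (ann_mono_int hf h0 le_rfl hb).trans (ann_unif hf h0 h n a)

lemma ann_mono {N : ℕ} {f g : E N → ℝ} (hf : ContinuousOn f {0}ᶜ) (hg : ContinuousOn g {0}ᶜ)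
    (h : ∀ x, x ≠ 0 → f x ≤ g x) (a b : ℝ) : 
    ∫ x in ann N a b, f x ∂(nu N) ≤ ∫ x in ann N a b, g x ∂(nu N) :=
  setIntegral_mono_on (integrableOn_ann hf a b) (integrableOn_ann hg a b) (measurableSet_ann _ _)
    fun x hx => h x (ne_zero_of_mem_ann hx)

lemma Bd.mono {N : ℕ} {f g : E N → ℝ} (h : Bd g) (hf : ContinuousOn f {0}ᶜ) (hg : ContinuousOn g {0}ᶜ)
    (hfg : ∀ x, x ≠ 0 → f x ≤ g x) : Bd f := by
  obtain ⟨C, hC, h⟩ := h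
  exact ⟨C, hC, fun τ => (ann_mono hf hg hfg _ _).trans (h τ)⟩

lemma Bd.add {N : ℕ} {f g : E N → ℝ} (h : Bd f) (h' : Bd g) (hf : ContinuousOn f {0}ᶜ) (hg : ContinuousOn g {0}ᶜ) :
    Bd (fun x => f x + g x) := by
  obtain ⟨C, hC, h⟩ := h
  obtain ⟨C', hC', h'⟩ := h'
  refine ⟨C + C', by positivity, fun τ => ?_⟩
  rw [integral_add (integrableOn_ann hf _ _) (integrableOn_ann hg _ _)]
  exact add_le_add (h τ) (h' τ)

lemma Bd.const_mul {N : ℕ} {f : E N → ℝ} (h : Bd f) {c : ℝ} (hc : 0 ≤ c) : Bd (fun x => c * f x) := by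
  obtain ⟨C, hC, h⟩ := h
  refine ⟨c * C, by positivity, fun τ => ?_⟩
  rw [integral_const_mul]
  exact mul_le_mul_of_nonneg_left (h τ) hc

lemma Bd_one {N : ℕ} : Bd (fun _ : E N => (1:ℝ)) := by
  refine ⟨V1 N, V1_nonneg N, fun τ => ?_⟩
  rw [setIntegral_const, nu_unit]; simp

namespace Dat
variable {N : ℕ} (d : Dat N)

lemma intA {η η' g g' : ℝ → ℝ} {a b : ℝ} (hη : C1 η η') (hs : Supp η a b) (hg : C1 g g') :
    Integrable (fun x => (-((((d.p - N) * η (log ‖x‖) + η' (log ‖x‖)) * g (d.ell x)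
        + d.μ * η (log ‖x‖) * g' (d.ell x)) * d.k x)
      + d.μ * ((1 - d.p) * η (log ‖x‖) * g (d.ell x) + η (log ‖x‖) * g' (d.ell x)) * d.q x ^ d.p
      - ((N - d.p) - (d.p - 1) * d.μ) * (η (log ‖x‖) * g (d.ell x)))) (nu N) := by
  have hsd := hs.deriv hη
  have n1 := cont_eta (N := N) hη.cont
  have n2 := cont_eta (N := N) hη.c
  have n4 := d.cont_G hg.cont
  have n5 := d.cont_G hg.c
  have n6 := d.cont_k
  have n7 := d.cont_qp
  exact (Nice.int d.hN (a := a) (b := b)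
      ⟨by
          repeat' first | assumption | exact continuousOn_const | apply ContinuousOn.fun_add | apply ContinuousOn.fun_sub | apply ContinuousOn.fun_mul | apply ContinuousOn.fun_neg, fun x hx hxa => by
        simp only [zero_off_ann hs hx hxa, zero_off_ann hsd hx hxa]; ring⟩)

lemma abs_k_le {x : E N} (hx : x ≠ 0) : |d.k x| ≤ d.q x ^ (d.p - 1) := abs_kk_le d.hp1 (d.abs_s_le hx)

lemma cont_exp (s₀ : ℝ) : ContinuousOn (fun x => exp (s₀ * d.ell x)) {0}ᶜ :=
  d.cont_G (G := fun t => exp (s₀ * t)) (by fun_prop)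

lemma cacc {s₀ M : ℝ} (hs₀ : s₀ ≠ d.p - 1) (hM : 0 ≤ M) : ∃ C : ℝ, 0 ≤ C ∧ ∀ (a b : ℝ) (ξ ξ' : ℝ → ℝ),
    C1 ξ ξ' → Supp ξ a b → (∀ t, 0 ≤ ξ t) → (∀ t, ξ t ≤ 1) → (∀ t, |ξ' t| ≤ M) →
    ∫ x, ξ (log ‖x‖) ^ N * (exp (s₀ * d.ell x) * d.q x ^ d.p) ∂(nu N) ≤
      C * ∫ x in ann N a b, exp (s₀ * d.ell x) ∂(nu N) := by
  have hp1 := d.hp1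
  have hpN := d.hpN
  have hμ := d.hμ
  set A := d.μ * (s₀ - (d.p - 1)) with hA
  have hA0 : A ≠ 0 := mul_ne_zero hμ.ne' (sub_ne_zero.2 hs₀)
  have hAp : 0 < |A| := abs_pos.2 hA0
  set B := (N - d.p) + N * M + d.μ * |s₀| with hB
  have hB0 : 0 ≤ B := by have : (0:ℝ) ≤ N := by positivity
                         have : 0 ≤ N - d.p := by linarith
                         positivity
  set κ := |A| / (2 * (B + 1)) with hκ
  have hκ0 : 0 < κ := by positivity
  have hκB : B * κ ≤ |A| / 2 := by
    rw [hκ, ← mul_div_assoc, div_le_div_iff₀ (by positivity) (by positivity)]; nlinarith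
  set c0 := |(N - d.p) - (d.p - 1) * d.μ| with hc0
  set C1' := B * (1 / κ) ^ (d.p - 1) + c0 with hC1
  have hC10 : 0 ≤ C1' := by positivity
  refine ⟨2 / |A| * C1', by positivity, fun a b ξ ξ' hξ hs h0 h1 hM' => ?_⟩
  have hsN : Supp (fun t => ξ t ^ N) a b := fun t ht => by
    simp only [hs t ht]; exact zero_pow (by have := d.hN; omega)
  have key := d.idA (hξ.pow N) hsN (C1.expc s₀)
  have iA := d.intA (hξ.pow N) hsN (C1.expc s₀)
  have iL : Integrable (fun x => ξ (log ‖x‖) ^ N * (exp (s₀ * d.ell x) * d.q x ^ d.p)) (nu N) :=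
    intg d.hN (hξ.pow N).cont hsN ((d.cont_exp s₀).mul d.cont_qp)
  obtain ⟨ε, hε, hεA⟩ : ∃ ε : ℝ, |ε| = 1 ∧ ε * A = |A| := by
    rcases lt_or_gt_of_ne hA0 with h | h
    · exact ⟨-1, by simp, by rw [abs_of_neg h]; ring⟩
    · exact ⟨1, by simp, by rw [abs_of_pos h]; ring⟩
  have main := int_le_ann d.hN (F := fun x => |A| / 2 * (ξ (log ‖x‖) ^ N * (exp (s₀ * d.ell x) * d.q x ^ d.p))
    - ε * (-((((d.p - N) * ξ (log ‖x‖) ^ N + N * ξ (log ‖x‖) ^ (N - 1) * ξ' (log ‖x‖)) * exp (s₀ * d.ell x)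
        + d.μ * ξ (log ‖x‖) ^ N * (s₀ * exp (s₀ * d.ell x))) * d.k x)
      + d.μ * ((1 - d.p) * ξ (log ‖x‖) ^ N * exp (s₀ * d.ell x) + ξ (log ‖x‖) ^ N * (s₀ * exp (s₀ * d.ell x))) * d.q x ^ d.p
      - ((N - d.p) - (d.p - 1) * d.μ) * (ξ (log ‖x‖) ^ N * exp (s₀ * d.ell x))))
    (f := fun x => C1' * exp (s₀ * d.ell x)) (a := a) (b := b) (continuousOn_const.mul (d.cont_exp s₀))
    ((iL.const_mul _).sub (iA.const_mul ε)) ?_ ?_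
  · rw [integral_sub (iL.const_mul _) (iA.const_mul ε), integral_const_mul, integral_const_mul, key,
      integral_const_mul] at main
    have h2 : 2 / |A| * (|A| / 2) = 1 := by field_simp
    calc _ = 2 / |A| * (|A| / 2 * ∫ x, ξ (log ‖x‖) ^ N * (exp (s₀ * d.ell x) * d.q x ^ d.p) ∂(nu N)) := by
          rw [← mul_assoc, h2, one_mul]
      _ ≤ 2 / |A| * (C1' * ∫ x in ann N a b, exp (s₀ * d.ell x) ∂(nu N)) := by
          exact mul_le_mul_of_nonneg_left (by linarith) (by positivity)
      _ = _ := by ring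
  · intro x hx _
    have b1 := d.abs_k_le hx
    have b2 := h0 (log ‖x‖)
    have b3 := h1 (log ‖x‖)
    have b4 := hM' (log ‖x‖)
    have b5 := young_cut d.hN hp1 hpN hκ0 b2 b3 (d.q_nonneg hx)
    set z := ξ (log ‖x‖)
    set z' := ξ' (log ‖x‖)
    set e := exp (s₀ * d.ell x)
    have he : 0 < e := exp_pos _
    have hzN : z ^ N ≤ z ^ (N - 1) := pow_le_pow_of_le_one b2 b3 (by omega)
    have hzN1 : z ^ N ≤ 1 := pow_le_one₀ b2 b3
    have hz0 : 0 ≤ z ^ N := by positivity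
    have hz1 : 0 ≤ z ^ (N - 1) := by positivity
    have hQ : 0 ≤ d.q x ^ d.p := Real.rpow_nonneg (d.q_nonneg hx) _
    have t1 : |ε * ((((d.p - N) * z ^ N + N * z ^ (N - 1) * z') + d.μ * z ^ N * s₀) * d.k x)|
        ≤ B * (z ^ (N - 1) * d.q x ^ (d.p - 1)) := by
      rw [abs_mul, hε, one_mul, abs_mul, ← mul_assoc]
      refine mul_le_mul ?_ b1 (abs_nonneg _) (by positivity)
      calc _ ≤ |(d.p - N) * z ^ N| + |N * z ^ (N - 1) * z'| + |d.μ * z ^ N * s₀| :=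
            (abs_add_le _ _).trans (add_le_add_left (abs_add_le _ _) _)
        _ = (N - d.p) * z ^ N + N * z ^ (N - 1) * |z'| + d.μ * z ^ N * |s₀| := by
            rw [abs_mul, abs_mul, abs_mul, abs_mul, abs_mul, abs_of_nonneg hz0, abs_of_nonneg hz1,
              abs_of_pos hμ, abs_of_neg (show d.p - N < 0 by linarith), Nat.abs_cast]; ring
        _ ≤ (N - d.p) * z ^ (N - 1) + N * z ^ (N - 1) * M + d.μ * z ^ (N - 1) * |s₀| := by
            have : 0 ≤ N - d.p := by linarith
            gcongr
        _ = B * z ^ (N - 1) := by rw [hB]; ring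
    have t2 : ε * (((N - d.p) - (d.p - 1) * d.μ) * z ^ N) ≤ c0 := by
      refine (le_abs_self _).trans ?_
      rw [abs_mul, hε, one_mul, abs_mul, abs_of_nonneg hz0]
      exact mul_le_of_le_one_right (abs_nonneg _) hzN1
    have t3 := le_of_abs_le t1
    have t4 : B * (z ^ (N - 1) * d.q x ^ (d.p - 1)) ≤ |A| / 2 * (z ^ N * d.q x ^ d.p) + B * (1 / κ) ^ (d.p - 1) := by
      calc _ ≤ B * (κ * (z ^ N * d.q x ^ d.p) + (1 / κ) ^ (d.p - 1)) := by gcongr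
        _ = B * κ * (z ^ N * d.q x ^ d.p) + B * (1 / κ) ^ (d.p - 1) := by ring
        _ ≤ _ := by gcongr
    have t5 : |A| / 2 * (z ^ N * d.q x ^ d.p) + ε * ((((d.p - N) * z ^ N + N * z ^ (N - 1) * z') + d.μ * z ^ N * s₀) * d.k x)
       - ε * A * (z ^ N * d.q x ^ d.p) + ε * (((N - d.p) - (d.p - 1) * d.μ) * z ^ N) ≤ C1' := by
      rw [hεA]; linarith
    have t6 := mul_le_mul_of_nonneg_left t5 he.le
    calc _ = _ := ?_
      _ ≤ _ := t6
      _ = _ := by ring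
    rw [hA]; ring
  · intro x hx hxa
    have z1 : ξ (log ‖x‖) = 0 := zero_off_ann hs hx hxa
    have z2 : ξ' (log ‖x‖) = 0 := zero_off_ann (hs.deriv hξ) hx hxa
    have : N ≠ 0 := by have := d.hN; omega
    simp [z1, z2, zero_pow this]

lemma qp_nonneg {x : E N} (hx : x ≠ 0) : 0 ≤ d.q x ^ d.p := Real.rpow_nonneg (d.q_nonneg hx) _

lemma cacc_bd {s₀ : ℝ} (hs₀ : s₀ ≠ d.p - 1) (h : Bd (fun x => exp (s₀ * d.ell x))) :
    Bd (fun x => exp (s₀ * d.ell x) * d.q x ^ d.p) := by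
  obtain ⟨M, hM, hM'⟩ := cut'_bdd
  obtain ⟨C, hC, hC'⟩ := d.cacc hs₀ hM
  obtain ⟨C2, hC2, hC2'⟩ := h.win (d.cont_exp s₀) (fun x _ => (exp_pos _).le) 3
  refine ⟨C * C2, by positivity, fun τ => ?_⟩
  have e := hC' (τ - 1) (τ + 2) _ _ (cut_C1 _ _) (cut_supp _ _) (cut_nonneg _ _) (cut_le_one _ _) (hM' _ _)
  have hsN : Supp (fun t => cut (τ - 1) (τ + 2) t ^ N) (τ - 1) (τ + 2) := fun t ht => by
    simp only [cut_supp _ _ t ht]; exact zero_pow (by have := d.hN; omega)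
  calc _ ≤ ∫ x, cut (τ - 1) (τ + 2) (log ‖x‖) ^ N * (exp (s₀ * d.ell x) * d.q x ^ d.p) ∂(nu N) := by
        refine ann_le_int d.hN ((d.cont_exp s₀).mul d.cont_qp) 
          (intg d.hN ((cut_C1 _ _).pow N).cont hsN ((d.cont_exp s₀).mul d.cont_qp)) ?_ ?_
        · intro x hx hxa
          have := (mem_ann_iff hx).1 hxa
          rw [cut_one (by linarith [this.1]) (by linarith [this.2]), one_pow, one_mul]
        · intro x hx _
          have := cut_nonneg (τ - 1) (τ + 2) (log ‖x‖)
          have := d.qp_nonneg hx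
          positivity
    _ ≤ _ := e
    _ ≤ _ := mul_le_mul_of_nonneg_left (hC2' _ _ (by push_cast; linarith)) hC

end Dat

lemma sobolev {N : ℕ} (hN : 2 ≤ N) : ∃ C : ℝ, 0 ≤ C ∧ ∀ f : E N → ℝ, ContDiff ℝ 1 f → HasCompactSupport f →
    ∫ x, |f x| ^ ((N : ℝ) / (N - 1)) ≤ C * (∫ x, ‖fderiv ℝ f x‖) ^ ((N : ℝ) / (N - 1)) := by
  have hN' : (2:ℝ) ≤ N := by exact_mod_cast hN
  set χ : ℝ := (N : ℝ) / (N - 1) with hχ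
  have hχ0 : 0 < χ := div_pos (by linarith) (by linarith)
  have hcj : Real.HolderConjugate (Module.finrank ℝ (E N)) χ := by
    rw [finrank_euclideanSpace_fin]
    exact Real.HolderConjugate.conjExponent (by linarith)
  refine ⟨(lintegralPowLePowLIntegralFDerivConst (volume : Measure (E N)) χ : ℝ), NNReal.coe_nonneg _, fun f hf hc => ?_⟩
  have h := lintegral_pow_le_pow_lintegral_fderiv (volume : Measure (E N)) hf hc hcj
  have hfd : Integrable (fderiv ℝ f) := (hf.continuous_fderiv one_ne_zero).integrable_of_hasCompactSupport (hc.fderiv ℝ)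
  have e2 : ∫⁻ x, ‖fderiv ℝ f x‖ₑ = ENNReal.ofReal (∫ x, ‖fderiv ℝ f x‖) :=
    (ofReal_integral_norm_eq_lintegral_enorm hfd).symm
  rw [e2] at h
  have hn : 0 ≤ ∫ x, ‖fderiv ℝ f x‖ := integral_nonneg fun x => norm_nonneg _
  rw [integral_eq_lintegral_of_nonneg_ae]
  · have e1 : ∀ x, ENNReal.ofReal (|f x| ^ χ) = ‖f x‖ₑ ^ χ := fun x => by
      rw [← Real.norm_eq_abs, ← ENNReal.ofReal_rpow_of_nonneg (norm_nonneg _) hχ0.le, ofReal_norm]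
    simp_rw [e1]
    refine ENNReal.toReal_le_of_le_ofReal (by positivity) (h.trans ?_)
    rw [ENNReal.ofReal_mul (NNReal.coe_nonneg _), ENNReal.ofReal_rpow_of_nonneg hn hχ0.le, ENNReal.ofReal_coe_nnreal]
  · exact Eventually.of_forall fun x => by positivity
  · exact (hf.continuous.abs.rpow_const fun x => Or.inr hχ0.le).aestronglyMeasurable

namespace Dat
variable {N : ℕ} (d : Dat N)

lemma q_le {x : E N} (hx : x ≠ 0) : d.q x ≤ 1 + d.q x ^ d.p := by
  have h0 := d.q_nonneg hx
  rcases le_total (d.q x) 1 with h | h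
  · linarith [d.qp_nonneg hx]
  · have := Real.rpow_le_rpow_of_exponent_le h d.hp1.le
    rw [Real.rpow_one] at this; linarith

lemma tf_fderiv_norm {η η' G G' : ℝ → ℝ} (hη : C1 η η') (hG : C1 G G') {x : E N} (hx : x ≠ 0) :
    ‖fderiv ℝ (d.tf η G) x‖ ≤ (|η' (log ‖x‖)| * |G (d.ell x)| + |η (log ‖x‖)| * |G' (d.ell x)| * (d.μ * (1 + d.q x))) / ‖x‖ := by
  have h3 := norm_pos_iff.2 hx
  have h4 := d.pos x hx
  have h5 := d.hμ
  have h6 := d.q_nonneg hx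
  refine ContinuousLinearMap.opNorm_le_bound _ (by positivity) fun ξ => ?_
  rw [d.tf_fderiv hη hG hx, Real.norm_eq_abs]
  have a1 : |⟪x, ξ⟫ / ‖x‖ ^ 2| ≤ ‖ξ‖ / ‖x‖ := by
    rw [abs_div, abs_of_pos (pow_pos h3 2), div_le_div_iff₀ (by positivity) h3]
    nlinarith [abs_real_inner_le_norm x ξ]
  have a2 : |⟪gradient d.v x, ξ⟫ / d.v x| ≤ d.μ * d.q x * (‖ξ‖ / ‖x‖) := by
    rw [abs_div, abs_of_pos h4, div_le_iff₀ h4]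
    refine (abs_real_inner_le_norm _ _).trans (le_of_eq ?_)
    rw [d.grad_norm hx]; field_simp
  calc _ ≤ |η' (log ‖x‖)| * |G (d.ell x)| * |⟪x, ξ⟫ / ‖x‖ ^ 2| + |η (log ‖x‖)| * |G' (d.ell x)| *
        (|⟪gradient d.v x, ξ⟫ / d.v x| + d.μ * |⟪x, ξ⟫ / ‖x‖ ^ 2|) := by
        refine (abs_add_le _ _).trans ?_
        rw [abs_mul, abs_mul, abs_mul, abs_mul]
        gcongr
        refine (abs_add_le _ _).trans ?_
        rw [abs_mul, abs_of_pos h5]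
    _ ≤ |η' (log ‖x‖)| * |G (d.ell x)| * (‖ξ‖ / ‖x‖) + |η (log ‖x‖)| * |G' (d.ell x)| *
        (d.μ * d.q x * (‖ξ‖ / ‖x‖) + d.μ * (‖ξ‖ / ‖x‖)) := by gcongr
    _ = _ := by ring

lemma integral_vol (f : E N → ℝ) (hN : 2 ≤ N) : ∫ x, f x = ∫ x, ‖x‖ ^ N * f x ∂(nu N) := by
  rw [integral_nu]
  refine integral_congr_ae ?_
  filter_upwards [ae_ne_zero hN] with x hx
  have := norm_pos_iff.2 hx
  field_simp

lemma sob_bd {s₀ : ℝ} (h : Bd (fun x => exp (s₀ * d.ell x)))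
    (h' : Bd (fun x => exp (s₀ * d.ell x) * d.q x ^ d.p)) :
    Bd (fun x => exp (s₀ * ((N : ℝ) / (N - 1)) * d.ell x)) := by
  have hN' : (2:ℝ) ≤ N := by exact_mod_cast d.hN
  obtain ⟨Cs, hCs, hsob⟩ := sobolev d.hN
  set χ : ℝ := (N : ℝ) / (N - 1) with hχ
  have hχ0 : 0 < χ := div_pos (by linarith) (by linarith)
  obtain ⟨M, hM, hM'⟩ := cut'_bdd
  have hμ := d.hμ
  have c1 := d.cont_exp s₀
  have c2 : ContinuousOn (fun x => exp (s₀ * d.ell x) * d.q x ^ d.p) {0}ᶜ := c1.mul d.cont_qp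
  set A := M + (N - 1) + 2 * d.μ * |s₀| with hA
  have hA0 : 0 ≤ A := by have : (0:ℝ) ≤ N - 1 := by linarith
                         positivity
  have hB := ((h.add h' c1 c2).const_mul hA0)
  have cB : ContinuousOn (fun x => A * (exp (s₀ * d.ell x) + exp (s₀ * d.ell x) * d.q x ^ d.p)) {0}ᶜ :=
    continuousOn_const.mul (c1.add c2)
  obtain ⟨C2, hC2, hC2'⟩ := hB.win cB (fun x hx => by have := d.qp_nonneg hx; positivity) 3
  refine ⟨Cs * C2 ^ χ, by positivity, fun τ => ?_⟩
  set ζ := cut (τ - 1) (τ + 2) with hζ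
  have hζ1 : C1 ζ _ := cut_C1 _ _
  have hη := (C1.expc (-((N:ℝ) - 1))).mul hζ1
  have hsη : Supp (fun t => exp (-((N:ℝ) - 1) * t) * ζ t) (τ - 1) (τ + 2) := fun t ht => by
    simp only [hζ, cut_supp _ _ t ht, mul_zero]
  have hG := C1.expc s₀
  set F := d.tf (fun t => exp (-((N:ℝ) - 1) * t) * ζ t) (fun t => exp (s₀ * t)) with hF
  have hFd : ContDiff ℝ 1 F := d.tf_contDiff hη hG hsη
  have hFc : HasCompactSupport F := d.tf_compact hsη
  have hFs : tsupport F ⊆ ann N (τ - 1) (τ + 2) := d.tf_tsupport hsη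
  have hs := hsob F hFd hFc
  have L1 : ∫ x in ann N τ (τ + 1), exp (s₀ * χ * d.ell x) ∂(nu N) ≤ ∫ x, |F x| ^ χ := by
    rw [integral_vol _ d.hN]
    refine ann_le_int d.hN (d.cont_exp _) ?_ ?_ ?_
    · refine Nice.int d.hN (a := τ - 1) (b := τ + 2) ⟨?_, ?_⟩
      · refine (ContinuousOn.mul (by fun_prop) ?_)
        exact (hFd.continuous.abs.rpow_const fun x => Or.inr hχ0.le).continuousOn
      · intro x hx hxa
        rw [hF, d.tf_off hsη hxa, abs_zero, Real.zero_rpow hχ0.ne', mul_zero]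
    · intro x hx hxa
      have := (mem_ann_iff hx).1 hxa
      have hr := norm_pos_iff.2 hx
      rw [hF, d.tf_ne hx, hζ, cut_one (by linarith [this.1]) (by linarith [this.2]), mul_one, ← Real.exp_add,
        abs_of_pos (exp_pos _), ← Real.exp_mul, ← Real.rpow_natCast, Real.rpow_def_of_pos hr, ← Real.exp_add]
      refine le_of_eq ?_
      congr 1
      have : ((N:ℝ) - 1) * χ = N := by rw [hχ]; exact mul_div_cancel₀ _ (by linarith)
      linear_combination (log ‖x‖) * this
    · intro x hx _
      positivity
  have L2 : ∫ x, ‖fderiv ℝ F x‖ ≤ C2 := by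
    rw [integral_vol _ d.hN]
    refine le_trans ?_ (hC2' (τ - 1) (τ + 2) (by push_cast; linarith))
    refine int_le_ann d.hN cB ?_ ?_ ?_
    · refine Nice.int d.hN (a := τ - 1) (b := τ + 2) ⟨?_, ?_⟩
      · exact (ContinuousOn.mul (by fun_prop) ((hFd.continuous_fderiv one_ne_zero).norm.continuousOn))
      · intro x hx hxa
        rw [fderiv_zero_off hFs hxa, norm_zero, mul_zero]
    · intro x hx _
      have hr := norm_pos_iff.2 hx
      have b1 := d.tf_fderiv_norm hη hG hx
      have b2 := d.q_nonneg hx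
      have b3 := d.q_le hx
      have b4 := hM' (τ - 1) (τ + 2) (log ‖x‖)
      have b5 := cut_nonneg (τ - 1) (τ + 2) (log ‖x‖)
      have b6 := cut_le_one (τ - 1) (τ + 2) (log ‖x‖)
      have b7 := d.qp_nonneg hx
      have e1 : exp (-((N:ℝ) - 1) * log ‖x‖) * ‖x‖ ^ N = ‖x‖ := by
        rw [← Real.rpow_natCast, Real.rpow_def_of_pos hr, ← Real.exp_add]
        conv_rhs => rw [← Real.exp_log hr]
        congr 1; ring
      simp only [← hζ] at b4 b5 b6
      set e := exp (-((N:ℝ) - 1) * log ‖x‖)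
      have he : 0 < e := exp_pos _
      set g := exp (s₀ * d.ell x)
      have hg : 0 < g := exp_pos _
      set z := ζ (log ‖x‖)
      set z' := cut' (τ - 1) (τ + 2) (log ‖x‖)
      have d1 : |-((N:ℝ) - 1) * e * z + e * z'| ≤ e * ((N - 1) + M) := by
        calc _ ≤ |-((N:ℝ) - 1) * e * z| + |e * z'| := abs_add_le _ _
          _ = e * ((N - 1) * z + |z'|) := by
            rw [abs_mul, abs_mul, abs_mul, abs_neg, abs_of_pos he, abs_of_nonneg b5, abs_of_nonneg (show (0:ℝ) ≤ N - 1 by linarith)]; ring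
          _ ≤ _ := by
            have : (0:ℝ) ≤ N - 1 := by linarith
            gcongr
            exact mul_le_of_le_one_right this b6
      have d2 : |e * z| ≤ e := by
        rw [abs_of_nonneg (by positivity)]; exact mul_le_of_le_one_right he.le b6
      have d3 : |s₀ * g| = |s₀| * g := by rw [abs_mul, abs_of_pos hg]
      calc _ ≤ ‖x‖ ^ N * ((|-((N:ℝ) - 1) * e * z + e * z'| * |g| + |e * z| * |s₀ * g| * (d.μ * (1 + d.q x))) / ‖x‖) := by
            gcongr
        _ ≤ ‖x‖ ^ N * ((e * ((N - 1) + M) * g + e * (|s₀| * g) * (d.μ * (1 + d.q x))) / ‖x‖) := by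
            rw [d3, abs_of_pos hg]; gcongr
        _ = (e * ‖x‖ ^ N) / ‖x‖ * (g * ((N - 1) + M + |s₀| * d.μ * (1 + d.q x))) := by ring
        _ = g * ((N - 1) + M + |s₀| * d.μ * (1 + d.q x)) := by rw [e1, div_self hr.ne', one_mul]
        _ ≤ g * (A * (1 + d.q x ^ d.p)) := by
            gcongr
            have t1 : |s₀| * d.μ * (1 + d.q x) ≤ |s₀| * d.μ * (2 * (1 + d.q x ^ d.p)) := by gcongr; linarith
            have t2 : (N - 1) + M ≤ ((N - 1) + M) * (1 + d.q x ^ d.p) := 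
              le_mul_of_one_le_right (by linarith) (by linarith)
            calc _ ≤ _ := add_le_add t2 t1
              _ = _ := by rw [hA]; ring
        _ = _ := by ring
    · intro x hx hxa
      rw [fderiv_zero_off hFs hxa, norm_zero, mul_zero]
  calc _ ≤ _ := L1
    _ ≤ _ := hs
    _ ≤ _ := by
      gcongr

lemma bd_lower {s s' : ℝ} (h : Bd (fun x => exp (s * d.ell x))) (h0 : 0 ≤ s') (h1 : s' ≤ s) :
    Bd (fun x => exp (s' * d.ell x)) := by
  refine (Bd_one.add h continuousOn_const (d.cont_exp s)).mono (d.cont_exp s') (continuousOn_const.add (d.cont_exp s)) ?_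
  intro x _
  rcases le_total (d.ell x) 0 with hl | hl
  · have : exp (s' * d.ell x) ≤ 1 := exp_le_one_iff.2 (by nlinarith)
    linarith [exp_pos (s * d.ell x)]
  · have : exp (s' * d.ell x) ≤ exp (s * d.ell x) := exp_le_exp.2 (by nlinarith)
    linarith

lemma bd_all {σ : ℝ} (hσ : 0 < σ) (h : Bd (fun x => exp (σ * d.ell x))) {s : ℝ} (hs : 0 ≤ s) :
    Bd (fun x => exp (s * d.ell x)) := by
  have hN' : (2:ℝ) ≤ N := by exact_mod_cast d.hN
  set χ : ℝ := (N : ℝ) / (N - 1) with hχ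
  have hχ1 : 1 < χ := by rw [hχ, lt_div_iff₀ (by linarith)]; linarith
  have hr1 : 1 < √χ := by rw [Real.lt_sqrt zero_le_one]; simpa using hχ1
  have hr2 : √χ * √χ = χ := Real.mul_self_sqrt (by linarith)
  have step : ∀ n : ℕ, Bd (fun x => exp (σ * √χ ^ n * d.ell x)) := by
    intro n
    induction n with
    | zero => simpa using h
    | succ n ih =>
      have hpos : 0 < σ * √χ ^ n := by positivity
      by_cases hne : σ * √χ ^ n = d.p - 1
      · have ih' := d.bd_lower ih (s' := σ * √χ ^ n / √χ) (by positivity) (div_le_self hpos.le hr1.le)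
        have hne' : σ * √χ ^ n / √χ ≠ d.p - 1 := by
          rw [← hne]; exact (div_lt_self hpos hr1).ne
        have := d.sob_bd ih' (d.cacc_bd hne' ih')
        rw [← hχ] at this
        convert this using 4
        rw [pow_succ]; field_simp; nlinarith
      · have := d.sob_bd ih (d.cacc_bd hne ih)
        rw [← hχ] at this
        refine d.bd_lower this (by positivity) ?_
        rw [pow_succ, ← mul_assoc]
        gcongr
        nlinarith
  obtain ⟨n, hn⟩ := ((tendsto_pow_atTop_atTop_of_one_lt hr1).const_mul_atTop hσ).eventually_ge_atTop s |>.exists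
  exact d.bd_lower (step n) hs hn

end Dat
end RS

namespace RS

noncomputable def hh (σ ε t : ℝ) : ℝ := exp (σ * t) / (1 + ε * exp (σ * t))
noncomputable def gg (σ ε t : ℝ) : ℝ := exp (σ * t) / (1 + ε * exp (σ * t)) ^ 2
noncomputable def gg' (σ ε t : ℝ) : ℝ := σ * gg σ ε t * (1 - ε * exp (σ * t)) / (1 + ε * exp (σ * t))

section
variable {σ ε : ℝ}

lemma hh_den (hε : 0 < ε) (t : ℝ) : 0 < 1 + ε * exp (σ * t) := by positivity

lemma hh_deriv (hε : 0 < ε) (t : ℝ) : HasDerivAt (hh σ ε) (σ * gg σ ε t) t := by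
  have h1 := (C1.expc σ).d t
  have h2 := (h1.const_mul ε).const_add 1
  have h3 := h1.div h2 (hh_den hε t).ne'
  refine h3.congr_deriv ?_
  have := (hh_den (σ := σ) hε t).ne'
  unfold gg
  field_simp; ring

lemma gg_deriv (hε : 0 < ε) (t : ℝ) : HasDerivAt (gg σ ε) (gg' σ ε t) t := by
  have h1 := (C1.expc σ).d t
  have h2 := ((h1.const_mul ε).const_add 1).pow 2
  have h3 := h1.div h2 (pow_pos (hh_den hε t) 2).ne'
  refine h3.congr_deriv ?_
  have := (hh_den (σ := σ) hε t).ne'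
  unfold gg' gg
  field_simp
  simp; ring

lemma gg_cont (hε : 0 < ε) : Continuous (gg σ ε) :=
  continuous_iff_continuousAt.2 fun t => (gg_deriv hε t).continuousAt

lemma C1_gg (hε : 0 < ε) : C1 (gg σ ε) (gg' σ ε) := by
  refine ⟨gg_deriv hε, ?_⟩
  unfold gg'
  have := gg_cont (σ := σ) hε
  exact Continuous.div (by fun_prop) (by fun_prop) fun t => (hh_den hε t).ne'

lemma C1_hh (hσ : 0 < σ) (hε : 0 < ε) : C1 (fun t => σ⁻¹ * hh σ ε t) (gg σ ε) := by
  refine ⟨fun t => ?_, gg_cont hε⟩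
  refine ((hh_deriv hε t).const_mul σ⁻¹).congr_deriv ?_
  field_simp

lemma hh_pos (hε : 0 < ε) (t : ℝ) : 0 < hh σ ε t := div_pos (exp_pos _) (hh_den hε t)
lemma gg_pos (hε : 0 < ε) (t : ℝ) : 0 < gg σ ε t := div_pos (exp_pos _) (pow_pos (hh_den hε t) 2)

lemma gg_le (hε : 0 < ε) (t : ℝ) : gg σ ε t ≤ hh σ ε t := by
  unfold gg hh
  have h := hh_den (σ := σ) hε t
  have : 0 < ε * exp (σ * t) := by positivity
  gcongr
  nlinarith

lemma gg'_le (hσ : 0 < σ) (hε : 0 < ε) (t : ℝ) : gg' σ ε t ≤ σ * gg σ ε t := by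
  unfold gg'
  have h := hh_den (σ := σ) hε t
  have h2 : 0 < ε * exp (σ * t) := by positivity
  have := gg_pos (σ := σ) hε t
  rw [div_le_iff₀ h]
  have : 0 < σ * gg σ ε t := by positivity
  nlinarith

lemma hh_le (hε : 0 < ε) (t : ℝ) : hh σ ε t ≤ ε⁻¹ := by
  unfold hh
  rw [div_le_iff₀ (hh_den hε t)]
  field_simp; linarith

lemma hh_le_exp (hε : 0 < ε) (t : ℝ) : hh σ ε t ≤ exp (σ * t) := by
  unfold hh
  have : 0 < ε * exp (σ * t) := by positivity
  exact div_le_self (exp_pos _).le (by linarith)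

lemma hh_ge (hε : 0 < ε) {t : ℝ} (h : ε * exp (σ * t) ≤ 1) : exp (σ * t) / 2 ≤ hh σ ε t := by
  unfold hh
  have := hh_den (σ := σ) hε t
  gcongr
  linarith
end

/-- logistic -/
noncomputable def lgs (m τ t : ℝ) : ℝ := (1 + exp (-m * (t - τ)))⁻¹

lemma lgs_pos (m τ t : ℝ) : 0 < lgs m τ t := by unfold lgs; positivity
lemma lgs_lt (m τ t : ℝ) : lgs m τ t < 1 := by
  unfold lgs; exact inv_lt_one_of_one_lt₀ (by have := exp_pos (-m * (t - τ)); linarith)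

lemma C1_lgs (m τ : ℝ) : C1 (lgs m τ) (fun t => m * lgs m τ t * (1 - lgs m τ t)) := by
  have h : ∀ t, HasDerivAt (lgs m τ) (m * lgs m τ t * (1 - lgs m τ t)) t := by
    intro t
    have h0 : 1 + exp (-m * (t - τ)) ≠ 0 := by positivity
    have h1 := ((((C1.expc (-m)).shift τ).d t).const_add 1).inv h0
    refine h1.congr_deriv ?_
    unfold lgs
    field_simp; ring
  have hc : Continuous (lgs m τ) := continuous_iff_continuousAt.2 fun t => (h t).continuousAt
  exact ⟨h, by fun_prop⟩

lemma lgs_le_exp (m τ t : ℝ) : lgs m τ t ≤ exp (m * (t - τ)) := by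
  unfold lgs
  rw [show m * (t - τ) = -(-m * (t - τ)) by ring, Real.exp_neg (-m * (t - τ))]
  gcongr
  linarith

lemma lgs_ge {m τ t : ℝ} (hm : 0 ≤ m) (h : τ ≤ t) : 1 / 2 ≤ lgs m τ t := by
  unfold lgs
  rw [one_div]
  have : exp (-m * (t - τ)) ≤ 1 := exp_le_one_iff.2 (by nlinarith)
  gcongr; linarith

lemma lgs_le {m τ t : ℝ} (hm : 0 ≤ m) (h : t ≤ τ + 1) : (1 + exp m)⁻¹ ≤ 1 - lgs m τ t := by
  have h0 : 0 < exp (-m * (t - τ)) := exp_pos _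
  have e : 1 - lgs m τ t = (1 + exp (m * (t - τ)))⁻¹ := by
    unfold lgs
    rw [show m * (t - τ) = -(-m * (t - τ)) by ring, Real.exp_neg (-m * (t - τ))]
    field_simp; ring
  rw [e]
  gcongr
  nlinarith

namespace Dat
variable {N : ℕ} (d : Dat N)

lemma ell_bdd : ∃ B : ℝ, ∀ x : E N, exp (-1) ≤ ‖x‖ → d.ell x ≤ B := by
  obtain ⟨B, hB⟩ := (isCompact_ann (N := N) (-1) (log (max d.R 1))).exists_bound_of_continuousOn
    (d.cont_ell.mono (ann_subset _ _))
  refine ⟨max B (log d.C), fun x hx => ?_⟩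
  rcases le_or_gt ‖x‖ d.R with h | h
  · refine le_max_of_le_left ((le_abs_self _).trans (hB x ⟨hx, ?_⟩))
    rw [Real.exp_log (by positivity)]; exact h.trans (le_max_left _ _)
  · have hr : 0 < ‖x‖ := (exp_pos _).trans_le hx
    refine le_max_of_le_right ?_
    have h1 := log_le_log (d.pos x (norm_pos_iff.1 hr)) (d.decay x h)
    rw [log_mul d.hC.ne' (by positivity), log_rpow hr] at h1
    unfold ell; linarith

end Dat

lemma cut'_zero {a b t : ℝ} (h1 : t ∉ Set.Icc a (a + 1)) (h2 : t ∉ Set.Icc (b - 1) b) : cut' a b t = 0 := by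
  unfold cut'
  rw [T'_supp (t - a) (fun h => h1 ⟨by linarith [h.1], by linarith [h.2]⟩),
    T'_supp (b - t) (fun h => h2 ⟨by linarith [h.2], by linarith [h.1]⟩)]
  ring

lemma int_le_ann2 {N : ℕ} (hN : 2 ≤ N) {F f1 f2 : E N → ℝ} {a b a' b' : ℝ} (hf1 : ContinuousOn f1 {0}ᶜ)
    (hf2 : ContinuousOn f2 {0}ᶜ) (h10 : ∀ x, x ≠ 0 → 0 ≤ f1 x) (h20 : ∀ x, x ≠ 0 → 0 ≤ f2 x)
    (hF : Integrable F (nu N)) (h1 : ∀ x, x ≠ 0 → x ∈ ann N a b → F x ≤ f1 x)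
    (h2 : ∀ x, x ≠ 0 → x ∈ ann N a' b' → F x ≤ f2 x)
    (h0 : ∀ x, x ≠ 0 → x ∉ ann N a b → x ∉ ann N a' b' → F x ≤ 0) :
    ∫ x, F x ∂(nu N) ≤ ∫ x in ann N a b, f1 x ∂(nu N) + ∫ x in ann N a' b', f2 x ∂(nu N) := by
  have i1 := (integrable_indicator_iff (measurableSet_ann (N := N) a b)).2 (integrableOn_ann hf1 a b)
  have i2 := (integrable_indicator_iff (measurableSet_ann (N := N) a' b')).2 (integrableOn_ann hf2 a' b')
  rw [← integral_indicator (measurableSet_ann a b), ← integral_indicator (measurableSet_ann a' b'),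
    ← integral_add i1 i2]
  refine integral_mono_ae hF (i1.add i2) ?_
  filter_upwards [ae_nu_ne_zero hN] with x hx
  show F x ≤ (ann N a b).indicator f1 x + (ann N a' b').indicator f2 x
  have p1 : 0 ≤ (ann N a b).indicator f1 x := Set.indicator_nonneg (fun y hy => h10 y (ne_zero_of_mem_ann hy)) x
  have p2 : 0 ≤ (ann N a' b').indicator f2 x := Set.indicator_nonneg (fun y hy => h20 y (ne_zero_of_mem_ann hy)) x
  by_cases m1 : x ∈ ann N a b
  · have := h1 x hx m1
    rw [Set.indicator_of_mem m1]; linarith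
  · by_cases m2 : x ∈ ann N a' b'
    · have := h2 x hx m2
      rw [Set.indicator_of_mem m2 (f := f2)]; linarith
    · have := h0 x hx m1 m2
      linarith

lemma init_P1 {p lam σ c0 κ Cκ m φ Z h g D k : ℝ} (hp : 1 < p) (hlam : 1 ≤ lam) (hσ : 0 < σ)
    (hκ : lam * κ ≤ (p - 1) / (2 * σ)) (hm0 : 0 < m) (hm : m * (lam * Cκ) ≤ c0 / 2)
    (hCκ : 0 ≤ Cκ)
    (hδ : |1 - k| ≤ κ + Cκ * D) (h0 : 0 < φ) (h1 : φ < 1) (hZ : 0 ≤ Z) (hg : 0 < g) (hgh : g ≤ h) (hD : 0 ≤ D) :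
    m * ((p - 1) / (2 * σ)) * ((1 - φ) * φ * Z * h) - c0 / 2 * (φ * Z * (g * D)) ≤
      (m * φ * (1 - φ)) * Z * ((p - 1) * (σ⁻¹ * h) - lam * (1 - k) * g) := by
  have a1 : lam * (1 - k) * g ≤ (p - 1) / (2 * σ) * h + lam * Cκ * D * g := by
    calc lam * (1 - k) * g ≤ lam * (κ + Cκ * D) * g := by
          gcongr; exact (le_abs_self _).trans hδ
      _ = lam * κ * g + lam * Cκ * D * g := by ring
      _ ≤ (p - 1) / (2 * σ) * h + lam * Cκ * D * g := by
          have : 0 ≤ (p - 1) / (2 * σ) := div_nonneg (by linarith) (by linarith)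
          gcongr
  have e1 : (p - 1) * (σ⁻¹ * h) = 2 * ((p - 1) / (2 * σ) * h) := by field_simp
  have a2 : (p - 1) / (2 * σ) * h - lam * Cκ * D * g ≤ (p - 1) * (σ⁻¹ * h) - lam * (1 - k) * g := by
    rw [e1]; linarith
  have hφ : 0 ≤ m * φ * (1 - φ) * Z := by
    have : 0 ≤ 1 - φ := by linarith
    positivity
  have a3 := mul_le_mul_of_nonneg_left a2 hφ
  have a4 : m * φ * (1 - φ) * Z * (lam * Cκ * D * g) ≤ c0 / 2 * (φ * Z * (g * D)) := by
    calc _ = m * (lam * Cκ) * (φ * Z * (g * D)) * (1 - φ) := by ring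
      _ ≤ m * (lam * Cκ) * (φ * Z * (g * D)) * 1 := by gcongr; linarith
      _ ≤ _ := by rw [mul_one]; gcongr
  calc _ = m * φ * (1 - φ) * Z * ((p - 1) / (2 * σ) * h) - c0 / 2 * (φ * Z * (g * D)) := by ring
    _ ≤ m * φ * (1 - φ) * Z * ((p - 1) / (2 * σ) * h) - m * φ * (1 - φ) * Z * (lam * Cκ * D * g) := by linarith
    _ = m * φ * (1 - φ) * Z * ((p - 1) / (2 * σ) * h - lam * Cκ * D * g) := by ring
    _ ≤ _ := a3

lemma init_P2 {p lam σ c0 κ Cq M φ z z' h g D k q : ℝ} {N : ℕ} (hN : 2 ≤ N) (hp : 1 < p) (hpN : p < N)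
    (hlam : 1 ≤ lam) (hσ : 0 < σ) (hκ0 : 0 < κ) (hκ : N * M * (lam * κ * Cq) ≤ c0 / 2) (hCq : 1 ≤ Cq) (hM : 0 ≤ M)
    (hq : 0 ≤ q) (hk : |k| ≤ q ^ (p - 1)) (hqD : q ^ p ≤ Cq * (1 + D)) (hz0 : 0 ≤ z) (hz1 : z ≤ 1) (hz' : |z'| ≤ M)
    (h0 : 0 < φ) (hg : 0 < g) (hgh : g ≤ h) (hD : 0 ≤ D) :
    - (φ * (N * z ^ (N - 1) * z') * ((p - 1) * (σ⁻¹ * h) - lam * (1 - k) * g)) ≤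
      c0 / 2 * (φ * z ^ N * (g * D)) + (N * M * ((p - 1) * σ⁻¹ + lam + lam * (1 / κ) ^ (p - 1)) + c0 / 2) * (φ * h) := by
  have hy := young_cut hN hp hpN hκ0 hz0 hz1 hq
  have hh0 : 0 < h := hg.trans_le hgh
  have hzN1 : z ^ N ≤ 1 := pow_le_one₀ hz0 hz1
  have hzm : z ^ (N - 1) ≤ 1 := pow_le_one₀ hz0 hz1
  have hc0 : 0 ≤ c0 / 2 := le_trans (by positivity) hκ
  have a1 : |(p - 1) * (σ⁻¹ * h) - lam * (1 - k) * g| ≤ (p - 1) * (σ⁻¹ * h) + lam * (1 + q ^ (p - 1)) * g := by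
    have : |1 - k| ≤ 1 + q ^ (p - 1) := by
      calc _ ≤ |(1:ℝ)| + |k| := abs_sub _ _
        _ ≤ _ := by rw [abs_one]; gcongr
    have hp' : 0 ≤ (p - 1) * (σ⁻¹ * h) := mul_nonneg (by linarith) (by positivity)
    calc _ ≤ |(p - 1) * (σ⁻¹ * h)| + |lam * (1 - k) * g| := abs_sub _ _
      _ = (p - 1) * (σ⁻¹ * h) + lam * |1 - k| * g := by
        rw [abs_of_nonneg hp', abs_mul, abs_mul, abs_of_pos hg, abs_of_pos (show 0 < lam by linarith)]
      _ ≤ _ := by gcongr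
  have a2 : z ^ (N - 1) * ((p - 1) * (σ⁻¹ * h) + lam * (1 + q ^ (p - 1)) * g) ≤
     (p - 1) * (σ⁻¹ * h) + lam * h + lam * (1 / κ) ^ (p - 1) * h + lam * κ * Cq * (z ^ N * g * (1 + D)) := by
    have hp' : 0 ≤ (p - 1) * (σ⁻¹ * h) := mul_nonneg (by linarith) (by positivity)
    have b1 : z ^ (N - 1) * q ^ (p - 1) ≤ κ * (z ^ N * (Cq * (1 + D))) + (1 / κ) ^ (p - 1) := hy.trans (by gcongr)
    calc _ = z ^ (N - 1) * ((p - 1) * (σ⁻¹ * h)) + z ^ (N - 1) * (lam * g) + lam * g * (z ^ (N - 1) * q ^ (p - 1)) := by ring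
      _ ≤ 1 * ((p - 1) * (σ⁻¹ * h)) + 1 * (lam * h) + lam * g * (κ * (z ^ N * (Cq * (1 + D))) + (1 / κ) ^ (p - 1)) := by
        gcongr
      _ = (p - 1) * (σ⁻¹ * h) + lam * h + lam * (1 / κ) ^ (p - 1) * g + lam * κ * Cq * (z ^ N * g * (1 + D)) := by ring
      _ ≤ _ := by gcongr
  calc _ ≤ |φ * (N * z ^ (N - 1) * z') * ((p - 1) * (σ⁻¹ * h) - lam * (1 - k) * g)| := neg_le_abs _
    _ = φ * (N * |z'|) * (z ^ (N - 1) * |(p - 1) * (σ⁻¹ * h) - lam * (1 - k) * g|) := by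
      rw [abs_mul, abs_mul, abs_mul, abs_mul, abs_of_pos h0, Nat.abs_cast, abs_of_nonneg (pow_nonneg hz0 _)]; ring
    _ ≤ φ * (N * M) * (z ^ (N - 1) * ((p - 1) * (σ⁻¹ * h) + lam * (1 + q ^ (p - 1)) * g)) := by gcongr
    _ ≤ φ * (N * M) * ((p - 1) * (σ⁻¹ * h) + lam * h + lam * (1 / κ) ^ (p - 1) * h + lam * κ * Cq * (z ^ N * g * (1 + D))) := by
      gcongr
    _ = N * M * ((p - 1) * σ⁻¹ + lam + lam * (1 / κ) ^ (p - 1)) * (φ * h) + N * M * (lam * κ * Cq) * (φ * (z ^ N * g * (1 + D))) := by ring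
    _ ≤ N * M * ((p - 1) * σ⁻¹ + lam + lam * (1 / κ) ^ (p - 1)) * (φ * h) + c0 / 2 * (φ * (z ^ N * g * (1 + D))) := by
      gcongr
    _ = N * M * ((p - 1) * σ⁻¹ + lam + lam * (1 / κ) ^ (p - 1)) * (φ * h) + c0 / 2 * (φ * (z ^ N * g)) + c0 / 2 * (φ * z ^ N * (g * D)) := by ring
    _ ≤ N * M * ((p - 1) * σ⁻¹ + lam + lam * (1 / κ) ^ (p - 1)) * (φ * h) + c0 / 2 * (φ * (1 * h)) + c0 / 2 * (φ * z ^ N * (g * D)) := by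
      gcongr
    _ = _ := by ring

namespace Dat
variable {N : ℕ} (d : Dat N)

set_option maxHeartbeats 1000000 in
lemma init_bd {σ : ℝ} (hσ : 0 < σ) (hσl : d.lam * σ ≤ (d.p - 1) / 2) : Bd (fun x => exp (σ * d.ell x)) := by
  have hp := d.hp1
  have hlam := d.hlam
  have hμ := d.hμ
  have hN := d.hN
  have hNp : (0:ℝ) < N := by exact_mod_cast (show 0 < N by omega)
  obtain ⟨B, hB⟩ := d.ell_bdd
  set c0 := d.μ * (d.p - 1) / 2 with hc0
  have hc0p : 0 < c0 := by have : 0 < d.p - 1 := by linarith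
                           positivity
  obtain ⟨M, hM, hM'⟩ := cut'_bdd
  set A1 := (d.p - 1) / (2 * σ) with hA1
  have hA1p : 0 < A1 := div_pos (by linarith) (by linarith)
  set κ := A1 / d.lam with hκ
  have hκp : 0 < κ := div_pos hA1p (by linarith)
  have hκl : d.lam * κ ≤ A1 := by rw [hκ, mul_div_cancel₀ _ (by linarith)]
  obtain ⟨Cκ, hCκ, hδ⟩ := delta_small hp hκp
  set m := c0 / (2 * (d.lam * Cκ + 1)) with hm
  have hlC : 0 ≤ d.lam * Cκ := by positivity
  have hmp : 0 < m := by positivity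
  have hml : m * (d.lam * Cκ) ≤ c0 / 2 := by
    rw [hm, div_mul_eq_mul_div, div_le_div_iff₀ (by positivity) (by positivity)]; nlinarith
  obtain ⟨Cq, hCq, hqD⟩ := qp_bound hp
  set κ' := c0 / (2 * (N * M * (d.lam * Cq) + 1)) with hκ'
  have hNC : 0 ≤ N * M * (d.lam * Cq) := by positivity
  have hκ'p : 0 < κ' := by positivity
  have hκ'l : N * M * (d.lam * κ' * Cq) ≤ c0 / 2 := by
    rw [show N * M * (d.lam * κ' * Cq) = κ' * (N * M * (d.lam * Cq)) by ring, hκ', div_mul_eq_mul_div,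
      div_le_div_iff₀ (by positivity) (by positivity)]; nlinarith
  set C2 := (N * M * ((d.p - 1) * σ⁻¹ + d.lam + d.lam * (1 / κ') ^ (d.p - 1)) + c0 / 2) with hC2
  have hC2p : 0 ≤ C2 := by have : 0 < d.p - 1 := by linarith
                           positivity
  set J := ∫ x in ann N 0 1, exp (σ * d.ell x) ∂(nu N) with hJ
  have hJ0 : 0 ≤ J := ann_int_nonneg (fun x _ => (exp_pos _).le) _ _
  set c1 := m * A1 * ((1 + exp m)⁻¹ * (1 / 2)) with hc1
  have hc1p : 0 < c1 := by positivity
  have hV := V1_nonneg N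
  refine ⟨max (2 * (C2 * (V1 N + J) / c1)) (exp (σ * B) * V1 N), le_max_of_le_right (by positivity), fun τ => ?_⟩
  rcases le_total (-1) τ with hτ | hτ
  · refine le_max_of_le_right ?_
    have : ∫ x in ann N τ (τ + 1), exp (σ * d.ell x) ∂(nu N) ≤ ∫ x in ann N τ (τ + 1), exp (σ * B) ∂(nu N) := by
      refine setIntegral_mono_on (integrableOn_ann (d.cont_exp σ) _ _) (integrableOn_ann continuousOn_const _ _)
        (measurableSet_ann _ _) fun x hx => ?_
      have := hB x ((exp_le_exp.2 hτ).trans hx.1)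
      gcongr
    refine this.trans (le_of_eq ?_)
    rw [setIntegral_const, nu_unit, smul_eq_mul, mul_comm]
  refine le_max_of_le_left ?_
  -- choose ε
  obtain ⟨B', hB'⟩ := (isCompact_ann (N := N) τ (τ + 1)).exists_bound_of_continuousOn
    (d.cont_ell.mono (ann_subset _ _))
  set ε := exp (- (σ * B')) with hε
  have hεp : 0 < ε := exp_pos _
  -- choose K
  obtain ⟨K, hK1, hK2⟩ : ∃ K : ℝ, 1 - τ ≤ K ∧ m * (-K + 1 - τ) ≤ - (σ * B') := by
    refine ⟨max (1 - τ) (1 - τ + σ * B' / m), le_max_left _ _, ?_⟩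
    have h1 := le_max_right (1 - τ) (1 - τ + σ * B' / m)
    have h2 := mul_le_mul_of_nonneg_left h1 hmp.le
    have h3 : m * (1 - τ + σ * B' / m) = m * (1 - τ) + σ * B' := by field_simp
    linarith
  set φ := lgs m τ with hφ
  set ζ := cut (-K) 1 with hζ
  set ζ' := cut' (-K) 1 with hζ'
  have hζ1 : C1 ζ ζ' := cut_C1 _ _
  have hζs : Supp (fun t => ζ t ^ N) (-K) 1 := fun t ht => by
    simp only [hζ, cut_supp _ _ t ht]; exact zero_pow (by omega)
  have hη := (C1_lgs m τ).mul (hζ1.pow N)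
  have hηs : Supp (fun t => φ t * ζ t ^ N) (-K) 1 := fun t ht => by
    have := hζs t ht
    simp only at this
    simp only [this, mul_zero]
  have hη0 : ∀ t, 0 ≤ φ t * ζ t ^ N := fun t => mul_nonneg (lgs_pos _ _ _).le (pow_nonneg (cut_nonneg _ _ _) _)
  have key := d.III_low hη hηs (C1_hh hσ hεp) (C1_gg hεp) hη0 (fun t => (gg_pos hεp t).le) (gg'_le hσ hεp) hσl
  have iX := d.intX hη.c (hηs.deriv hη) (C1_hh hσ hεp).cont (C1_gg (σ := σ) hεp).cont
  have chh : Continuous (hh σ ε) := continuous_iff_continuousAt.2 fun t => (hh_deriv hεp t).continuousAt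
  have n4 := d.cont_G (C1_gg (σ := σ) hεp).cont
  have n3 := d.cont_G chh
  have iD : Integrable (fun x => φ (log ‖x‖) * ζ (log ‖x‖) ^ N * (gg σ ε (d.ell x) * d.D x)) (nu N) :=
    intg d.hN hη.cont hηs (n4.mul d.cont_D)
  have hφc : Continuous φ := (C1_lgs m τ).cont
  have iH : Integrable (fun x => ((1 - φ (log ‖x‖)) * φ (log ‖x‖) * ζ (log ‖x‖) ^ N) * hh σ ε (d.ell x)) (nu N) := by
    refine intg d.hN (φ := fun t => (1 - φ t) * φ t * ζ t ^ N) (a := -K) (b := 1) ?_ ?_ n3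
    · have := hζ1.cont; fun_prop
    · intro t ht
      have := hζs t ht
      simp only at this
      simp only [this, mul_zero]
  have P1 : ∀ x : E N, x ≠ 0 → _ := fun x hx => init_P1 (φ := φ (log ‖x‖)) (Z := ζ (log ‖x‖) ^ N) hp hlam hσ hκl hmp hml hCκ
    (hδ (d.q x) (d.s x) (d.abs_s_le hx)) (lgs_pos _ _ _) (lgs_lt _ _ _) (pow_nonneg (cut_nonneg _ _ _) _)
    (gg_pos (σ := σ) hεp (d.ell x)) (gg_le hεp _) (d.D_nonneg hx)
  have P2 : ∀ x : E N, x ≠ 0 → _ := fun x hx => init_P2 (φ := φ (log ‖x‖)) (z := ζ (log ‖x‖)) (z' := ζ' (log ‖x‖)) hN hp d.hpN hlam hσ hκ'p hκ'l hCq hM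
    (d.q_nonneg hx) (d.abs_k_le hx) (hqD (d.q x) (d.s x) (d.abs_s_le hx)) (cut_nonneg _ _ _) (cut_le_one _ _ _)
    (hM' _ _ _) (lgs_pos _ _ _)
    (gg_pos (σ := σ) hεp (d.ell x)) (gg_le hεp _) (d.D_nonneg hx)
  simp only [show ∀ x, kk d.p (d.q x) (d.s x) = d.k x from fun _ => rfl,
    show ∀ x, DD d.p (d.q x) (d.s x) = d.D x from fun _ => rfl] at P1 P2
  have main := int_le_ann2 d.hN (a := -K) (b := -K + 1) (a' := 0) (b' := 1)
    (F := fun x => m * A1 * (((1 - φ (log ‖x‖)) * φ (log ‖x‖) * ζ (log ‖x‖) ^ N) * hh σ ε (d.ell x))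
      - c0 * (φ (log ‖x‖) * ζ (log ‖x‖) ^ N * (gg σ ε (d.ell x) * d.D x))
      - (m * φ (log ‖x‖) * (1 - φ (log ‖x‖)) * ζ (log ‖x‖) ^ N + φ (log ‖x‖) * (N * ζ (log ‖x‖) ^ (N - 1) * ζ' (log ‖x‖)))
        * ((d.p - 1) * (σ⁻¹ * hh σ ε (d.ell x)) - d.lam * (1 - d.k x) * gg σ ε (d.ell x)))
    (f1 := fun x => C2) (f2 := fun x => C2 * exp (σ * d.ell x)) continuousOn_const
    (continuousOn_const.mul (d.cont_exp σ)) (fun _ _ => hC2p) (fun x _ => by positivity)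
    (((iH.const_mul _).sub (iD.const_mul _)).sub iX) ?_ ?_ ?_
  · have e0 := integral_sub ((iH.const_mul (m * A1)).sub (iD.const_mul c0)) iX
    have e1 := integral_sub (iH.const_mul (m * A1)) (iD.const_mul c0)
    rw [integral_const_mul, integral_const_mul] at e1
    simp only [Pi.sub_apply] at e0
    rw [e1] at e0
    rw [e0] at main
    have e2 : ∫ x in ann N (-K) (-K + 1), C2 ∂(nu N) = C2 * V1 N := by
      rw [setIntegral_const, nu_unit, smul_eq_mul, mul_comm]
    rw [e2, integral_const_mul, ← hJ] at main
    have e3 : m * A1 * ∫ x, ((1 - φ (log ‖x‖)) * φ (log ‖x‖) * ζ (log ‖x‖) ^ N) * hh σ ε (d.ell x) ∂(nu N) ≤ C2 * (V1 N + J) := by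
      rw [← hc0] at key
      simp only [← hφ] at key main
      linarith only [key, main]
    have e4 : ∫ x in ann N τ (τ + 1), ((1 + exp m)⁻¹ * (1 / 2)) * (exp (σ * d.ell x) / 2) ∂(nu N) ≤
        ∫ x, ((1 - φ (log ‖x‖)) * φ (log ‖x‖) * ζ (log ‖x‖) ^ N) * hh σ ε (d.ell x) ∂(nu N) := by
      refine ann_le_int d.hN (continuousOn_const.mul ((d.cont_exp σ).div_const 2)) iH ?_ ?_
      · intro x hx hxa
        have hb := hB' x hxa
        have ha := (mem_ann_iff hx).1 hxa
        have f1 : ζ (log ‖x‖) = 1 := cut_one (by linarith [ha.1]) (by linarith [ha.2])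
        rw [f1, one_pow, mul_one]
        have f2 : exp (σ * d.ell x) / 2 ≤ hh σ ε (d.ell x) := by
          refine hh_ge hεp ?_
          rw [hε, ← Real.exp_add, exp_le_one_iff]
          have : d.ell x ≤ B' := (le_abs_self _).trans hb
          have := mul_le_mul_of_nonneg_left this hσ.le
          linarith only [this]
        have f3 := lgs_le (m := m) hmp.le ha.2
        have f4 := lgs_ge (m := m) hmp.le ha.1
        have f5 := lgs_lt m τ (log ‖x‖)
        have f6 : 0 ≤ 1 - lgs m τ (log ‖x‖) := by linarith
        exact mul_le_mul (mul_le_mul f3 f4 (by norm_num) f6) f2 (by positivity) (mul_nonneg f6 (by linarith))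
      · intro x hx _
        have f5 := lgs_lt m τ (log ‖x‖)
        have f6 : 0 ≤ 1 - φ (log ‖x‖) := by linarith
        have f7 := (lgs_pos m τ (log ‖x‖)).le
        have f8 := (hh_pos (σ := σ) hεp (d.ell x)).le
        exact mul_nonneg (mul_nonneg (mul_nonneg f6 f7) (pow_nonneg (cut_nonneg _ _ _) _)) f8
    rw [integral_const_mul, integral_div] at e4
    have e5 := mul_le_mul_of_nonneg_left e4 (show 0 ≤ m * A1 by positivity)
    have e6 : c1 * ((∫ x in ann N τ (τ + 1), exp (σ * d.ell x) ∂(nu N)) / 2) ≤ C2 * (V1 N + J) := by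
      rw [hc1]; linarith
    have e7 := (le_div_iff₀' hc1p).2 e6
    linarith
  · intro x hx hxa
    have p1 := P1 x hx
    have p2 := P2 x hx
    have ha := (mem_ann_iff hx).1 hxa
    have f1 : φ (log ‖x‖) ≤ ε := by
      refine (lgs_le_exp _ _ _).trans ?_
      rw [hε]; refine exp_le_exp.2 (le_trans ?_ hK2)
      exact mul_le_mul_of_nonneg_left (by linarith [ha.2]) hmp.le
    have f2 : φ (log ‖x‖) * hh σ ε (d.ell x) ≤ 1 := by
      calc _ ≤ ε * ε⁻¹ := mul_le_mul f1 (hh_le hεp _) (hh_pos hεp _).le hεp.le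
        _ = 1 := mul_inv_cancel₀ hεp.ne'
    have f3 : C2 * (φ (log ‖x‖) * hh σ ε (d.ell x)) ≤ C2 * 1 := mul_le_mul_of_nonneg_left f2 hC2p
    rw [← hC2] at p2
    linarith
  · intro x hx hxa
    have p1 := P1 x hx
    have p2 := P2 x hx
    have f2 : φ (log ‖x‖) * hh σ ε (d.ell x) ≤ exp (σ * d.ell x) := by
      calc _ ≤ 1 * exp (σ * d.ell x) := mul_le_mul (lgs_lt _ _ _).le (hh_le_exp hεp _) (hh_pos hεp _).le zero_le_one
        _ = _ := one_mul _
    have f3 : C2 * (φ (log ‖x‖) * hh σ ε (d.ell x)) ≤ C2 * exp (σ * d.ell x) := mul_le_mul_of_nonneg_left f2 hC2p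
    rw [← hC2] at p2
    linarith
  · intro x hx h1 h2
    have p1 := P1 x hx
    rw [mem_ann_iff hx] at h1 h2
    have hz : ζ' (log ‖x‖) = 0 := cut'_zero h1 (by simpa using h2)
    have f1 : 0 ≤ c0 / 2 * (φ (log ‖x‖) * ζ (log ‖x‖) ^ N * (gg σ ε (d.ell x) * d.D x)) := by
      refine mul_nonneg (by positivity) (mul_nonneg (hη0 _) (mul_nonneg (gg_pos hεp _).le (d.D_nonneg hx)))
    rw [hz]
    simp only [mul_zero, add_zero]
    linarith

end Dat
end RS

namespace RS

noncomputable def win {N : ℕ} (f : E N → ℝ) (τ : ℝ) : ℝ := ∫ x, T' (log ‖x‖ - τ) * f x ∂(nu N)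

lemma T'_supp_shift (τ : ℝ) : Supp (fun t => T' (t - τ)) τ (τ + 1) := fun t ht =>
  T'_supp _ fun h => ht ⟨by linarith [h.1], by linarith [h.2]⟩

lemma T'_cont_shift (τ : ℝ) : Continuous (fun t => T' (t - τ)) := C1_T.c.comp (by fun_prop)

lemma win_int {N : ℕ} (hN : 2 ≤ N) {f : E N → ℝ} (hf : ContinuousOn f {0}ᶜ) (τ : ℝ) :
    Integrable (fun x => T' (log ‖x‖ - τ) * f x) (nu N) :=
  intg hN (φ := fun t => T' (t - τ)) (T'_cont_shift τ) (T'_supp_shift τ) hf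

lemma win_abs_le {N : ℕ} (hN : 2 ≤ N) : ∃ M : ℝ, 0 ≤ M ∧ ∀ f g : E N → ℝ, ContinuousOn f {0}ᶜ → ContinuousOn g {0}ᶜ →
    (∀ x, x ≠ 0 → |f x| ≤ g x) → ∀ τ, |win f τ| ≤ M * ∫ x in ann N τ (τ + 1), g x ∂(nu N) := by
  obtain ⟨M, hM, hM'⟩ := T'_bdd
  refine ⟨M, hM, fun f g hf hg h τ => ?_⟩
  unfold win
  refine abs_integral_le_integral_abs.trans ?_
  rw [← integral_const_mul]
  refine int_le_ann hN (continuousOn_const.mul hg) (win_int hN hf τ).abs ?_ ?_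
  · intro x hx _
    rw [abs_mul, abs_of_nonneg (T'_nonneg _)]
    exact mul_le_mul (hM' _) (h x hx) (abs_nonneg _) hM
  · intro x hx hxa
    have : T' (log ‖x‖ - τ) = 0 := zero_off_ann (T'_supp_shift τ) hx hxa
    rw [this, zero_mul, abs_zero]

/-- plateau -/
noncomputable def pl (τ₀ τ₁ t : ℝ) : ℝ := smoothTransition (t - τ₀) - smoothTransition (t - τ₁)

lemma pl_C1 (τ₀ τ₁ : ℝ) : C1 (pl τ₀ τ₁) (fun t => T' (t - τ₀) - T' (t - τ₁)) :=
  ⟨fun t => ((C1_T.shift τ₀).d t).sub ((C1_T.shift τ₁).d t), (T'_cont_shift τ₀).sub (T'_cont_shift τ₁)⟩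

lemma pl_nonneg {τ₀ τ₁ : ℝ} (h : τ₀ ≤ τ₁) (t : ℝ) : 0 ≤ pl τ₀ τ₁ t :=
  sub_nonneg.2 (smoothTransition.monotone (by linarith))

lemma pl_supp {τ₀ τ₁ : ℝ} (h : τ₀ ≤ τ₁) : Supp (pl τ₀ τ₁) τ₀ (τ₁ + 1) := by
  intro t ht
  rw [Set.mem_Icc, not_and_or, not_le, not_le] at ht
  unfold pl
  rcases ht with h' | h'
  · rw [smoothTransition.zero_of_nonpos (by linarith), smoothTransition.zero_of_nonpos (by linarith), sub_zero]
  · rw [smoothTransition.one_of_one_le (by linarith), smoothTransition.one_of_one_le (by linarith), sub_self]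

lemma pl_one {τ₀ τ₁ t : ℝ} (h0 : τ₀ + 1 ≤ t) (h1 : t ≤ τ₁) : pl τ₀ τ₁ t = 1 := by
  unfold pl
  rw [smoothTransition.one_of_one_le (by linarith), smoothTransition.zero_of_nonpos (by linarith), sub_zero]

lemma small_of {l : Filter ℝ} {F En : ℝ → ℝ} {A : ℝ} (hA : 0 ≤ A)
    (h : ∀ κ : ℝ, 0 < κ → ∃ C : ℝ, 0 ≤ C ∧ ∀ τ, |F τ| ≤ κ * A + C * En τ) (hE : Tendsto En l (nhds 0)) :
    Tendsto F l (nhds 0) := by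
  rw [Metric.tendsto_nhds]
  intro ε hε
  obtain ⟨C, hC, h⟩ := h (ε / (2 * (A + 1))) (by positivity)
  have h2 : Tendsto (fun τ => C * En τ) l (nhds 0) := by simpa using hE.const_mul C
  filter_upwards [h2.eventually_lt_const (show 0 < ε / 2 by linarith)] with τ hτ
  rw [Real.dist_eq, sub_zero]
  have h3 : ε / (2 * (A + 1)) * A ≤ ε / 2 := by
    rw [div_mul_eq_mul_div, div_le_div_iff₀ (by positivity) (by positivity)]; nlinarith
  linarith [h τ]

namespace Dat
variable {N : ℕ} (d : Dat N)

/-- everything bounded -/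
structure AllBd (σ : ℝ) : Prop where
  pos : 0 < σ
  small : d.lam * σ ≤ (d.p - 1) / 2
  e : ∀ s, 0 ≤ s → Bd (fun x => exp (s * d.ell x))

variable {d}

lemma AllBd.q {σ : ℝ} (h : d.AllBd σ) {s : ℝ} (hs : 0 ≤ s) : Bd (fun x => exp (s * d.ell x) * d.q x ^ d.p) := by
  have hp := d.hp1
  by_cases hs1 : s = d.p - 1
  · have b1 := d.cacc_bd (s₀ := 0) (by linarith) (h.e 0 le_rfl)
    have b2 := d.cacc_bd (s₀ := d.p) (by linarith) (h.e d.p (by linarith))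
    have c1 := (d.cont_exp 0).mul d.cont_qp
    have c2 := (d.cont_exp d.p).mul d.cont_qp
    refine (b1.add b2 c1 c2).mono ((d.cont_exp s).mul d.cont_qp) (c1.add c2) fun x hx => ?_
    have := d.qp_nonneg hx
    rw [← add_mul]
    gcongr
    rcases le_total (d.ell x) 0 with hl | hl
    · have : exp (s * d.ell x) ≤ exp (0 * d.ell x) := exp_le_exp.2 (by nlinarith)
      linarith [exp_pos (d.p * d.ell x)]
    · have : exp (s * d.ell x) ≤ exp (d.p * d.ell x) := exp_le_exp.2 (by nlinarith)
      linarith [exp_pos (0 * d.ell x)]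
  · exact d.cacc_bd hs1 (h.e s hs)

variable (d)

lemma abs_delta_le {x : E N} (hx : x ≠ 0) : |1 - d.k x| ≤ 2 + d.q x ^ d.p := by
  have h0 := d.q_nonneg hx
  have h1 : d.q x ^ (d.p - 1) ≤ 1 + d.q x ^ d.p := by
    rcases le_total (d.q x) 1 with h | h
    · have := Real.rpow_le_one h0 h (show 0 ≤ d.p - 1 by linarith [d.hp1])
      linarith [d.qp_nonneg hx]
    · have := Real.rpow_le_rpow_of_exponent_le h (show d.p - 1 ≤ d.p by linarith)
      linarith
  calc _ ≤ |(1:ℝ)| + |d.k x| := abs_sub _ _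
    _ ≤ 1 + d.q x ^ (d.p - 1) := by rw [abs_one]; gcongr; exact d.abs_k_le hx
    _ ≤ _ := by linarith

/-- window masses -/
noncomputable def wA (s τ : ℝ) : ℝ := win (fun x => exp (s * d.ell x)) τ
noncomputable def wD (s τ : ℝ) : ℝ := win (fun x => (1 - d.k x) * exp (s * d.ell x)) τ

lemma cont_del_exp (s : ℝ) : ContinuousOn (fun x => (1 - d.k x) * exp (s * d.ell x)) {0}ᶜ :=
  d.cont_delta.mul (d.cont_exp s)

lemma win_split (c s τ₀ τ₁ : ℝ) : ∫ x, (T' (log ‖x‖ - τ₀) - T' (log ‖x‖ - τ₁)) * 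
    (c * exp (s * d.ell x) - d.lam * (1 - d.k x) * exp (s * d.ell x)) ∂(nu N) =
    c * (d.wA s τ₀ - d.wA s τ₁) - d.lam * (d.wD s τ₀ - d.wD s τ₁) := by
  have i1 := win_int d.hN (d.cont_exp s) τ₀
  have i2 := win_int d.hN (d.cont_exp s) τ₁
  have i3 := win_int d.hN (d.cont_del_exp s) τ₀
  have i4 := win_int d.hN (d.cont_del_exp s) τ₁
  unfold wA wD win
  have e := integral_sub ((i1.sub i2).const_mul c) ((i3.sub i4).const_mul d.lam)
  simp only [Pi.sub_apply] at e
  rw [← integral_sub i1 i2, ← integral_sub i3 i4, ← integral_const_mul, ← integral_const_mul, ← e]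
  congr 1; ext x; ring

lemma low_win {σ : ℝ} (h : d.AllBd σ) {τ₀ τ₁ : ℝ} (hτ : τ₀ ≤ τ₁) :
    (d.p - 1) * σ⁻¹ * (d.wA σ τ₀ - d.wA σ τ₁) - d.lam * (d.wD σ τ₀ - d.wD σ τ₁) ≤
      - (d.μ * (d.p - 1) / 2 * ∫ x in ann N (τ₀ + 1) τ₁, exp (σ * d.ell x) * d.D x ∂(nu N)) := by
  have hσ := h.pos
  have hg := C1.expc σ
  have hH : C1 (fun t => σ⁻¹ * exp (σ * t)) (fun t => exp (σ * t)) :=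
    (hg.const_mul σ⁻¹).congr' fun t => by field_simp
  have key := d.III_low (pl_C1 τ₀ τ₁) (pl_supp hτ) hH hg (pl_nonneg hτ) (fun t => (exp_pos _).le)
    (fun t => le_rfl) h.small
  have e := d.win_split ((d.p - 1) * σ⁻¹) σ τ₀ τ₁
  rw [← e]
  have hp := d.hp1
  have hμ := d.hμ
  have e2 : ∫ x in ann N (τ₀ + 1) τ₁, exp (σ * d.ell x) * d.D x ∂(nu N) ≤
      ∫ x, pl τ₀ τ₁ (log ‖x‖) * (exp (σ * d.ell x) * d.D x) ∂(nu N) := by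
    have c := (d.cont_exp σ).mul d.cont_D
    refine ann_le_int d.hN c (intg d.hN (pl_C1 _ _).cont (pl_supp hτ) c) ?_ ?_
    · intro x hx hxa
      have ha := (mem_ann_iff hx).1 hxa
      rw [pl_one ha.1 ha.2, one_mul]
    · intro x hx _
      exact mul_nonneg (pl_nonneg hτ _) (mul_nonneg (exp_pos _).le (d.D_nonneg hx))
  have hc : 0 ≤ d.μ * (d.p - 1) / 2 := by
    have : 0 ≤ d.p - 1 := by linarith
    positivity
  have e3 := mul_le_mul_of_nonneg_left e2 hc
  refine le_trans (le_of_eq ?_) (key.trans (neg_le_neg e3))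
  congr 1; ext x; ring

lemma up_win {τ₀ τ₁ : ℝ} (hτ : τ₀ ≤ τ₁) :
    d.μ * ∫ x in ann N (τ₀ + 1) τ₁, exp (d.p * d.ell x) * d.D x ∂(nu N) ≤
    (d.p - 1) * d.p⁻¹ * (d.wA d.p τ₀ - d.wA d.p τ₁) - d.lam * (d.wD d.p τ₀ - d.wD d.p τ₁) := by
  have key := d.III_up (pl_C1 τ₀ τ₁) (pl_supp hτ) (pl_nonneg hτ)
  have e := d.win_split ((d.p - 1) * d.p⁻¹) d.p τ₀ τ₁
  rw [← e]
  have hμ := d.hμ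
  have e2 : ∫ x in ann N (τ₀ + 1) τ₁, exp (d.p * d.ell x) * d.D x ∂(nu N) ≤
      ∫ x, pl τ₀ τ₁ (log ‖x‖) * (exp (d.p * d.ell x) * d.D x) ∂(nu N) := by
    have c := (d.cont_exp d.p).mul d.cont_D
    refine ann_le_int d.hN c (intg d.hN (pl_C1 _ _).cont (pl_supp hτ) c) ?_ ?_
    · intro x hx hxa
      have ha := (mem_ann_iff hx).1 hxa
      rw [pl_one ha.1 ha.2, one_mul]
    · intro x hx _
      exact mul_nonneg (pl_nonneg hτ _) (mul_nonneg (exp_pos _).le (d.D_nonneg hx))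
  have e3 := mul_le_mul_of_nonneg_left e2 hμ.le
  refine e3.trans (key.trans (le_of_eq ?_))
  congr 1; ext x; ring

lemma wA_bdd {σ : ℝ} (h : d.AllBd σ) {s : ℝ} (hs : 0 ≤ s) : ∃ C : ℝ, 0 ≤ C ∧ ∀ τ, |d.wA s τ| ≤ C := by
  obtain ⟨M, hM, hw⟩ := win_abs_le d.hN
  obtain ⟨C, hC, hC'⟩ := h.e s hs
  refine ⟨M * C, by positivity, fun τ => ?_⟩
  exact (hw _ _ (d.cont_exp s) (d.cont_exp s) (fun x _ => by rw [abs_of_pos (exp_pos _)]) τ).trans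
    (mul_le_mul_of_nonneg_left (hC' τ) hM)

lemma wD_bdd {σ : ℝ} (h : d.AllBd σ) {s : ℝ} (hs : 0 ≤ s) : ∃ C : ℝ, 0 ≤ C ∧ ∀ τ, |d.wD s τ| ≤ C := by
  obtain ⟨M, hM, hw⟩ := win_abs_le d.hN
  have c1 : ContinuousOn (fun x => 2 * exp (s * d.ell x)) {0}ᶜ := continuousOn_const.mul (d.cont_exp s)
  have c2 : ContinuousOn (fun x => exp (s * d.ell x) * d.q x ^ d.p) {0}ᶜ := (d.cont_exp s).mul d.cont_qp
  obtain ⟨C, hC, hC'⟩ := ((h.e s hs).const_mul zero_le_two).add (h.q hs) c1 c2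
  refine ⟨M * C, by positivity, fun τ => ?_⟩
  refine (hw _ _ (d.cont_del_exp s) (c1.fun_add c2) (fun x hx => ?_) τ).trans
    (mul_le_mul_of_nonneg_left (hC' τ) hM)
  rw [abs_mul, abs_of_pos (exp_pos _)]
  have := mul_le_mul_of_nonneg_right (d.abs_delta_le hx) (exp_pos (s * d.ell x)).le
  linarith

/-- the energy density is integrable -/
lemma energy_int {σ : ℝ} (h : d.AllBd σ) {s : ℝ} (hs : s = σ ∨ s = d.p) :
    Integrable (fun x => exp (s * d.ell x) * d.D x) (nu N) := by
  have hp := d.hp1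
  have hμ := d.hμ
  have hσ := h.pos
  have hlam := d.hlam
  have hs0 : 0 < s := by rcases hs with rfl | rfl <;> linarith
  obtain ⟨CA, hCA, hA⟩ := d.wA_bdd h hs0.le
  obtain ⟨CD, hCD, hD⟩ := d.wD_bdd h hs0.le
  have c := (d.cont_exp s).mul d.cont_D
  have bd : ∃ C : ℝ, ∀ τ₀ τ₁ : ℝ, τ₀ ≤ τ₁ → ∫ x in ann N (τ₀ + 1) τ₁, exp (s * d.ell x) * d.D x ∂(nu N) ≤ C := by
    have hb : ∀ τ₀ τ₁ : ℝ, |(d.p - 1) * s⁻¹ * (d.wA s τ₀ - d.wA s τ₁) - d.lam * (d.wD s τ₀ - d.wD s τ₁)| ≤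
        (d.p - 1) * s⁻¹ * (CA + CA) + d.lam * (CD + CD) := by
      intro τ₀ τ₁
      have hp' : 0 ≤ (d.p - 1) * s⁻¹ := mul_nonneg (by linarith) (by positivity)
      refine (abs_sub _ _).trans ?_
      rw [abs_mul ((d.p - 1) * s⁻¹), abs_mul d.lam, abs_of_nonneg hp', abs_of_nonneg (show 0 ≤ d.lam by linarith)]
      gcongr
      · exact (abs_sub _ _).trans (add_le_add (hA _) (hA _))
      · exact (abs_sub _ _).trans (add_le_add (hD _) (hD _))
    rcases hs with rfl | rfl
    · refine ⟨((d.p - 1) * s⁻¹ * (CA + CA) + d.lam * (CD + CD)) / (d.μ * (d.p - 1) / 2), fun τ₀ τ₁ hτ => ?_⟩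
      have : 0 < d.p - 1 := by linarith
      rw [le_div_iff₀' (by positivity)]
      have h1 := d.low_win h hτ
      have h2 := neg_le_of_abs_le (hb τ₀ τ₁)
      linarith
    · refine ⟨((d.p - 1) * d.p⁻¹ * (CA + CA) + d.lam * (CD + CD)) / d.μ, fun τ₀ τ₁ hτ => ?_⟩
      rw [le_div_iff₀' hμ]
      exact (d.up_win hτ).trans (le_of_abs_le (hb τ₀ τ₁))
  obtain ⟨C, hC⟩ := bd
  have cov : AECover (nu N) atTop (fun n : ℕ => ann N (-(n:ℝ)) n) := by
    refine ⟨?_, fun n => measurableSet_ann _ _⟩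
    filter_upwards [ae_nu_ne_zero d.hN] with x hx
    have := tendsto_natCast_atTop_atTop (R := ℝ) |>.eventually_ge_atTop |log ‖x‖|
    filter_upwards [this] with n hn
    rw [mem_ann_iff hx]
    exact abs_le.1 hn
  refine cov.integrable_of_integral_bounded_of_nonneg_ae C (fun n => integrableOn_ann c _ _) ?_ ?_
  · filter_upwards [ae_nu_ne_zero d.hN] with x hx using mul_nonneg (exp_pos _).le (d.D_nonneg hx)
  · refine Eventually.of_forall fun n => ?_
    refine (ann_mono_int c (fun x hx => mul_nonneg (exp_pos _).le (d.D_nonneg hx)) (a' := (-(n:ℝ) - 1) + 1) (by linarith) le_rfl).trans (hC _ _ ?_)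
    have : (0:ℝ) ≤ n := by positivity
    linarith

lemma tail_zero {f : E N → ℝ} (hN : 2 ≤ N) (hf : Integrable f (nu N)) {l : Filter ℝ} [l.IsCountablyGenerated]
    (hl : Tendsto (fun t : ℝ => |t|) l atTop) (a b : ℝ) :
    Tendsto (fun τ => ∫ x in ann N (a + τ) (b + τ), f x ∂(nu N)) l (nhds 0) := by
  have e : ∀ τ, ∫ x in ann N (a + τ) (b + τ), f x ∂(nu N) = ∫ x, (ann N (a + τ) (b + τ)).indicator f x ∂(nu N) :=
    fun τ => (integral_indicator (measurableSet_ann _ _)).symm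
  simp_rw [e]
  have h0 : (0:ℝ) = ∫ x : E N, (0:ℝ) ∂(nu N) := by simp
  rw [h0]
  refine tendsto_integral_filter_of_dominated_convergence (fun x => ‖f x‖) ?_ ?_ hf.norm ?_
  · exact Eventually.of_forall fun τ => (hf.indicator (measurableSet_ann _ _)).aestronglyMeasurable
  · exact Eventually.of_forall fun τ => Eventually.of_forall fun x => norm_indicator_le_norm_self _ _
  · filter_upwards [ae_nu_ne_zero hN] with x hx
    refine tendsto_const_nhds.congr' ?_
    filter_upwards [hl.eventually_gt_atTop (|log ‖x‖| + |a| + |b|)] with τ hτ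
    rw [Set.indicator_of_notMem]
    rw [mem_ann_iff hx]
    rintro ⟨h1, h2⟩
    have a1 := abs_le.1 (le_refl |log ‖x‖|)
    have a2 := abs_le.1 (le_refl |a|)
    have a3 := abs_le.1 (le_refl |b|)
    rcases lt_max_iff.1 (show _ < max τ (-τ) from hτ) with h | h <;> linarith

lemma wD_tendsto {σ : ℝ} (h : d.AllBd σ) {s : ℝ} (hs : s = σ ∨ s = d.p) {l : Filter ℝ} [l.IsCountablyGenerated]
    (hl : Tendsto (fun t : ℝ => |t|) l atTop) : Tendsto (d.wD s) l (nhds 0) := by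
  have hp := d.hp1
  have hσ := h.pos
  have hs0 : 0 < s := by rcases hs with rfl | rfl <;> linarith
  obtain ⟨M, hM, hw⟩ := win_abs_le d.hN
  obtain ⟨C, hC, hC'⟩ := h.e s hs0.le
  have hE := tail_zero d.hN (d.energy_int h hs) hl 0 1
  have c := (d.cont_exp s).mul d.cont_D
  refine small_of (A := M * C) (by positivity) (fun κ hκ => ?_) hE
  obtain ⟨Cκ, hCκ, hδ⟩ := delta_small hp hκ
  refine ⟨M * Cκ, by positivity, fun τ => ?_⟩
  have c1 : ContinuousOn (fun x => κ * exp (s * d.ell x)) {0}ᶜ := continuousOn_const.mul (d.cont_exp s)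
  have c2 : ContinuousOn (fun x => Cκ * (exp (s * d.ell x) * d.D x)) {0}ᶜ := continuousOn_const.mul c
  have h1 := hw _ _ (d.cont_del_exp s) (c1.fun_add c2) (fun x hx => by
    rw [abs_mul, abs_of_pos (exp_pos _)]
    have := mul_le_mul_of_nonneg_right (hδ _ _ (d.abs_s_le hx)) (exp_pos (s * d.ell x)).le
    refine this.trans (le_of_eq ?_)
    show (κ + Cκ * d.D x) * _ = κ * exp (s * d.ell x) + Cκ * (exp (s * d.ell x) * d.D x)
    ring) τ
  have e : ∫ x in ann N τ (τ + 1), (κ * exp (s * d.ell x) + Cκ * (exp (s * d.ell x) * d.D x)) ∂(nu N) =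
      κ * ∫ x in ann N τ (τ + 1), exp (s * d.ell x) ∂(nu N) + Cκ * ∫ x in ann N τ (τ + 1), exp (s * d.ell x) * d.D x ∂(nu N) := by
    rw [integral_add (integrableOn_ann c1 _ _) (integrableOn_ann c2 _ _), integral_const_mul, integral_const_mul]
  have h2 := h1.trans (le_of_eq (congrArg (M * ·) e))
  have h3 : M * (κ * ∫ x in ann N τ (τ + 1), exp (s * d.ell x) ∂(nu N)) ≤ M * (κ * C) := by
    have := hC' τ
    gcongr
  rw [zero_add, add_comm 1 τ]
  refine h2.trans ?_
  rw [mul_add]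
  refine (add_le_add_left h3 _).trans (le_of_eq ?_)
  ring

end Dat
end RS

namespace RS
open Metric

lemma seg_bound {N : ℕ} {F : E N → ℝ} {z : E N} {r : ℝ}
    (hF : ∀ x ∈ ball z r, ContDiffAt ℝ 1 F x) {x y : E N} (hx : x ∈ ball z r) (hy : y ∈ ball z r) :
    ‖F x - F y‖ₑ ≤ ∫⁻ t in Set.Icc (0:ℝ) 1, ENNReal.ofReal (2 * r) *
      (ball z r).indicator (fun u => ‖fderiv ℝ F u‖ₑ) (y + t • (x - y)) := by
  have hm : ∀ t ∈ Set.Icc (0:ℝ) 1, y + t • (x - y) ∈ ball z r := fun t ht =>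
    (convex_ball z r).add_smul_sub_mem hy hx ht
  have hpath : ∀ t : ℝ, HasDerivAt (fun t : ℝ => y + t • (x - y)) (x - y) t := by
    intro t
    have := ((hasDerivAt_id t).smul_const (x - y)).const_add y
    simpa using this
  have hc : ContDiffOn ℝ 1 (fun t : ℝ => F (y + t • (x - y))) (Set.Icc 0 1) := by
    intro t ht
    refine ContDiffAt.contDiffWithinAt ?_
    have h1 : ContDiffAt ℝ 1 (fun t : ℝ => y + t • (x - y)) t := by fun_prop
    exact ContDiffAt.comp t (hF _ (hm t ht)) h1
  have := enorm_sub_le_lintegral_deriv_of_contDiffOn_Icc hc zero_le_one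
  simp only [one_smul, zero_smul, add_zero, add_sub_cancel] at this
  refine this.trans ?_
  refine setLIntegral_mono' measurableSet_Icc fun t ht => ?_
  have hd := ((hF _ (hm t ht)).differentiableAt one_ne_zero).hasFDerivAt.comp_hasDerivAt t (hpath t)
  have hd' : deriv (fun t : ℝ => F (y + t • (x - y))) t = fderiv ℝ F (y + t • (x - y)) (x - y) := hd.deriv
  rw [hd', Set.indicator_of_mem (hm t ht), mul_comm]
  refine (ContinuousLinearMap.le_opENorm _ _).trans ?_
  gcongr
  rw [← ofReal_norm]
  refine ENNReal.ofReal_le_ofReal ?_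
  rw [← dist_eq_norm]
  have := dist_triangle_right x y z
  have h1 := mem_ball.1 hx
  have h2 := mem_ball.1 hy
  linarith

lemma poinc {N : ℕ} {F : E N → ℝ} {z : E N} {r : ℝ}
    (hF : ∀ x ∈ ball z r, ContDiffAt ℝ 1 F x) :
    ∫⁻ x in ball z r, ∫⁻ y in ball z r, ‖F x - F y‖ₑ ≤
      ENNReal.ofReal (2 * r) * volume (ball (0 : E N) (2 * r)) * ∫⁻ x in ball z r, ‖fderiv ℝ F x‖ₑ := by
  set B := ball z r with hB
  set g : E N → ENNReal := B.indicator (fun u => ‖fderiv ℝ F u‖ₑ) with hg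
  have hgm : Measurable g := (measurable_fderiv ℝ F).enorm.indicator measurableSet_ball
  set B2 := ball (0 : E N) (2 * r)
  set χ : E N → ENNReal := B2.indicator 1 with hχ
  have hχm : Measurable χ := measurable_one.indicator measurableSet_ball
  have h1 : ∫⁻ x in B, ∫⁻ y in B, ‖F x - F y‖ₑ ≤
      ∫⁻ x in B, ∫⁻ y, ∫⁻ t in Set.Icc (0:ℝ) 1, ENNReal.ofReal (2 * r) * (χ (x - y) * g (y + t • (x - y))) := by
    refine setLIntegral_mono' measurableSet_ball fun x hx => ?_
    refine le_trans ?_ (setLIntegral_le_lintegral B _)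
    refine setLIntegral_mono' measurableSet_ball fun y hy => ?_
    refine (seg_bound hF hx hy).trans (le_of_eq ?_)
    have : χ (x - y) = 1 := by
      rw [hχ, Set.indicator_of_mem]; rfl
      rw [mem_ball_zero_iff, ← dist_eq_norm]
      have := dist_triangle_right x y z
      have h1 := mem_ball.1 hx
      have h2 := mem_ball.1 hy
      linarith
    rw [this]; simp only [one_mul, hg, hB]
  refine h1.trans ((setLIntegral_le_lintegral B _).trans ?_)
  have m3 : Measurable (fun u : (E N × E N) × ℝ => ENNReal.ofReal (2 * r) * (χ u.1.1 * g (u.1.2 + u.2 • u.1.1))) := by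
    refine measurable_const.mul ((hχm.comp (by fun_prop)).mul (hgm.comp (by fun_prop)))
  have m3' : Measurable (fun u : (E N × E N) × ℝ => ENNReal.ofReal (2 * r) * (χ (u.1.1 - u.1.2) * g (u.1.2 + u.2 • (u.1.1 - u.1.2)))) := by
    refine measurable_const.mul ((hχm.comp (by fun_prop)).mul (hgm.comp (by fun_prop)))
  have m2 : Measurable (fun u : E N × E N => ∫⁻ t in Set.Icc (0:ℝ) 1, ENNReal.ofReal (2 * r) * (χ u.1 * g (u.2 + t • u.1))) :=
    m3.lintegral_prod_right'
  have m2' : Measurable (fun u : E N × E N => ∫⁻ t in Set.Icc (0:ℝ) 1, ENNReal.ofReal (2 * r) * (χ (u.1 - u.2) * g (u.2 + t • (u.1 - u.2)))) :=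
    m3'.lintegral_prod_right'
  rw [lintegral_lintegral_swap m2'.aemeasurable]
  have h2 : ∀ y : E N, ∫⁻ x, ∫⁻ t in Set.Icc (0:ℝ) 1, ENNReal.ofReal (2 * r) * (χ (x - y) * g (y + t • (x - y))) =
      ∫⁻ x, ∫⁻ t in Set.Icc (0:ℝ) 1, ENNReal.ofReal (2 * r) * (χ x * g (y + t • x)) := fun y =>
    lintegral_sub_right_eq_self (fun x => ∫⁻ t in Set.Icc (0:ℝ) 1, ENNReal.ofReal (2 * r) * (χ x * g (y + t • x))) y
  simp_rw [h2]
  rw [← lintegral_lintegral_swap m2.aemeasurable]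
  have h3 : ∀ x : E N, ∫⁻ y, ∫⁻ t in Set.Icc (0:ℝ) 1, ENNReal.ofReal (2 * r) * (χ x * g (y + t • x)) =
      ENNReal.ofReal (2 * r) * (χ x * ∫⁻ y, g y) := by
    intro x
    have m : Measurable (fun u : E N × ℝ => ENNReal.ofReal (2 * r) * (χ x * g (u.1 + u.2 • x))) := by
      refine measurable_const.mul (measurable_const.mul (hgm.comp (by fun_prop)))
    rw [lintegral_lintegral_swap m.aemeasurable]
    have : ∀ t : ℝ, ∫⁻ y, ENNReal.ofReal (2 * r) * (χ x * g (y + t • x)) = ENNReal.ofReal (2 * r) * (χ x * ∫⁻ y, g y) := by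
      intro t
      have mm : Measurable (fun y => g (y + t • x)) := hgm.comp (by fun_prop)
      rw [lintegral_const_mul _ (mm.const_mul (χ x)), lintegral_const_mul _ mm, lintegral_add_right_eq_self]
    simp_rw [this]
    simp
  simp_rw [h3]
  rw [lintegral_const_mul _ (hχm.mul_const _), lintegral_mul_const _ hχm, hχ, lintegral_indicator_one measurableSet_ball,
    hg, lintegral_indicator measurableSet_ball, mul_assoc]

/-- spread of F between two sets -/
noncomputable def spr {N : ℕ} (F : E N → ℝ) (A B : Set (E N)) : ENNReal := ∫⁻ x in A, ∫⁻ y in B, ‖F x - F y‖ₑ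

lemma spr_mono {N : ℕ} (F : E N → ℝ) {A B A' B' : Set (E N)} (hA : A ⊆ A') (hB : B ⊆ B') : spr F A B ≤ spr F A' B' :=
  (lintegral_mono fun _ => lintegral_mono_set hB).trans (lintegral_mono_set hA)

lemma lint_union {N : ℕ} (f : E N → ENNReal) (A B : Set (E N)) :
    ∫⁻ x in A ∪ B, f x ≤ (∫⁻ x in A, f x) + ∫⁻ x in B, f x := lintegral_union_le f A B

lemma spr_union_left {N : ℕ} (F : E N → ℝ) (A A' B : Set (E N)) : spr F (A ∪ A') B ≤ spr F A B + spr F A' B :=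
  lint_union _ _ _

lemma spr_comm {N : ℕ} {F : E N → ℝ} (hF : AEMeasurable F) (A B : Set (E N)) : spr F A B = spr F B A := by
  unfold spr
  rw [lintegral_lintegral_swap]
  · simp_rw [enorm_sub_rev]
  · have h1 : AEMeasurable (fun u : E N × E N => F u.1) ((volume.restrict A).prod (volume.restrict B)) :=
      (hF.restrict (s := A)).comp_fst
    have h2 : AEMeasurable (fun u : E N × E N => F u.2) ((volume.restrict A).prod (volume.restrict B)) :=
      (hF.restrict (s := B)).comp_snd
    exact (h1.sub h2).enorm

lemma spr_trans {N : ℕ} {F : E N → ℝ} (hF : AEMeasurable F) (A B C : Set (E N)) :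
    volume B * spr F A C ≤ volume C * spr F A B + volume A * spr F B C := by
  have h : ∀ x y, volume B * ‖F x - F y‖ₑ ≤ ∫⁻ w in B, (‖F x - F w‖ₑ + ‖F w - F y‖ₑ) := by
    intro x y
    rw [mul_comm, ← setLIntegral_const]
    refine lintegral_mono fun w => ?_
    have : F x - F y = (F x - F w) + (F w - F y) := by ring
    rw [this]; exact enorm_add_le _ _
  have hm : ∀ (S : Set (E N)) x, AEMeasurable (fun w => ‖F x - F w‖ₑ) (volume.restrict S) := fun S x =>
    (hF.restrict.const_sub _).enorm
  have hm2 : ∀ (S : Set (E N)) x, AEMeasurable (fun w => ‖F w - F x‖ₑ) (volume.restrict S) := fun S x =>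
    (hF.restrict.sub_const _).enorm
  have hp : ∀ S T : Set (E N), AEMeasurable (fun u : E N × E N => ‖F u.1 - F u.2‖ₑ) ((volume.restrict S).prod (volume.restrict T)) := fun S T => by
    have h1 : AEMeasurable (fun u : E N × E N => F u.1) ((volume.restrict S).prod (volume.restrict T)) :=
      (hF.restrict (s := S)).comp_fst
    have h2 : AEMeasurable (fun u : E N × E N => F u.2) ((volume.restrict S).prod (volume.restrict T)) :=
      (hF.restrict (s := T)).comp_snd
    exact (h1.sub h2).enorm
  have hi : ∀ S T : Set (E N), AEMeasurable (fun x => ∫⁻ y in T, ‖F x - F y‖ₑ) (volume.restrict S) := fun S T =>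
    (hp S T).lintegral_prod_right'
  calc volume B * spr F A C = ∫⁻ x in A, ∫⁻ y in C, volume B * ‖F x - F y‖ₑ := by
        unfold spr
        rw [← lintegral_const_mul'' _ (hi A C)]
        congr 1; ext x
        rw [lintegral_const_mul'' _ (hm C x)]
    _ ≤ ∫⁻ x in A, ∫⁻ y in C, ((∫⁻ w in B, ‖F x - F w‖ₑ) + ∫⁻ w in B, ‖F w - F y‖ₑ) := by
        refine lintegral_mono fun x => lintegral_mono fun y => ?_
        refine (h x y).trans (le_of_eq ?_)
        rw [lintegral_add_left' (hm B x)]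
    _ = ∫⁻ x in A, (volume C * (∫⁻ w in B, ‖F x - F w‖ₑ) + spr F B C) := by
        congr 1; ext x
        rw [lintegral_add_left' aemeasurable_const, setLIntegral_const, mul_comm, spr_comm hF B C]
        simp only [spr, enorm_sub_rev]
    _ = _ := by
        rw [lintegral_add_right' _ aemeasurable_const, setLIntegral_const, lintegral_const_mul'' _ (hi A B), mul_comm (spr F B C)]
        rfl

/-- vanishing oscillation on compact sets -/
lemma spr_zero {N : ℕ} (hN : 2 ≤ N) {F : ℝ → E N → ℝ} {l : Filter ℝ}
    (hm : ∀ τ, AEMeasurable (F τ))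
    (hd : ∀ τ x, x ≠ 0 → ContDiffAt ℝ 1 (F τ) x)
    (hg : ∀ a b : ℝ, Tendsto (fun τ => ∫⁻ x in ann N a b, ‖fderiv ℝ (F τ) x‖ₑ) l (nhds 0)) {K : Set (E N)}
    (hK : IsCompact K) (hK0 : K ⊆ {0}ᶜ) : Tendsto (fun τ => spr (F τ) K K) l (nhds 0) := by
  set P : E N → E N → Prop := fun z w => ∃ r : ℝ, 0 < r ∧ Tendsto (fun τ => spr (F τ) (ball z r) (ball w r)) l (nhds 0) with hP
  have sq : ∀ {f g : ℝ → ENNReal}, (∀ τ, f τ ≤ g τ) → Tendsto g l (nhds 0) → Tendsto f l (nhds 0) := fun h hg =>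
    tendsto_of_tendsto_of_tendsto_of_le_of_le tendsto_const_nhds hg (fun _ => zero_le) h
  have hmono : ∀ {z w : E N} {r r' : ℝ}, r ≤ r' → Tendsto (fun τ => spr (F τ) (ball z r') (ball w r')) l (nhds 0) →
      Tendsto (fun τ => spr (F τ) (ball z r) (ball w r)) l (nhds 0) := fun h ht =>
    sq (fun τ => spr_mono _ (ball_subset_ball h) (ball_subset_ball h)) ht
  have hcon : IsPreconnected ({0}ᶜ : Set (E N)) := by
    refine (isConnected_compl_singleton_of_one_lt_rank ?_ _).isPreconnected
    rw [← Module.finrank_eq_rank, finrank_euclideanSpace_fin]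
    exact_mod_cast (by omega : 1 < N)
  have all : ∀ z w : E N, z ≠ 0 → w ≠ 0 → P z w := by
    intro z w hz hw
    refine hcon.induction₂ P ?_ ?_ ?_ hz hw
    · intro x hx
      have hx' := norm_pos_iff.2 hx
      set r := ‖x‖ / 2 with hr
      have hr0 : 0 < r := by positivity
      have hsub : ball x r ⊆ ann N (log (‖x‖ / 2)) (log (2 * ‖x‖)) := by
        intro y hy
        rw [mem_ball, dist_eq_norm] at hy
        have h1 := norm_sub_norm_le x y
        have h2 := norm_sub_norm_le y x
        rw [norm_sub_rev] at h1
        constructor <;> rw [exp_log (by positivity)] <;> linarith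
      have t0 : Tendsto (fun τ => spr (F τ) (ball x r) (ball x r)) l (nhds 0) := by
        have := ENNReal.Tendsto.const_mul (a := ENNReal.ofReal (2 * r) * volume (ball (0 : E N) (2 * r))) (hg (log (‖x‖ / 2)) (log (2 * ‖x‖)))
          (Or.inr (ENNReal.mul_ne_top ENNReal.ofReal_ne_top measure_ball_lt_top.ne))
        rw [mul_zero] at this
        refine sq (fun τ => ?_) this
        refine (poinc fun y hy => hd τ y (ne_zero_of_mem_ann (hsub hy))).trans ?_
        gcongr
      refine eventually_nhdsWithin_of_eventually_nhds ?_
      filter_upwards [ball_mem_nhds x (show 0 < r / 2 by positivity)] with y hy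
      refine ⟨r / 2, by positivity, sq (fun τ => spr_mono _ (ball_subset_ball (by linarith)) ?_) t0⟩
      refine ball_subset_ball' ?_
      rw [mem_ball] at hy; linarith
    · rintro x y u hx hy hu ⟨r, hr, h1⟩ ⟨r', hr', h2⟩
      set ρ := min r r'
      have hρ : 0 < ρ := lt_min hr hr'
      refine ⟨ρ, hρ, ?_⟩
      have h1' := hmono (min_le_left r r') h1
      have h2' := hmono (min_le_right r r') h2
      have vb : volume (ball y ρ) ≠ 0 := (measure_ball_pos _ _ hρ).ne'
      have vf : ∀ w : E N, volume (ball w ρ) ≠ ⊤ := fun w => measure_ball_lt_top.ne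
      have h3 := (ENNReal.Tendsto.const_mul (a := volume (ball u ρ)) h1' (Or.inr (vf _))).add
        (ENNReal.Tendsto.const_mul (a := volume (ball x ρ)) h2' (Or.inr (vf _)))
      rw [mul_zero, mul_zero, add_zero] at h3
      have h4 := sq (fun τ => spr_trans (hm τ) (ball x ρ) (ball y ρ) (ball u ρ)) h3
      have h5 := ENNReal.Tendsto.const_mul (a := (volume (ball y ρ))⁻¹) h4 (Or.inr (ENNReal.inv_ne_top.2 vb))
      simp only [← mul_assoc, ENNReal.inv_mul_cancel vb (vf y), one_mul, mul_zero] at h5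
      exact h5
    · rintro x y hx hy ⟨r, hr, h⟩
      refine ⟨r, hr, ?_⟩
      simp_rw [fun τ => spr_comm (hm τ) (ball y r) (ball x r)]
      exact h
  have un : ∀ {A A' B : Set (E N)}, Tendsto (fun τ => spr (F τ) A B) l (nhds 0) →
      Tendsto (fun τ => spr (F τ) A' B) l (nhds 0) → Tendsto (fun τ => spr (F τ) (A ∪ A') B) l (nhds 0) := by
    intro A A' B h1 h2
    have := h1.add h2
    rw [add_zero] at this
    exact sq (fun τ => spr_union_left _ _ _ _) this
  have emp : ∀ B : Set (E N), Tendsto (fun τ => spr (F τ) ∅ B) l (nhds 0) := fun B => by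
    simp only [spr, Measure.restrict_empty, lintegral_zero_measure]; exact tendsto_const_nhds
  have step : ∀ w : E N, w ≠ 0 → ∃ t ∈ nhds w, Tendsto (fun τ => spr (F τ) K t) l (nhds 0) := by
    intro w hw
    refine hK.induction_on (p := fun S => ∃ t ∈ nhds w, Tendsto (fun τ => spr (F τ) S t) l (nhds 0)) ?_ ?_ ?_ ?_
    · exact ⟨Set.univ, univ_mem, emp _⟩
    · rintro S T hST ⟨t, ht, h⟩
      exact ⟨t, ht, sq (fun τ => spr_mono _ hST subset_rfl) h⟩
    · rintro S T ⟨t, ht, h⟩ ⟨t', ht', h'⟩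
      exact ⟨t ∩ t', inter_mem ht ht', un (sq (fun τ => spr_mono _ subset_rfl Set.inter_subset_left) h)
        (sq (fun τ => spr_mono _ subset_rfl Set.inter_subset_right) h')⟩
    · intro z hz
      obtain ⟨r, hr, h⟩ := all z w (hK0 hz) hw
      exact ⟨ball z r, mem_nhdsWithin_of_mem_nhds (ball_mem_nhds _ hr), ball w r, ball_mem_nhds _ hr, h⟩
  refine hK.induction_on (p := fun S => Tendsto (fun τ => spr (F τ) S K) l (nhds 0)) (emp K) ?_ (fun S T h h' => un h h') ?_
  · intro S T hST h
    exact sq (fun τ => spr_mono _ hST subset_rfl) h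
  · intro w hw
    obtain ⟨t, ht, h⟩ := step w (hK0 hw)
    refine ⟨t, mem_nhdsWithin_of_mem_nhds ht, ?_⟩
    simp_rw [fun τ => spr_comm (hm τ) t K]
    exact h

end RS

namespace RS
open Metric

lemma aem_of_cont {N : ℕ} (hN : 2 ≤ N) {f : E N → ℝ} (hf : ContinuousOn f {0}ᶜ) : AEMeasurable f volume := by
  have h : AEMeasurable f (volume.restrict ({0}ᶜ : Set (E N))) := hf.aemeasurable (measurableSet_singleton 0).compl
  rwa [Measure.restrict_eq_self_of_ae_mem (show ∀ᵐ x : E N, x ∈ ({0}ᶜ : Set (E N)) from ae_ne_zero hN)] at h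

lemma nuK_le {N : ℕ} (g : E N → ENNReal) : ∫⁻ x in ann N 0 1, g x ∂(nu N) ≤ ∫⁻ x in ann N 0 1, g x := by
  refine lintegral_mono' ?_ le_rfl
  refine Measure.le_iff.2 fun s hs => ?_
  rw [Measure.restrict_apply hs, Measure.restrict_apply hs]
  have hm := hs.inter (measurableSet_ann (N := N) 0 1)
  unfold nu
  rw [withDensity_apply _ hm, ← setLIntegral_one]
  refine setLIntegral_mono' hm fun x hx => ?_
  rw [← ENNReal.ofReal_one]
  refine ENNReal.ofReal_le_ofReal ?_
  have := hx.2.1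
  rw [exp_zero] at this
  exact inv_le_one_of_one_le₀ (one_le_pow₀ this)

lemma T'_supp0 : Supp T' 0 1 := T'_supp

lemma w_int {N : ℕ} (hN : 2 ≤ N) {f : E N → ℝ} (hf : ContinuousOn f {0}ᶜ) :
    Integrable (fun x => T' (log ‖x‖) * f x) (nu N) := by
  have := win_int hN hf 0
  simpa only [sub_zero] using this

noncomputable def ZZ (N : ℕ) : ℝ := ∫ x, T' (log ‖x‖) ∂(nu N)

lemma w_abs_le {N : ℕ} (hN : 2 ≤ N) : ∃ M : ℝ, 0 ≤ M ∧ ∀ f g : E N → ℝ, ContinuousOn f {0}ᶜ → ContinuousOn g {0}ᶜ →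
    (∀ x, x ≠ 0 → |f x| ≤ g x) → |∫ x, T' (log ‖x‖) * f x ∂(nu N)| ≤ M * ∫ x in ann N 0 1, g x ∂(nu N) := by
  obtain ⟨M, hM, h⟩ := win_abs_le hN
  refine ⟨M, hM, fun f g hf hg hfg => ?_⟩
  have := h f g hf hg hfg 0
  simpa only [win, sub_zero, zero_add] using this

lemma rev_jensen {N : ℕ} (hN : 2 ≤ N) (hZ : 0 < ZZ N) {F : ℝ → E N → ℝ} {l : Filter ℝ}
    (hc : ∀ τ, ContinuousOn (F τ) {0}ᶜ) (hpos : ∀ τ x, 0 ≤ F τ x)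
    (hspr : Tendsto (fun τ => spr (F τ) (ann N 0 1) (ann N 0 1)) l (nhds 0))
    (hb : ∀ n : ℕ, ∃ C : ℝ, 0 ≤ C ∧ ∀ τ, ∫ x in ann N 0 1, F τ x ^ n ∂(nu N) ≤ C) {m : ℕ} (hm : 1 ≤ m) :
    Tendsto (fun τ => (ZZ N)⁻¹ * (∫ x, T' (log ‖x‖) * F τ x ^ m ∂(nu N)) -
      ((ZZ N)⁻¹ * ∫ x, T' (log ‖x‖) * F τ x ∂(nu N)) ^ m) l (nhds 0) := by
  obtain ⟨M, hM, hw⟩ := w_abs_le hN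
  set Z := ZZ N with hZd
  set α : ℝ → ℝ := fun τ => Z⁻¹ * ∫ x, T' (log ‖x‖) * F τ x ∂(nu N) with hα
  have hcp : ∀ (n : ℕ) τ, ContinuousOn (fun x => F τ x ^ n) {0}ᶜ := fun n τ => (hc τ).pow n
  have hα0 : ∀ τ, 0 ≤ α τ := fun τ => mul_nonneg (inv_nonneg.2 hZ.le)
    (integral_nonneg fun x => mul_nonneg (T'_nonneg _) (hpos τ x))
  -- integrals of constants
  have hconst : ∀ c : ℝ, ∫ x, T' (log ‖x‖) * c ∂(nu N) = Z * c := fun c => by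
    rw [integral_mul_const]; rfl
  have hdiff : ∀ (f : E N → ℝ) (c : ℝ), ContinuousOn f {0}ᶜ →
      Z⁻¹ * (∫ x, T' (log ‖x‖) * f x ∂(nu N)) - c = Z⁻¹ * ∫ x, T' (log ‖x‖) * (f x - c) ∂(nu N) := by
    intro f c hf
    have e := integral_sub (w_int hN hf) (w_int hN (continuousOn_const (c := c)))
    have e2 : ∫ x, T' (log ‖x‖) * (f x - c) ∂(nu N) = ∫ x, (T' (log ‖x‖) * f x - T' (log ‖x‖) * c) ∂(nu N) := by
      congr 1; ext x; ring
    rw [e2, e, hconst]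
    field_simp
  -- alpha bounded
  obtain ⟨C1, hC1, hC1'⟩ := hb 1
  set A0 := Z⁻¹ * (M * C1) with hA0
  have hA0' : 0 ≤ A0 := by positivity
  have hαb : ∀ τ, α τ ≤ A0 := by
    intro τ
    have h1 := le_of_abs_le (hw (F τ) (fun x => F τ x ^ 1) (hc τ) (hcp 1 τ) (fun x _ => by rw [pow_one, abs_of_nonneg (hpos τ x)]))
    simp only [hα, hA0]
    gcongr
    exact h1.trans (by gcongr; exact hC1' τ)
  -- L1 deviation
  have hK : (nu N) (ann N 0 1) ≠ ⊤ := (nu_ann_lt_top 0 1).ne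
  have hdev : Tendsto (fun τ => ∫ x in ann N 0 1, |F τ x - α τ| ∂(nu N)) l (nhds 0) := by
    have hcd : ∀ τ, ContinuousOn (fun x => F τ x - α τ) {0}ᶜ := fun τ => (hc τ).fun_sub continuousOn_const
    have e1 : ∀ τ, ∫ x in ann N 0 1, |F τ x - α τ| ∂(nu N) = (∫⁻ x in ann N 0 1, ‖F τ x - α τ‖ₑ ∂(nu N)).toReal := by
      intro τ
      exact integral_norm_eq_lintegral_enorm (integrableOn_ann (hcd τ) 0 1).aestronglyMeasurable
    simp_rw [e1]
    rw [← ENNReal.toReal_zero]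
    refine (ENNReal.tendsto_toReal ENNReal.zero_ne_top).comp ?_
    have h1 := ENNReal.Tendsto.const_mul (a := ENNReal.ofReal (Z⁻¹ * M)) hspr (Or.inr ENNReal.ofReal_ne_top)
    rw [mul_zero] at h1
    refine tendsto_of_tendsto_of_tendsto_of_le_of_le tendsto_const_nhds h1 (fun _ => zero_le) fun τ => ?_
    calc ∫⁻ x in ann N 0 1, ‖F τ x - α τ‖ₑ ∂(nu N) ≤
        ∫⁻ x in ann N 0 1, ENNReal.ofReal (Z⁻¹ * M) * ∫⁻ y in ann N 0 1, ‖F τ x - F τ y‖ₑ := by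
          refine (nuK_le _).trans ?_
          refine lintegral_mono fun x => ?_
          have cx : ContinuousOn (fun y => F τ y - F τ x) {0}ᶜ := (hc τ).fun_sub continuousOn_const
          have cx' : ContinuousOn (fun y => |F τ y - F τ x|) {0}ᶜ := cx.abs
          have h2 : |F τ x - α τ| ≤ Z⁻¹ * (M * ∫ y in ann N 0 1, |F τ y - F τ x| ∂(nu N)) := by
            rw [abs_sub_comm]
            simp only [hα]
            rw [hdiff (F τ) (F τ x) (hc τ), abs_mul, abs_of_pos (inv_pos.2 hZ)]
            gcongr
            exact hw _ _ cx cx' (fun y _ => le_rfl)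
          have h3 : ENNReal.ofReal (∫ y in ann N 0 1, |F τ y - F τ x| ∂(nu N)) ≤ ∫⁻ y in ann N 0 1, ‖F τ x - F τ y‖ₑ := by
            rw [show ∫ y in ann N 0 1, |F τ y - F τ x| ∂(nu N) = (∫⁻ y in ann N 0 1, ‖F τ y - F τ x‖ₑ ∂(nu N)).toReal from
              integral_norm_eq_lintegral_enorm (integrableOn_ann cx 0 1).aestronglyMeasurable]
            refine ENNReal.ofReal_toReal_le.trans ((nuK_le _).trans (le_of_eq ?_))
            simp only [enorm_sub_rev]
          rw [Real.enorm_eq_ofReal_abs]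
          refine (ENNReal.ofReal_le_ofReal h2).trans ?_
          rw [← mul_assoc, ENNReal.ofReal_mul (by positivity)]
          gcongr
      _ = _ := by
          rw [lintegral_const_mul' _ _ ENNReal.ofReal_ne_top]; rfl
  -- conclusion
  set n := 2 * m - 1 with hn
  obtain ⟨Cn, hCn, hCn'⟩ := hb n
  set B := 2 ^ (n - 1) * (Cn + A0 ^ n * V1 N) with hB
  have hV := V1_nonneg N
  have hB0 : 0 ≤ B := by positivity
  refine small_of (A := Z⁻¹ * (M * (m * B))) (by positivity) (fun κ hκ => ?_) hdev
  refine ⟨Z⁻¹ * (M * (m * κ⁻¹)), by positivity, fun τ => ?_⟩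
  rw [hdiff (fun x => F τ x ^ m) _ (hcp m τ), abs_mul, abs_of_pos (inv_pos.2 hZ)]
  have c1 : ContinuousOn (fun x => F τ x ^ m - α τ ^ m) {0}ᶜ := (hcp m τ).fun_sub continuousOn_const
  have c2 : ContinuousOn (fun x => |F τ x - α τ|) {0}ᶜ := ((hc τ).fun_sub continuousOn_const).abs
  have c3 : ContinuousOn (fun x => F τ x ^ n + A0 ^ n) {0}ᶜ := (hcp n τ).fun_add continuousOn_const
  have c4 : ContinuousOn (fun x => (m * κ⁻¹) * |F τ x - α τ|) {0}ᶜ := continuousOn_const.fun_mul c2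
  have c5 : ContinuousOn (fun x => (m * κ * 2 ^ (n - 1)) * (F τ x ^ n + A0 ^ n)) {0}ᶜ := continuousOn_const.fun_mul c3
  have h1 := hw (fun x => F τ x ^ m - α τ ^ m) (fun x => (m * κ⁻¹) * |F τ x - α τ| + (m * κ * 2 ^ (n - 1)) * (F τ x ^ n + A0 ^ n))
    c1 (c4.fun_add c5) (fun x _ => ?_)
  · have e : ∫ x in ann N 0 1, ((m * κ⁻¹) * |F τ x - α τ| + (m * κ * 2 ^ (n - 1)) * (F τ x ^ n + A0 ^ n)) ∂(nu N) =
        (m * κ⁻¹) * (∫ x in ann N 0 1, |F τ x - α τ| ∂(nu N)) + (m * κ * 2 ^ (n - 1)) *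
          ((∫ x in ann N 0 1, F τ x ^ n ∂(nu N)) + A0 ^ n * V1 N) := by
      rw [integral_add (integrableOn_ann c4 _ _) (integrableOn_ann c5 _ _), integral_const_mul, integral_const_mul,
        integral_add (integrableOn_ann (hcp n τ) _ _) (integrableOn_ann continuousOn_const _ _), setIntegral_const, smul_eq_mul, mul_comm _ (A0 ^ n), V1]
    rw [e] at h1
    have h2 := mul_le_mul_of_nonneg_left h1 (inv_nonneg.2 hZ.le)
    refine h2.trans ?_
    have h3 : (m * κ * 2 ^ (n - 1)) * ((∫ x in ann N 0 1, F τ x ^ n ∂(nu N)) + A0 ^ n * V1 N) ≤ m * κ * B := by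
      rw [hB, ← mul_assoc]
      gcongr
      exact hCn' τ
    have h4 : Z⁻¹ * (M * ((m * κ⁻¹) * (∫ x in ann N 0 1, |F τ x - α τ| ∂(nu N)) + (m * κ * 2 ^ (n - 1)) *
          ((∫ x in ann N 0 1, F τ x ^ n ∂(nu N)) + A0 ^ n * V1 N))) ≤
        Z⁻¹ * (M * ((m * κ⁻¹) * (∫ x in ann N 0 1, |F τ x - α τ| ∂(nu N)) + m * κ * B)) := by gcongr
    refine h4.trans (le_of_eq ?_)
    ring
  · -- pointwise
    have ha := hα0 τ
    have hf := hpos τ x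
    have hA := hαb τ
    set f := F τ x
    set a := α τ
    have g1 : |f ^ m - a ^ m| ≤ |f - a| * m * (f + a) ^ (m - 1) := by
      refine (abs_pow_sub_pow_le f a m).trans ?_
      gcongr
      refine max_le ?_ ?_
      · rw [abs_of_nonneg hf]; linarith
      · rw [abs_of_nonneg ha]; linarith
    have g2 : |f - a| * (f + a) ^ (m - 1) ≤ κ⁻¹ * |f - a| + κ * (f + a) ^ n := by
      have hfa : |f - a| ≤ f + a := abs_le.2 ⟨by linarith, by linarith⟩
      have h0 : 0 ≤ f + a := by linarith
      set Y := (f + a) ^ (m - 1) with hY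
      have hY0 : 0 ≤ Y := by positivity
      have hYn : (f + a) ^ n = (f + a) * Y * Y := by
        rw [hY, hn, mul_assoc, ← pow_add, ← pow_succ']
        congr 1; omega
      rw [hYn]
      rcases le_total Y κ⁻¹ with h | h
      · have := mul_le_mul_of_nonneg_left h (abs_nonneg (f - a))
        have : 0 ≤ κ * ((f + a) * Y * Y) := by positivity
        linarith
      · have h5 : 1 ≤ κ * Y := by
          have := mul_le_mul_of_nonneg_left h hκ.le
          rwa [mul_inv_cancel₀ hκ.ne'] at this
        have h6 : |f - a| * Y ≤ (f + a) * Y := by gcongr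
        have h7 : (f + a) * Y * 1 ≤ (f + a) * Y * (κ * Y) := by gcongr
        have : 0 ≤ κ⁻¹ * |f - a| := by positivity
        linarith
    have g3 : (f + a) ^ n ≤ 2 ^ (n - 1) * (f ^ n + A0 ^ n) := by
      refine (add_pow_le hf ha n).trans ?_
      gcongr
    calc |f ^ m - a ^ m| ≤ m * (|f - a| * (f + a) ^ (m - 1)) := g1.trans (le_of_eq (by ring))
      _ ≤ m * (κ⁻¹ * |f - a| + κ * (2 ^ (n - 1) * (f ^ n + A0 ^ n))) := by
          gcongr
          exact g2.trans (by gcongr)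
      _ = _ := by ring

end RS

namespace RS
open Metric

lemma ann_smul {N : ℕ} (f : E N → ℝ) (a b τ : ℝ) :
    ∫ x in ann N a b, f (exp τ • x) ∂(nu N) = ∫ x in ann N (a + τ) (b + τ), f x ∂(nu N) := by
  have h := (mp_smul N (exp_pos τ)).setIntegral_preimage_emb
    (Homeomorph.smulOfNeZero (exp τ) (exp_pos τ).ne').measurableEmbedding f (ann N (a + τ) (b + τ))
  rw [preimage_ann, add_sub_cancel_right, add_sub_cancel_right] at h
  exact h

lemma ann_nu {N : ℕ} (f : E N → ℝ) (a b : ℝ) :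
    ∫ x in ann N a b, f x ∂(nu N) = ∫ x in ann N a b, (‖x‖ ^ N)⁻¹ * f x := by
  rw [← integral_indicator (measurableSet_ann _ _), integral_nu, ← integral_indicator (measurableSet_ann _ _)]
  congr 1; ext x
  by_cases hx : x ∈ ann N a b <;> simp [hx]

lemma ae_of_nu {N : ℕ} (hN : 2 ≤ N) {P : E N → Prop} (h : ∀ᵐ x ∂(nu N), P x) : ∀ᵐ x, P x := by
  have : (volume : Measure (E N)) ≪ nu N := by
    unfold nu
    refine withDensity_absolutelyContinuous' (measurable_dens N).aemeasurable ?_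
    filter_upwards [ae_ne_zero hN] with x hx
    have := norm_pos_iff.2 hx
    exact (ENNReal.ofReal_pos.2 (by positivity)).ne'
  exact this.ae_le h

lemma zero_of_int {N : ℕ} (hN : 2 ≤ N) {f : E N → ℝ} (hf : ContinuousOn f {0}ᶜ) (h0 : ∀ x, x ≠ 0 → 0 ≤ f x)
    (hi : Integrable f (nu N)) (h : ∫ x, f x ∂(nu N) = 0) : ∀ x, x ≠ 0 → f x = 0 := by
  have h1 : ∀ᵐ x ∂(nu N), 0 ≤ f x := by
    filter_upwards [ae_nu_ne_zero hN] with x hx using h0 x hx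
  have h2 := (integral_eq_zero_iff_of_nonneg_ae h1 hi).1 h
  have h3 : f =ᵐ[volume] 0 := ae_of_nu hN h2
  have h4 := Measure.eqOn_open_of_ae_eq (ae_restrict_of_ae (s := ({0}ᶜ : Set (E N))) h3) isOpen_compl_singleton hf continuousOn_const
  exact fun x hx => h4 hx

lemma ZZ_pos {N : ℕ} (hN : 2 ≤ N) : 0 < ZZ N := by
  have hc : ContinuousOn (fun x : E N => T' (log ‖x‖)) {0}ᶜ := C1_T.c.comp_continuousOn Dat.cont_logn
  have hi : Integrable (fun x : E N => T' (log ‖x‖)) (nu N) := by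
    have := w_int hN (f := fun _ => 1) continuousOn_const
    simpa using this
  have h0 : 0 ≤ ZZ N := integral_nonneg fun x => T'_nonneg _
  refine lt_of_le_of_ne h0 fun h => ?_
  have hz := zero_of_int hN hc (fun x _ => T'_nonneg _) hi h.symm
  have hT : ∀ t, T' t = 0 := by
    intro t
    have : Nontrivial (E N) := by
      have : Nonempty (Fin N) := ⟨⟨0, by omega⟩⟩
      infer_instance
    obtain ⟨x, hx⟩ := NormedSpace.exists_lt_norm ℝ (E N) 0
    have hx0 : x ≠ 0 := norm_pos_iff.1 hx
    have hn : ‖(exp t * ‖x‖⁻¹) • x‖ = exp t := by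
      rw [norm_smul, Real.norm_of_nonneg (by positivity), mul_assoc, inv_mul_cancel₀ hx.ne', mul_one]
    have := hz ((exp t * ‖x‖⁻¹) • x) (norm_pos_iff.1 (by rw [hn]; positivity))
    rwa [hn, log_exp] at this
  have hconst := is_const_of_deriv_eq_zero (f := smoothTransition) (fun t => (C1_T.d t).differentiableAt)
    (fun t => by rw [(C1_T.d t).deriv, hT]) 0 1
  rw [smoothTransition.zero, smoothTransition.one] at hconst
  exact zero_ne_one hconst

namespace Dat
variable {N : ℕ} (d : Dat N)

noncomputable def H (x : E N) : ℝ := sqrt (d.q x ^ 2 - 2 * d.s x + 1)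

lemma cont_H : ContinuousOn d.H {0}ᶜ := by
  refine ContinuousOn.sqrt ?_
  have h1 := d.cont_q
  have h2 := d.cont_s
  fun_prop

lemma fd_ell_norm {y : E N} (hy : y ≠ 0) : ‖fderiv ℝ d.ell y‖ = d.μ / ‖y‖ * d.H y := by
  have hy' := norm_pos_iff.2 hy
  have hv := d.pos y hy
  have hμ := d.hμ
  have hgr := d.grad_norm hy
  have hgi := d.grad_inner hy
  set w := (d.v y)⁻¹ • gradient d.v y + (d.μ * (‖y‖ ^ 2)⁻¹) • y with hw
  have e : fderiv ℝ d.ell y = innerSL ℝ w := by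
    rw [(d.hasFDerivAt_ell hy).fderiv]
    ext ξ
    simp [hw, inner_gradient_left]
    ring
  have e2 : ‖w‖ ^ 2 = (d.μ / ‖y‖) ^ 2 * (d.q y ^ 2 - 2 * d.s y + 1) := by
    rw [hw, norm_add_sq_real, norm_smul, norm_smul, inner_smul_left, inner_smul_right, real_inner_comm, hgi, hgr]
    rw [Real.norm_of_nonneg (by positivity), Real.norm_of_nonneg (by positivity)]
    simp only [conj_trivial]
    field_simp
    ring
  rw [e, innerSL_apply_norm]
  have e3 : ‖w‖ = sqrt (‖w‖ ^ 2) := (Real.sqrt_sq (norm_nonneg _)).symm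
  rw [e3, e2, Real.sqrt_mul (by positivity), Real.sqrt_sq (by positivity)]
  rfl

noncomputable def fs (σ τ : ℝ) (x : E N) : ℝ := exp (σ * d.ell (exp τ • x))

lemma smul_ne {x : E N} (τ : ℝ) (hx : x ≠ 0) : exp τ • x ≠ 0 := smul_ne_zero (exp_pos τ).ne' hx

lemma cont_smul {f : E N → ℝ} (hf : ContinuousOn f {0}ᶜ) (τ : ℝ) : ContinuousOn (fun x => f (exp τ • x)) {0}ᶜ :=
  hf.comp (continuous_const_smul _).continuousOn fun _ hx => smul_ne τ hx

lemma fs_cd (σ τ : ℝ) {x : E N} (hx : x ≠ 0) : ContDiffAt ℝ 1 (d.fs σ τ) x := by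
  have h1 : ContDiffAt ℝ 1 (fun x : E N => d.ell (exp τ • x)) x :=
    ContDiffAt.comp x (d.contDiffAt_ell (smul_ne τ hx)) (by fun_prop)
  exact (contDiffAt_const.mul h1).exp

lemma fs_fd {σ : ℝ} (hσ : 0 < σ) (τ : ℝ) {x : E N} (hx : x ≠ 0) :
    ‖fderiv ℝ (d.fs σ τ) x‖ = σ * d.μ / ‖x‖ * (exp (σ * d.ell (exp τ • x)) * d.H (exp τ • x)) := by
  have hy := smul_ne τ hx
  have h1 : HasFDerivAt (fun x : E N => exp τ • x) (exp τ • ContinuousLinearMap.id ℝ (E N)) x :=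
    (hasFDerivAt_id x).const_smul (exp τ)
  have h2 : HasFDerivAt (fun x : E N => d.ell (exp τ • x)) (exp τ • fderiv ℝ d.ell (exp τ • x)) x := by
    have h3 : HasFDerivAt d.ell (fderiv ℝ d.ell (exp τ • x)) (exp τ • x) := (d.hasFDerivAt_ell hy).differentiableAt.hasFDerivAt
    have := h3.comp x h1
    have e : exp τ • fderiv ℝ d.ell (exp τ • x) = (fderiv ℝ d.ell (exp τ • x)).comp (exp τ • ContinuousLinearMap.id ℝ (E N)) := by
      ext ξ; simp
    rw [e]; exact this
  have h4 := (h2.const_mul σ).exp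
  have h5 : fderiv ℝ (d.fs σ τ) x = exp (σ * d.ell (exp τ • x)) • σ • exp τ • fderiv ℝ d.ell (exp τ • x) := h4.fderiv
  rw [h5, norm_smul, norm_smul, norm_smul, d.fd_ell_norm hy, norm_smul, Real.norm_of_nonneg (exp_pos _).le,
    Real.norm_of_nonneg hσ.le, Real.norm_of_nonneg (exp_pos τ).le]
  have := norm_pos_iff.2 hx
  have := exp_pos τ
  field_simp

variable {d}

lemma HE_tendsto {σ : ℝ} (h : d.AllBd σ) {l : Filter ℝ} [l.IsCountablyGenerated]
    (hl : Tendsto (fun t : ℝ => |t|) l atTop) (a b : ℝ) :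
    Tendsto (fun τ => ∫ x in ann N (a + τ) (b + τ), exp (σ * d.ell x) * d.H x ∂(nu N)) l (nhds 0) := by
  have hp := d.hp1
  have hσ := h.pos
  have hE := tail_zero d.hN (d.energy_int h (Or.inl rfl)) hl a b
  obtain ⟨n, hn⟩ := exists_nat_ge (b - a)
  obtain ⟨C, hC, hC'⟩ := (h.e σ hσ.le).win (d.cont_exp σ) (fun x _ => (exp_pos _).le) n
  have cD : ContinuousOn (fun x => exp (σ * d.ell x) * d.D x) {0}ᶜ := (d.cont_exp σ).fun_mul d.cont_D
  have cH : ContinuousOn (fun x => exp (σ * d.ell x) * d.H x) {0}ᶜ := (d.cont_exp σ).fun_mul d.cont_H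
  refine small_of (A := C) hC (fun κ hκ => ?_) hE
  obtain ⟨Cκ, hCκ, hδ⟩ := grad_small hp hκ
  refine ⟨Cκ, hCκ, fun τ => ?_⟩
  have c1 : ContinuousOn (fun x => κ * exp (σ * d.ell x)) {0}ᶜ := continuousOn_const.fun_mul (d.cont_exp σ)
  have c2 : ContinuousOn (fun x => Cκ * (exp (σ * d.ell x) * d.D x)) {0}ᶜ := continuousOn_const.fun_mul cD
  have h0 : 0 ≤ ∫ x in ann N (a + τ) (b + τ), exp (σ * d.ell x) * d.H x ∂(nu N) :=
    setIntegral_nonneg (measurableSet_ann _ _) fun x _ => mul_nonneg (exp_pos _).le (Real.sqrt_nonneg _)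
  rw [abs_of_nonneg h0]
  calc _ ≤ ∫ x in ann N (a + τ) (b + τ), (κ * exp (σ * d.ell x) + Cκ * (exp (σ * d.ell x) * d.D x)) ∂(nu N) := by
        refine setIntegral_mono_on (integrableOn_ann cH _ _) (integrableOn_ann (c1.fun_add c2) _ _) (measurableSet_ann _ _) fun x hx => ?_
        have := mul_le_mul_of_nonneg_left (hδ _ _ (d.abs_s_le (ne_zero_of_mem_ann hx))) (exp_pos (σ * d.ell x)).le
        refine this.trans (le_of_eq ?_)
        show exp (σ * d.ell x) * (κ + Cκ * d.D x) = _
        ring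
    _ = κ * (∫ x in ann N (a + τ) (b + τ), exp (σ * d.ell x) ∂(nu N)) + Cκ * ∫ x in ann N (a + τ) (b + τ), exp (σ * d.ell x) * d.D x ∂(nu N) := by
        rw [integral_add (integrableOn_ann c1 _ _) (integrableOn_ann c2 _ _), integral_const_mul, integral_const_mul]
    _ ≤ _ := by
        have := hC' (a + τ) (b + τ) (by linarith)
        gcongr

lemma fd_tendsto {σ : ℝ} (h : d.AllBd σ) {l : Filter ℝ} [l.IsCountablyGenerated]
    (hl : Tendsto (fun t : ℝ => |t|) l atTop) (a b : ℝ) :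
    Tendsto (fun τ => ∫⁻ x in ann N a b, ‖fderiv ℝ (d.fs σ τ) x‖ₑ) l (nhds 0) := by
  have hσ := h.pos
  have hμ := d.hμ
  set K := σ * d.μ * (exp a)⁻¹ * exp b ^ N with hK
  have hK0 : 0 ≤ K := by positivity
  have h1 := ((HE_tendsto h hl a b).const_mul K)
  rw [mul_zero] at h1
  have h2 := ENNReal.tendsto_ofReal h1
  rw [ENNReal.ofReal_zero] at h2
  refine tendsto_of_tendsto_of_tendsto_of_le_of_le tendsto_const_nhds h2 (fun _ => zero_le) fun τ => ?_
  have cH : ContinuousOn (fun x => exp (σ * d.ell x) * d.H x) {0}ᶜ := (d.cont_exp σ).fun_mul d.cont_H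
  have cH2 := cont_smul cH τ
  have cN : ContinuousOn (fun x : E N => (‖x‖ ^ N)⁻¹) {0}ᶜ := by
    refine ContinuousOn.inv₀ (by fun_prop) fun x hx => ?_
    have := norm_pos_iff.2 hx
    positivity
  have c3 : ContinuousOn (fun x : E N => (‖x‖ ^ N)⁻¹ * (exp (σ * d.ell (exp τ • x)) * d.H (exp τ • x))) {0}ᶜ := cN.fun_mul cH2
  have c4 : IntegrableOn (fun x : E N => K * ((‖x‖ ^ N)⁻¹ * (exp (σ * d.ell (exp τ • x)) * d.H (exp τ • x)))) (ann N a b) volume :=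
    ((continuousOn_const.fun_mul c3).mono (ann_subset a b)).integrableOn_compact (isCompact_ann a b)
  show _ ≤ ENNReal.ofReal (K * ∫ x in ann N (a + τ) (b + τ), exp (σ * d.ell x) * d.H x ∂(nu N))
  rw [← ann_smul (fun x => exp (σ * d.ell x) * d.H x), ann_nu, ← integral_const_mul, ofReal_integral_eq_lintegral_ofReal c4]
  · refine setLIntegral_mono' (measurableSet_ann _ _) fun x hx => ?_
    have hx0 := ne_zero_of_mem_ann hx
    have hxp := norm_pos_iff.2 hx0
    rw [← ofReal_norm]
    refine ENNReal.ofReal_le_ofReal ?_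
    rw [d.fs_fd hσ τ hx0, ← mul_assoc K]
    refine mul_le_mul_of_nonneg_right ?_ (mul_nonneg (exp_pos _).le (Real.sqrt_nonneg _))
    rw [hK, mul_assoc _ (exp b ^ N), div_eq_mul_inv]
    have e1 : ‖x‖⁻¹ ≤ (exp a)⁻¹ := inv_anti₀ (exp_pos _) hx.1
    have e2 : 1 ≤ exp b ^ N * (‖x‖ ^ N)⁻¹ := by
      rw [← div_eq_mul_inv, one_le_div (by positivity)]
      exact pow_le_pow_left₀ hxp.le hx.2 N
    calc σ * d.μ * ‖x‖⁻¹ ≤ σ * d.μ * (exp a)⁻¹ * 1 := by rw [mul_one]; gcongr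
      _ ≤ _ := by gcongr
  · refine Eventually.of_forall fun x => ?_
    have := Real.sqrt_nonneg (d.q (exp τ • x) ^ 2 - 2 * d.s (exp τ • x) + 1)
    show 0 ≤ K * ((‖x‖ ^ N)⁻¹ * (exp (σ * d.ell (exp τ • x)) * sqrt _))
    positivity

lemma wA_scale (d : Dat N) (s τ : ℝ) : d.wA s τ = ∫ x, T' (log ‖x‖) * exp (s * d.ell (exp τ • x)) ∂(nu N) := by
  unfold wA win
  rw [← integral_nu_smul (exp_pos τ)]
  refine integral_congr_ae ?_
  filter_upwards [ae_nu_ne_zero d.hN] with x hx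
  have := norm_pos_iff.2 hx
  rw [norm_smul, Real.norm_of_nonneg (exp_pos τ).le, log_mul (exp_pos τ).ne' this.ne', log_exp]
  congr 2; ring

lemma jensen {σ : ℝ} (h : d.AllBd σ) {m : ℕ} (hm : 1 ≤ m) (hmp : d.p = m * σ) {l : Filter ℝ} [l.IsCountablyGenerated]
    (hl : Tendsto (fun t : ℝ => |t|) l atTop) :
    Tendsto (fun τ => (ZZ N)⁻¹ * d.wA d.p τ - ((ZZ N)⁻¹ * d.wA σ τ) ^ m) l (nhds 0) := by
  have hN := d.hN
  have hσ := h.pos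
  have hc : ∀ τ, ContinuousOn (d.fs σ τ) {0}ᶜ := fun τ => cont_smul (d.cont_exp σ) τ
  have hpow : ∀ (n : ℕ) τ x, d.fs σ τ x ^ n = exp ((n * σ) * d.ell (exp τ • x)) := by
    intro n τ x
    unfold fs
    rw [← Real.exp_nat_mul]; congr 1; ring
  have hs := spr_zero hN (F := d.fs σ) (l := l) (fun τ => aem_of_cont hN (hc τ)) (fun τ x hx => d.fs_cd σ τ hx)
    (fd_tendsto h hl) (isCompact_ann 0 1) (ann_subset 0 1)
  have key := rev_jensen hN (ZZ_pos hN) hc (fun τ x => (exp_pos _).le) hs (fun n => ?_) hm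
  · refine key.congr fun τ => ?_
    simp_rw [hpow, ← hmp]
    rw [wA_scale, wA_scale]
    rfl
  · obtain ⟨C, hC, hC'⟩ := h.e (n * σ) (by positivity)
    refine ⟨C, hC, fun τ => ?_⟩
    simp_rw [hpow]
    rw [ann_smul (fun x => exp ((n * σ) * d.ell x)), zero_add, add_comm 1 τ]
    exact hC' τ

end Dat
end RS

namespace RS
namespace Dat
variable {N : ℕ} (d : Dat N)

lemma exists_sigma : ∃ m : ℕ, 1 ≤ m ∧ d.AllBd (d.p / m) := by
  have hp := d.hp1
  have hl := d.hlam
  obtain ⟨n, hn⟩ := exists_nat_ge (2 * d.lam * d.p / (d.p - 1))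
  have hp' : 0 < d.p - 1 := by linarith
  have hpos : 0 < 2 * d.lam * d.p / (d.p - 1) := by positivity
  have hn0 : (0:ℝ) < n := by linarith
  have hσ : 0 < d.p / n := by positivity
  have hs : d.lam * (d.p / n) ≤ (d.p - 1) / 2 := by
    rw [div_le_iff₀ hp'] at hn
    rw [← mul_div_assoc, div_le_div_iff₀ hn0 two_pos]
    linarith
  refine ⟨n, Nat.one_le_iff_ne_zero.2 (by rintro rfl; simp at hn0), hσ, hs, fun s h => ?_⟩
  exact d.bd_all hσ (d.init_bd hσ hs) h

lemma energy_zero {m : ℕ} (hm : 1 ≤ m) (h : d.AllBd (d.p / m)) (n : ℝ) :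
    ∫ x in ann N (-n) n, exp (d.p / m * d.ell x) * d.D x ∂(nu N) ≤ 0 := by
  by_contra! he
  set σ := d.p / m with hσd
  set e := ∫ x in ann N (-n) n, exp (σ * d.ell x) * d.D x ∂(nu N)
  have hp := d.hp1
  have hμ := d.hμ
  have hσ := h.pos
  have hZ := ZZ_pos d.hN
  have hm0 : (0:ℝ) < m := by exact_mod_cast hm
  have hmp : d.p = m * σ := by rw [hσd]; field_simp
  set Z := ZZ N
  have labs : Tendsto (fun t : ℝ => |t|) atTop atTop := tendsto_abs_atTop_atTop
  have labs' : Tendsto (fun t : ℝ => |t|) atBot atTop := tendsto_abs_atBot_atTop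
  have D1 := d.wD_tendsto h (Or.inl rfl) labs
  have D2 := (d.wD_tendsto h (Or.inl rfl) labs').comp tendsto_neg_atTop_atBot
  have D3 := d.wD_tendsto h (Or.inr rfl) labs
  have D4 := (d.wD_tendsto h (Or.inr rfl) labs').comp tendsto_neg_atTop_atBot
  have J1 := jensen h hm hmp labs
  have J2 := (jensen h hm hmp labs').comp tendsto_neg_atTop_atBot
  set α : ℝ → ℝ := fun τ => Z⁻¹ * d.wA σ τ with hα
  have hα0 : ∀ τ, 0 ≤ α τ := fun τ => mul_nonneg (inv_nonneg.2 hZ.le)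
    (integral_nonneg fun x => mul_nonneg (T'_nonneg _) (exp_pos _).le)
  have hp' : 0 < d.p - 1 := by linarith
  -- first inequality
  set δ := Z⁻¹ * (σ * (d.p - 1)⁻¹ * (d.μ * (d.p - 1) / 2 * e)) with hδ
  have hδ0 : 0 < δ := by positivity
  have L1 : Tendsto (fun τ => Z⁻¹ * (σ * (d.p - 1)⁻¹ * (d.lam * (d.wD σ (-τ) - d.wD σ τ)))) atTop (nhds 0) := by
    have := ((D2.sub D1).const_mul d.lam).const_mul (σ * (d.p - 1)⁻¹) |>.const_mul Z⁻¹
    simpa using this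
  have L2 : Tendsto (fun τ => Z⁻¹ * (d.p * (d.p - 1)⁻¹ * (d.lam * (d.wD d.p (-τ) - d.wD d.p τ)))) atTop (nhds 0) := by
    have := ((D4.sub D3).const_mul d.lam).const_mul (d.p * (d.p - 1)⁻¹) |>.const_mul Z⁻¹
    simpa using this
  have ev1 := L1.eventually_lt_const (show 0 < δ / 2 by linarith)
  have hη : 0 < (δ / 2) ^ m := by positivity
  have L3 := (L2.add J2).sub J1
  rw [add_zero, sub_zero] at L3
  have L4 : Tendsto (fun τ => (Z⁻¹ * d.wA d.p τ - α τ ^ m) - (Z⁻¹ * d.wA d.p (-τ) - α (-τ) ^ m) +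
      Z⁻¹ * (d.p * (d.p - 1)⁻¹ * (d.lam * (d.wD d.p (-τ) - d.wD d.p τ)))) atTop (nhds 0) := by
    have := (J1.sub J2).add L2
    simpa using this
  have ev2 := L4.eventually (lt_mem_nhds (show -(δ / 2) ^ m < 0 by linarith))
  obtain ⟨τ, h1, h2, h3, h4⟩ := (ev1.and (ev2.and ((eventually_ge_atTop (|n| + 1)).and (eventually_ge_atTop 0)))).exists
  have hτ : -τ ≤ τ := by linarith
  have low := d.low_win h hτ
  have up := d.up_win hτ
  have up0 : 0 ≤ d.μ * ∫ x in ann N (-τ + 1) τ, exp (d.p * d.ell x) * d.D x ∂(nu N) :=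
    mul_nonneg hμ.le (setIntegral_nonneg (measurableSet_ann _ _) fun x hx => mul_nonneg (exp_pos _).le (d.D_nonneg (ne_zero_of_mem_ann hx)))
  have lowe : e ≤ ∫ x in ann N (-τ + 1) τ, exp (σ * d.ell x) * d.D x ∂(nu N) := by
    refine ann_mono_int ((d.cont_exp σ).mul d.cont_D) (fun x hx => mul_nonneg (exp_pos _).le (d.D_nonneg hx)) ?_ ?_
    · linarith [le_abs_self n]
    · linarith [le_abs_self n]
  have low2 : (d.p - 1) * σ⁻¹ * (d.wA σ (-τ) - d.wA σ τ) - d.lam * (d.wD σ (-τ) - d.wD σ τ) ≤ - (d.μ * (d.p - 1) / 2 * e) :=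
    low.trans (neg_le_neg (mul_le_mul_of_nonneg_left lowe (by positivity)))
  have a1 : α (-τ) - α τ ≤ Z⁻¹ * (σ * (d.p - 1)⁻¹ * (d.lam * (d.wD σ (-τ) - d.wD σ τ))) - δ := by
    have := mul_le_mul_of_nonneg_left low2 (show 0 ≤ Z⁻¹ * (σ * (d.p - 1)⁻¹) by positivity)
    have e1 : Z⁻¹ * (σ * (d.p - 1)⁻¹) * ((d.p - 1) * σ⁻¹ * (d.wA σ (-τ) - d.wA σ τ) - d.lam * (d.wD σ (-τ) - d.wD σ τ)) =
        (α (-τ) - α τ) - Z⁻¹ * (σ * (d.p - 1)⁻¹ * (d.lam * (d.wD σ (-τ) - d.wD σ τ))) := by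
      simp only [hα]; field_simp
    rw [e1] at this
    rw [hδ]
    linarith
  have a2 : α (-τ) + δ / 2 ≤ α τ := by linarith
  have a3 : α (-τ) ^ m + (δ / 2) ^ m ≤ α τ ^ m :=
    (pow_add_pow_le (hα0 _) (by positivity) (by omega)).trans (pow_le_pow_left₀ (by have := hα0 (-τ); positivity) a2 m)
  have a4 : Z⁻¹ * (d.p * (d.p - 1)⁻¹ * (d.lam * (d.wD d.p (-τ) - d.wD d.p τ))) ≤ Z⁻¹ * d.wA d.p (-τ) - Z⁻¹ * d.wA d.p τ := by
    have := mul_le_mul_of_nonneg_left (up0.trans up) (show 0 ≤ Z⁻¹ * (d.p * (d.p - 1)⁻¹) by positivity)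
    have e1 : Z⁻¹ * (d.p * (d.p - 1)⁻¹) * ((d.p - 1) * d.p⁻¹ * (d.wA d.p (-τ) - d.wA d.p τ) - d.lam * (d.wD d.p (-τ) - d.wD d.p τ)) =
        (Z⁻¹ * d.wA d.p (-τ) - Z⁻¹ * d.wA d.p τ) - Z⁻¹ * (d.p * (d.p - 1)⁻¹ * (d.lam * (d.wD d.p (-τ) - d.wD d.p τ))) := by
      have : d.p ≠ 0 := by linarith
      field_simp
    rw [e1, mul_zero] at this
    linarith
  linarith

lemma D_zero {x : E N} (hx : x ≠ 0) : d.D x = 0 := by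
  obtain ⟨m, hm, h⟩ := d.exists_sigma
  set σ := d.p / m
  have hi := d.energy_int h (Or.inl rfl)
  have hc : ContinuousOn (fun x => exp (σ * d.ell x) * d.D x) {0}ᶜ := (d.cont_exp σ).fun_mul d.cont_D
  have h0 : ∀ x, x ≠ 0 → 0 ≤ exp (σ * d.ell x) * d.D x := fun x hx => mul_nonneg (exp_pos _).le (d.D_nonneg hx)
  have cov : AECover (nu N) atTop (fun n : ℕ => ann N (-(n:ℝ)) n) := by
    refine ⟨?_, fun n => measurableSet_ann _ _⟩
    filter_upwards [ae_nu_ne_zero d.hN] with x hx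
    have := tendsto_natCast_atTop_atTop (R := ℝ) |>.eventually_ge_atTop |log ‖x‖|
    filter_upwards [this] with n hn
    rw [mem_ann_iff hx]
    exact abs_le.1 hn
  have t := cov.integral_tendsto_of_countably_generated hi
  have h1 : ∫ x, exp (σ * d.ell x) * d.D x ∂(nu N) ≤ 0 := le_of_tendsto t (Eventually.of_forall fun n => d.energy_zero hm h n)
  have h2 : 0 ≤ ∫ x, exp (σ * d.ell x) * d.D x ∂(nu N) := integral_nonneg_of_ae (by
    filter_upwards [ae_nu_ne_zero d.hN] with x hx using h0 x hx)
  have := zero_of_int d.hN hc h0 hi (le_antisymm h1 h2) x hx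
  exact (mul_eq_zero.1 this).resolve_left (exp_pos _).ne'

lemma ell_const : ∃ a : ℝ, ∀ x : E N, x ≠ 0 → d.ell x = a := by
  have hcon : IsPreconnected ({0}ᶜ : Set (E N)) := by
    refine (isConnected_compl_singleton_of_one_lt_rank ?_ _).isPreconnected
    rw [← Module.finrank_eq_rank, finrank_euclideanSpace_fin]
    have := d.hN
    exact_mod_cast (by omega : 1 < N)
  obtain ⟨a, ha⟩ := isOpen_compl_singleton.exists_is_const_of_fderiv_eq_zero (𝕜 := ℝ) hcon (f := d.ell)
    (fun x hx => (d.hasFDerivAt_ell hx).differentiableAt.differentiableWithinAt) (fun x hx => by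
      have h1 := DD_zero d.hp1 (d.abs_s_le hx) (d.D_zero hx)
      have : d.H x = 0 := by
        unfold H; rw [h1.1, h1.2]; norm_num
      have h2 := d.fd_ell_norm hx
      rw [this, mul_zero] at h2
      exact norm_eq_zero.1 h2)
  exact ⟨a, fun x hx => ha x hx⟩

lemma final : ∃ g : ℝ → ℝ, StrictAntiOn g (Set.Ioi 0) ∧ ∀ x : E N, x ≠ 0 → d.v x = g ‖x‖ := by
  obtain ⟨a, ha⟩ := d.ell_const
  have hμ := d.hμ
  refine ⟨fun r => exp (a - d.μ * log r), ?_, ?_⟩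
  · intro r hr t ht hrt
    have := Real.log_lt_log hr hrt
    exact exp_lt_exp.2 (by nlinarith)
  · intro x hx
    have h1 := ha x hx
    have h2 : log (d.v x) = a - d.μ * log ‖x‖ := by
      rw [← h1]; unfold ell; ring
    show _ = exp (a - d.μ * log ‖x‖)
    rw [← h2, exp_log (d.pos x hx)]

end Dat
end RS

/-- A positive `C^1` solution of `-Δ_p v - γ |x|^{-p} v^{p-1} = 0` in
`ℝ^N \ {0}` blowing up at the origin and with the decay `v ≍ |x|^{-γ₂}` at infinity
is radial and strictly radially decreasing. -/
theorem radial_symmetry_singular_homogeneous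
    (N : ℕ) (hN : 2 ≤ N) (p γ : ℝ) (hp1 : 1 < p) (hpN : p < N)
    (hγ0 : 0 < γ) (hγ : γ < ((N - p) / p) ^ p)
    (γ₂ : ℝ)
    (hγ₂root : (p - 1) * γ₂ ^ p - (N - p) * γ₂ ^ (p - 1) + γ = 0)
    (hγ₂lb : (N - p) / p < γ₂) (hγ₂ub : γ₂ ≤ (N - p) / (p - 1))
    (hγ₂max : ∀ μ : ℝ, 0 ≤ μ →
      (p - 1) * μ ^ p - (N - p) * μ ^ (p - 1) + γ = 0 → μ ≤ γ₂)
    (v : EuclideanSpace ℝ (Fin N) → ℝ)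
    (hpos : ∀ x : EuclideanSpace ℝ (Fin N), x ≠ 0 → 0 < v x)
    (hreg : ContDiffOn ℝ 1 v {(0 : EuclideanSpace ℝ (Fin N))}ᶜ)
    (hweak : ∀ φ : EuclideanSpace ℝ (Fin N) → ℝ,
      ContDiff ℝ (⊤ : ℕ∞) φ → HasCompactSupport φ →
      tsupport φ ⊆ {(0 : EuclideanSpace ℝ (Fin N))}ᶜ →
      (∫ x, ‖gradient v x‖ ^ (p - 2) * ⟪gradient v x, gradient φ x⟫)
        = γ * ∫ x, ‖x‖ ^ (-p) * v x ^ (p - 1) * φ x)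
    (hblow : Tendsto v (nhdsWithin 0 {(0 : EuclideanSpace ℝ (Fin N))}ᶜ) atTop)
    (c C R₁ : ℝ) (hc : 0 < c) (hC : 0 < C) (hR₁ : 0 < R₁)
    (hdecay : ∀ x : EuclideanSpace ℝ (Fin N), R₁ < ‖x‖ →
      c * ‖x‖ ^ (-γ₂) ≤ v x ∧ v x ≤ C * ‖x‖ ^ (-γ₂)) :
    ∃ g : ℝ → ℝ, StrictAntiOn g (Set.Ioi 0) ∧
      ∀ x : EuclideanSpace ℝ (Fin N), x ≠ 0 → v x = g ‖x‖ := by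
  exact RS.Dat.final (N := N)
    { p := p, μ := γ₂, γ := γ, C := C, R := R₁, v := v, hN := hN, hp1 := hp1, hpN := hpN, root := hγ₂root,
      lb := hγ₂lb, ub := hγ₂ub, pos := hpos, reg := hreg, weak := hweak, hR := hR₁, hC := hC,
      decay := fun x hx => (hdecay x hx).2 }
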